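/- Let (u_p)_{p>1} be a family of low energy nodal solutions of (P_p) and fix ϱ ∈ (0, ϱ₀/2]. Then the constants C_{i,p} := ∫_{B_ϱ(x_{i,p})} |u_p(x)|^p dx satisfy C_{i,p} = (8π√e/p)(1 + O(log p / p)) as p → ∞, for i = 1,2. -/

import Mathlib

open Real MeasureTheory Metric Filter Topology Bornology

noncomputable section

abbrev E2 : Type := EuclideanSpace ℝ (Fin 2)

/-- Laplacian of `u : ℝ² → ℝ` via coordinate second derivatives. -/
def lap (u : E2 → ℝ) (x : E2) : ℝ :=
  ∑ i : Fin 2,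
    fderiv ℝ (fun y => fderiv ℝ u y (EuclideanSpace.single i 1)) x (EuclideanSpace.single i 1)

/-- `u` is a (classical) solution of the Lane–Emden problem `(P_p)` on `Ω`. -/
def IsSolution (Ω : Set E2) (p : ℝ) (u : E2 → ℝ) : Prop :=
  ContDiffOn ℝ 2 u Ω ∧ ContinuousOn u (closure Ω) ∧
    (∀ x ∈ Ω, -lap u x = |u x| ^ (p - 1) * u x) ∧
    (∀ x ∈ frontier Ω, u x = 0)

/-- `u` is a nodal (sign-changing) function on `Ω`. -/
def IsNodal (Ω : Set E2) (u : E2 → ℝ) : Prop :=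
  (∃ x ∈ Ω, 0 < u x) ∧ (∃ x ∈ Ω, u x < 0)

/-- The Green function of `-Δ` on `Ω` with Dirichlet boundary conditions, together with
its regular part `H`, so that `G(x,y) = -(1/2π) log|x-y| + H(x,y)`. -/
structure GreenData (Ω : Set E2) where
  G : E2 → E2 → ℝ
  H : E2 → E2 → ℝ
  decomp : ∀ x y, G x y = -(1 / (2 * π)) * Real.log ‖x - y‖ + H x y
  bdry : ∀ x ∈ Ω, ∀ y ∈ frontier Ω, G x y = 0
  symm : ∀ x y, G x y = G y x
  smoothH : ContDiffOn ℝ (⊤ : ℕ∞) (fun q : E2 × E2 => H q.1 q.2) (Ω ×ˢ Ω)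
  contH : ∀ x ∈ Ω, ContinuousOn (H x) (closure Ω)
  harmH : ∀ x ∈ Ω, ∀ y ∈ Ω, lap (H x) y = 0

/-- The Kirchhoff–Routh type function `Ψ(a₁,a₂) = 2G(a₁,a₂) − R(a₁) − R(a₂)`. -/
def KR {Ω : Set E2} (gd : GreenData Ω) (q : E2 × E2) : ℝ :=
  2 * gd.G q.1 q.2 - gd.H q.1 q.1 - gd.H q.2 q.2

/-- `q` is a non-degenerate critical point of `F`. -/
def NondegCrit (F : E2 × E2 → ℝ) (q : E2 × E2) : Prop :=
  fderiv ℝ F q = 0 ∧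
    ∀ v : E2 × E2, (∀ w : E2 × E2, fderiv ℝ (fun r => fderiv ℝ F r) q v w = 0) → v = 0

/-- Convergence in `C²_loc(S)`: uniform convergence of all derivatives of order `≤ 2`
on compact subsets of `S`. -/
def TendstoC2LocOn (S : Set E2) (F : ℕ → E2 → ℝ) (g : E2 → ℝ) : Prop :=
  ∀ K : Set E2, K ⊆ S → IsCompact K → ∀ k : ℕ, k ≤ 2 →
    TendstoUniformlyOn (fun n x => iteratedFDeriv ℝ k (F n) x)
      (fun x => iteratedFDeriv ℝ k g x) atTop K

/-- `‖u⁺‖_∞` on `closure Ω`. -/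
def supPos (Ω : Set E2) (u : E2 → ℝ) : ℝ := sSup ((fun x => max (u x) 0) '' closure Ω)

/-- `‖u⁻‖_∞` on `closure Ω`. -/
def supNeg (Ω : Set E2) (u : E2 → ℝ) : ℝ := sSup ((fun x => max (-u x) 0) '' closure Ω)

/-- The energy functional `J_p`. -/
def energy (Ω : Set E2) (p : ℝ) (u : E2 → ℝ) : ℝ :=
  (1 / 2) * (∫ x in Ω, ‖fderiv ℝ u x‖ ^ 2) - (1 / (p + 1)) * ∫ x in Ω, |u x| ^ (p + 1)

/-- The standard bubble `U(z) = −2 log(1 + |z|²/8)`. -/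
def Ustd (z : E2) : ℝ := -2 * Real.log (1 + ‖z‖ ^ 2 / 8)

/-- Unit vector at angle `θ`. -/
def circDir (θ : ℝ) : E2 :=
  EuclideanSpace.single 0 (Real.cos θ) + EuclideanSpace.single 1 (Real.sin θ)

/-- Surface integral over the circle `∂B_r(c)`; the integrand may depend on the
outer unit normal (first argument) and on the point (second argument). -/
def surfInt (c : E2) (r : ℝ) (F : E2 → E2 → ℝ) : ℝ :=
  ∫ θ in (0:ℝ)..(2 * π), r * F (circDir θ) (c + r • circDir θ)

/-- Inner product of gradients `⟨∇f, ∇g⟩`. -/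
def gradInner (f g : E2 → ℝ) (x : E2) : ℝ :=
  ∑ j : Fin 2, fderiv ℝ f x (EuclideanSpace.single j 1) *
    fderiv ℝ g x (EuclideanSpace.single j 1)

/-- The quadratic form `P_i` (centred at `c`, radius `r`). -/
def Pform (c : E2) (r : ℝ) (f g : E2 → ℝ) : ℝ :=
  -2 * r * surfInt c r (fun ν x => fderiv ℝ f x ν * fderiv ℝ g x ν) +
    r * surfInt c r (fun _ x => gradInner f g x)

/-- The quadratic form `Q_{ij}` (centred at `c`, radius `r`). -/
def Qform (c : E2) (r : ℝ) (j : Fin 2) (f g : E2 → ℝ) : ℝ :=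
  surfInt c r (fun ν x =>
    -(fderiv ℝ f x (EuclideanSpace.single j 1)) * fderiv ℝ g x ν -
      fderiv ℝ f x ν * fderiv ℝ g x (EuclideanSpace.single j 1) +
      gradInner f g x * ν j)


/-- Coordinate vectors. -/
abbrev eb (i : Fin 2) : E2 := EuclideanSpace.single i 1

lemma radial_integral (f : ℝ → ℝ) :
    ∫ x : E2, f ‖x‖ = 2 * π * ∫ y in Set.Ioi (0:ℝ), y * f y := by
  have h := integral_fun_norm_addHaar (volume : Measure E2) f
  rw [h]
  have h2 : (volume : Measure E2).real (ball 0 1) = π := by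
    simp [Measure.real, Real.pi_pos.le]
  simp [h2]
  ring

lemma radial_integrable (f : ℝ → ℝ) :
    Integrable (fun x : E2 => f ‖x‖) ↔ IntegrableOn (fun y : ℝ => y * f y) (Set.Ioi 0) := by
  have h := integrable_fun_norm_addHaar (volume : Measure E2) (f := f)
  rw [h]
  simp

/-- Truncated kernel `1/|z|` on the ball of radius `s`. -/
def K1 (s : ℝ) (z : E2) : ℝ := (Set.Ioo 0 s).indicator (fun r : ℝ => r⁻¹) ‖z‖

lemma K1_aux (s : ℝ) :
    Set.EqOn (fun y : ℝ => y * (Set.Ioo 0 s).indicator (fun r : ℝ => r⁻¹) y)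
      ((Set.Ioo 0 s).indicator (fun _ => (1:ℝ))) (Set.Ioi 0) := by
  intro y hy
  have hy' : (0:ℝ) < y := hy
  by_cases h : y ∈ Set.Ioo 0 s
  · simp [h, hy'.ne']
  · simp [h]

lemma K1_integrable (s : ℝ) : Integrable (K1 s) := by
  unfold K1
  rw [radial_integrable, integrableOn_congr_fun (K1_aux s) measurableSet_Ioi]
  apply Integrable.integrableOn
  rw [integrable_indicator_iff measurableSet_Ioo]
  exact integrableOn_const (by simp)

lemma K1_integral {s : ℝ} (hs : 0 ≤ s) : ∫ z, K1 s z = 2 * π * s := by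
  unfold K1
  rw [radial_integral, setIntegral_congr_fun measurableSet_Ioi (K1_aux s),
    setIntegral_indicator measurableSet_Ioo,
    Set.inter_eq_self_of_subset_right (fun y hy => hy.1)]
  simp [hs]

lemma K1_nonneg (s : ℝ) (z : E2) : 0 ≤ K1 s z := by
  unfold K1
  apply Set.indicator_nonneg
  intro r hr
  exact inv_nonneg.2 hr.1.le

lemma K1_of_lt {s : ℝ} {z : E2} (h : ‖z‖ < s) : K1 s z = ‖z‖⁻¹ := by
  unfold K1
  by_cases hz : 0 < ‖z‖
  · simp [hz, h]
  · have : ‖z‖ = 0 := le_antisymm (not_lt.1 hz) (norm_nonneg _)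
    simp [this]

lemma K1_neg (s : ℝ) (z : E2) : K1 s (-z) = K1 s z := by
  unfold K1; rw [norm_neg]

/-- Kernel `1/|z|^2` on an annulus. -/
def K2 (s D : ℝ) (z : E2) : ℝ := (Set.Icc s D).indicator (fun r : ℝ => (r ^ 2)⁻¹) ‖z‖

lemma K2_aux (s D : ℝ) :
    Set.EqOn (fun y : ℝ => y * (Set.Icc s D).indicator (fun r : ℝ => (r ^ 2)⁻¹) y)
      ((Set.Icc s D).indicator (fun y => y⁻¹)) (Set.Ioi 0) := by
  intro y hy
  have hy' : (0:ℝ) < y := hy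
  by_cases h : y ∈ Set.Icc s D
  · simp only [Set.indicator_of_mem h]; field_simp
  · simp [h]

lemma K2_integrable {s : ℝ} (D : ℝ) (hs : 0 < s) : Integrable (K2 s D) := by
  unfold K2
  rw [radial_integrable, integrableOn_congr_fun (K2_aux s D) measurableSet_Ioi]
  apply Integrable.integrableOn
  rw [integrable_indicator_iff measurableSet_Icc]
  apply ContinuousOn.integrableOn_Icc
  exact continuousOn_inv₀.mono (fun y hy => (hs.trans_le hy.1).ne')

lemma K2_integral {s D : ℝ} (hs : 0 < s) (hD : s ≤ D) :
    ∫ z, K2 s D z = 2 * π * Real.log (D / s) := by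
  unfold K2
  rw [radial_integral, setIntegral_congr_fun measurableSet_Ioi (K2_aux s D),
    setIntegral_indicator measurableSet_Icc,
    Set.inter_eq_self_of_subset_right
      (show Set.Icc s D ⊆ Set.Ioi 0 from fun y hy => hs.trans_le hy.1),
    integral_Icc_eq_integral_Ioc, ← intervalIntegral.integral_of_le hD,
    integral_inv_of_pos hs (hs.trans_le hD)]

lemma K2_nonneg (s D : ℝ) (z : E2) : 0 ≤ K2 s D z := by
  unfold K2
  apply Set.indicator_nonneg
  intro r hr
  positivity

/-- Mollifier `ρ_ε` (mass one). -/
def rho (ε : ℝ) (z : E2) : ℝ := ε ^ 2 / (π * (‖z‖ ^ 2 + ε ^ 2) ^ 2)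

lemma rho_nonneg (ε : ℝ) (z : E2) : 0 ≤ rho ε z := by unfold rho; positivity

lemma rho_aux {ε : ℝ} (hε : 0 < ε) (y : ℝ) :
    HasDerivAt (fun y : ℝ => - (ε ^ 2 / (2 * π)) * (y ^ 2 + ε ^ 2)⁻¹)
      (y * (ε ^ 2 / (π * (y ^ 2 + ε ^ 2) ^ 2))) y := by
  have h1 : HasDerivAt (fun y : ℝ => y ^ 2 + ε ^ 2) (2 * y) y := by
    simpa using (hasDerivAt_pow 2 y).add_const (ε ^ 2)
  have h0 : y ^ 2 + ε ^ 2 ≠ 0 := by positivity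
  have := (h1.inv h0).const_mul (- (ε ^ 2 / (2 * π)))
  refine HasDerivAt.congr_deriv this ?_
  have := Real.pi_ne_zero
  field_simp

lemma rho_tend {ε : ℝ} :
    Tendsto (fun y : ℝ => - (ε ^ 2 / (2 * π)) * (y ^ 2 + ε ^ 2)⁻¹) atTop (𝓝 0) := by
  have : Tendsto (fun y : ℝ => (y ^ 2 + ε ^ 2)⁻¹) atTop (𝓝 0) :=
    (tendsto_atTop_add_const_right _ _ (tendsto_pow_atTop two_ne_zero)).inv_tendsto_atTop
  simpa using this.const_mul (- (ε ^ 2 / (2 * π)))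

lemma rho_integrable {ε : ℝ} (hε : 0 < ε) : Integrable (rho ε) := by
  unfold rho
  rw [radial_integrable (fun y => ε ^ 2 / (π * (y ^ 2 + ε ^ 2) ^ 2))]
  refine integrableOn_Ioi_deriv_of_nonneg' (fun y _ => rho_aux hε y) ?_ rho_tend
  intro y hy
  have : (0:ℝ) < y := hy
  positivity

lemma rho_integral {ε : ℝ} (hε : 0 < ε) : ∫ z, rho ε z = 1 := by
  unfold rho
  rw [radial_integral (fun y => ε ^ 2 / (π * (y ^ 2 + ε ^ 2) ^ 2))]
  rw [integral_Ioi_of_hasDerivAt_of_nonneg' (fun y _ => rho_aux hε y) ?_ rho_tend]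
  · have := Real.pi_ne_zero
    field_simp
    simp
  · intro y hy
    have : (0:ℝ) < y := hy
    positivity

lemma rho_scale {ε : ℝ} (hε : 0 < ε) (z : E2) : rho ε (ε • z) = (ε ^ 2)⁻¹ * rho 1 z := by
  unfold rho
  rw [norm_smul, Real.norm_of_nonneg hε.le]
  have := Real.pi_ne_zero
  have h0 : ‖z‖ ^ 2 + 1 ≠ 0 := by positivity
  have h1 : ε ^ 2 * ‖z‖ ^ 2 + ε ^ 2 ≠ 0 := by positivity
  field_simp

lemma rho_tendsto (w : E2 → ℝ) (hw : Continuous w) (hc : HasCompactSupport w) (x : E2) :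
    Tendsto (fun ε : ℝ => ∫ y, rho ε (x - y) * w y) (𝓝[>] 0) (𝓝 (w x)) := by
  obtain ⟨B, hB⟩ := hc.exists_bound_of_continuous hw
  have key : ∀ ε ∈ Set.Ioi (0:ℝ), ∫ y, rho ε (x - y) * w y
      = ∫ z, rho 1 z * w (x - ε • z) := by
    intro ε hε
    have hε' : (0:ℝ) < ε := hε
    have h1 := integral_sub_left_eq_self (fun z => rho ε z * w (x - z)) (volume : Measure E2) x
    simp only [sub_sub_cancel] at h1
    rw [h1]
    have h2 := Measure.integral_comp_smul (volume : Measure E2)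
      (fun z => rho ε z * w (x - z)) ε
    simp only [rho_scale hε'] at h2
    have h3 : Module.finrank ℝ E2 = 2 := by simp
    rw [h3, abs_of_nonneg (by positivity), smul_eq_mul] at h2
    simp only [mul_assoc] at h2
    rw [integral_const_mul] at h2
    have : (ε ^ 2)⁻¹ ≠ 0 := by positivity
    exact (mul_left_cancel₀ this h2).symm
  have lim : Tendsto (fun ε : ℝ => ∫ z, rho 1 z * w (x - ε • z)) (𝓝[>] 0)
      (𝓝 (∫ z, rho 1 z * w x)) := by
    apply tendsto_integral_filter_of_dominated_convergence (fun z => rho 1 z * B)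
    · filter_upwards with ε
      apply ((rho_integrable one_pos).aestronglyMeasurable).mul
      exact (hw.comp (by fun_prop)).aestronglyMeasurable
    · filter_upwards with ε
      filter_upwards with z
      rw [norm_mul, Real.norm_of_nonneg (rho_nonneg _ _)]
      exact mul_le_mul_of_nonneg_left (hB _) (rho_nonneg _ _)
    · exact (rho_integrable one_pos).mul_const B
    · filter_upwards with z
      apply Tendsto.const_mul
      apply Tendsto.mono_left _ nhdsWithin_le_nhds
      have : Continuous (fun ε : ℝ => w (x - ε • z)) := hw.comp (by fun_prop)
      simpa using this.tendsto 0
  rw [integral_mul_const, rho_integral one_pos, one_mul] at lim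
  exact lim.congr' (by filter_upwards [self_mem_nhdsWithin] with ε hε using (key ε hε).symm)

/-! ### Integration by parts -/

lemma ibp {f g : E2 → ℝ} (hf : ContDiff ℝ 1 f) (hg : ContDiff ℝ 1 g)
    (hc : HasCompactSupport g) (v : E2) :
    ∫ x, f x * fderiv ℝ g x v = - ∫ x, fderiv ℝ f x v * g x := by
  have hf' : Continuous (fun x => fderiv ℝ f x v) :=
    (hf.continuous_fderiv one_ne_zero).clm_apply continuous_const
  have hg' : Continuous (fun x => fderiv ℝ g x v) :=
    (hg.continuous_fderiv one_ne_zero).clm_apply continuous_const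
  apply integral_mul_fderiv_eq_neg_fderiv_mul_of_integrable
  · exact (hf'.mul hg.continuous).integrable_of_hasCompactSupport hc.mul_left
  · exact (hf.continuous.mul hg').integrable_of_hasCompactSupport
      (HasCompactSupport.mul_left (hc.fderiv_apply ℝ v))
  · exact (hf.continuous.mul hg.continuous).integrable_of_hasCompactSupport hc.mul_left
  · intro x _; exact hf.differentiable one_ne_zero x
  · intro x _; exact hg.differentiable one_ne_zero x

lemma contDiff_pd {w : E2 → ℝ} (hw : ContDiff ℝ 2 w) (v : E2) :
    ContDiff ℝ 1 (fun y => fderiv ℝ w y v) :=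
  (hw.fderiv_right (m := 1) (by norm_num)).clm_apply contDiff_const

lemma lap_continuous {w : E2 → ℝ} (hw : ContDiff ℝ 2 w) : Continuous (lap w) := by
  unfold lap
  apply continuous_finsetSum
  intro i _
  exact ((contDiff_pd hw _).continuous_fderiv one_ne_zero).clm_apply continuous_const

lemma lap_support {w : E2 → ℝ} (hc : HasCompactSupport w) : HasCompactSupport (lap w) := by
  apply HasCompactSupport.intro' hc (isClosed_tsupport w)
  intro x hx
  unfold lap
  apply Finset.sum_eq_zero
  intro i _
  have h1 : (fun y => fderiv ℝ w y (eb i)) =ᶠ[𝓝 x] fun _ => 0 := by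
    have : ∀ᶠ y in 𝓝 x, y ∉ tsupport w := (isClosed_tsupport w).isOpen_compl.mem_nhds hx
    filter_upwards [this] with y hy
    have : y ∉ tsupport (fderiv ℝ w) := fun h => hy (tsupport_fderiv_subset ℝ h)
    rw [image_eq_zero_of_notMem_tsupport this]; rfl
  rw [h1.fderiv_eq]
  simp

/-- First Green identity. -/
lemma green1 {k w : E2 → ℝ} (hk : ContDiff ℝ 1 k) (hw : ContDiff ℝ 2 w)
    (hc : HasCompactSupport w) :
    ∫ y, k y * lap w y = - ∫ y, ∑ i, fderiv ℝ k y (eb i) * fderiv ℝ w y (eb i) := by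
  have hk' : ∀ v, Continuous (fun x => fderiv ℝ k x v) := fun v =>
    (hk.continuous_fderiv one_ne_zero).clm_apply continuous_const
  have e1 : ∀ i, ∫ x, k x * fderiv ℝ (fun y => fderiv ℝ w y (eb i)) x (eb i)
      = - ∫ x, fderiv ℝ k x (eb i) * fderiv ℝ w x (eb i) := fun i =>
    ibp hk (contDiff_pd hw _) (hc.fderiv_apply ℝ _) _
  unfold lap
  simp only [Finset.mul_sum]
  rw [integral_finsetSum, integral_finsetSum]
  · simp only [e1, Finset.sum_neg_distrib]
  · intro i _
    exact ((hk' _).mul (contDiff_pd hw _).continuous).integrable_of_hasCompactSupport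
      (HasCompactSupport.mul_left (hc.fderiv_apply ℝ _))
  · intro i _
    refine (hk.continuous.mul (((contDiff_pd hw _).continuous_fderiv one_ne_zero).clm_apply
      continuous_const)).integrable_of_hasCompactSupport
      (HasCompactSupport.mul_left ((hc.fderiv_apply ℝ _).fderiv_apply ℝ _))

/-- Green identity, derivative on the other side. -/
lemma green1' {k w : E2 → ℝ} (hk : ContDiff ℝ 2 k) (hw : ContDiff ℝ 1 w)
    (hc : HasCompactSupport w) :
    ∫ y, ∑ i, fderiv ℝ k y (eb i) * fderiv ℝ w y (eb i) = - ∫ y, lap k y * w y := by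
  have e1 : ∀ i, ∫ x, fderiv ℝ k x (eb i) * fderiv ℝ w x (eb i)
      = - ∫ x, fderiv ℝ (fun y => fderiv ℝ k y (eb i)) x (eb i) * w x := fun i =>
    ibp (contDiff_pd hk _) hw hc _
  have hw' : ∀ v, Continuous (fun x => fderiv ℝ w x v) := fun v =>
    (hw.continuous_fderiv one_ne_zero).clm_apply continuous_const
  unfold lap
  simp only [Finset.sum_mul]
  rw [integral_finsetSum, integral_finsetSum]
  · simp only [e1, Finset.sum_neg_distrib]
  · intro i _
    refine ((((contDiff_pd hk _).continuous_fderiv one_ne_zero).clm_apply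
      continuous_const).mul hw.continuous).integrable_of_hasCompactSupport
      (HasCompactSupport.mul_left hc)
  · intro i _
    exact ((contDiff_pd hk _).continuous.mul (hw' _)).integrable_of_hasCompactSupport
      (HasCompactSupport.mul_left (hc.fderiv_apply ℝ _))

lemma lap_integral_zero {w : E2 → ℝ} (hw : ContDiff ℝ 2 w)
    (hc : HasCompactSupport w) : ∫ y, lap w y = 0 := by
  have := green1 (k := fun _ => 1) contDiff_const hw hc
  simpa using this

/-! ### Bounded measurable functions with bounded support -/

/-- Bounded, measurable, with bounded support. -/
structure BB (g : E2 → ℝ) : Prop where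
  meas : Measurable g
  bdd : ∃ A, 0 ≤ A ∧ ∀ y, |g y| ≤ A
  supp : ∃ s, 0 < s ∧ ∀ y, g y ≠ 0 → ‖y‖ < s

lemma BB.of_continuous {g : E2 → ℝ} (hg : Continuous g) (hc : HasCompactSupport g) : BB g := by
  obtain ⟨A, hA⟩ := hc.exists_bound_of_continuous hg
  obtain ⟨s, hs⟩ := hc.isBounded.subset_ball 0
  refine ⟨hg.measurable, ⟨A, (norm_nonneg _).trans (hA 0), hA⟩, ⟨max s 1, by positivity, ?_⟩⟩
  intro y hy
  have := hs (subset_tsupport g hy)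
  rw [mem_ball_zero_iff] at this
  exact this.trans_le (le_max_left _ _)

lemma BB.mul {g h : E2 → ℝ} (hg : BB g) (hm : Measurable h) {B : ℝ} (hB : ∀ y, |h y| ≤ B) :
    BB (fun y => h y * g y) := by
  obtain ⟨A, hA0, hA⟩ := hg.bdd
  obtain ⟨s, hs0, hs⟩ := hg.supp
  have hB0 : 0 ≤ B := (abs_nonneg _).trans (hB 0)
  refine ⟨hm.mul hg.meas, ⟨B * A, by positivity, ?_⟩, ⟨s, hs0, ?_⟩⟩
  · intro y; rw [abs_mul]; exact mul_le_mul (hB y) (hA y) (abs_nonneg _) hB0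
  · intro y hy; exact hs y (right_ne_zero_of_mul hy)

lemma BB.indicator {g : E2 → ℝ} (hg : BB g) {S : Set E2} (hS : MeasurableSet S) :
    BB (S.indicator g) := by
  obtain ⟨A, hA0, hA⟩ := hg.bdd
  obtain ⟨s, hs0, hs⟩ := hg.supp
  refine ⟨hg.meas.indicator hS, ⟨A, hA0, ?_⟩, ⟨s, hs0, ?_⟩⟩
  · intro y; by_cases h : y ∈ S <;> simp [h, hA, hA0]
  · intro y hy
    by_cases h : y ∈ S
    · rw [Set.indicator_of_mem h] at hy; exact hs y hy
    · simp [h] at hy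

lemma BB.sub {g h : E2 → ℝ} (hg : BB g) (hh : BB h) : BB (fun y => g y - h y) := by
  obtain ⟨A, hA0, hA⟩ := hg.bdd
  obtain ⟨s, hs0, hs⟩ := hg.supp
  obtain ⟨A', hA0', hA'⟩ := hh.bdd
  obtain ⟨s', hs0', hs'⟩ := hh.supp
  refine ⟨hg.meas.sub hh.meas, ⟨A + A', by positivity, ?_⟩, ⟨max s s', by positivity, ?_⟩⟩
  · intro y
    exact (abs_sub _ _).trans (add_le_add (hA y) (hA' y))
  · intro y hy
    by_cases hgy : g y = 0
    · have : h y ≠ 0 := by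
        intro h3; exact hy (by simp [hgy, h3])
      exact (hs' y this).trans_le (le_max_right _ _)
    · exact (hs y hgy).trans_le (le_max_left _ _)

lemma BB.abs {g : E2 → ℝ} (hg : BB g) : BB (fun y => |g y|) := by
  obtain ⟨A, hA0, hA⟩ := hg.bdd
  obtain ⟨s, hs0, hs⟩ := hg.supp
  refine ⟨by simpa using hg.meas.norm, ⟨A, hA0, by simpa using hA⟩,
    ⟨s, hs0, fun y hy => hs y (by simpa using hy)⟩⟩

lemma BB.integrable {g : E2 → ℝ} (hg : BB g) : Integrable g := by
  obtain ⟨A, hA0, hA⟩ := hg.bdd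
  obtain ⟨s, hs0, hs⟩ := hg.supp
  have h : Integrable ((ball (0:E2) s).indicator (fun _ => A)) := by
    rw [integrable_indicator_iff measurableSet_ball]
    exact integrableOn_const measure_ball_lt_top.ne
  refine h.mono' hg.meas.aestronglyMeasurable (ae_of_all _ fun y => ?_)
  by_cases hy : g y = 0
  · simp only [hy, norm_zero]; exact Set.indicator_nonneg (fun _ _ => hA0) _
  · rw [Set.indicator_of_mem (by simpa using hs y hy)]; exact hA y

/-- Admissible kernels. -/
def Ker (κ : E2 → ℝ) : Prop :=
  Measurable κ ∧ ∃ C, 0 ≤ C ∧ ∀ z, z ≠ 0 → |κ z| ≤ C * (‖z‖⁻¹ + ‖z‖ ^ 2)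

lemma Ker.dom {g : E2 → ℝ} (hg : BB g) (x : E2) :
    Integrable (fun y => (‖x - y‖⁻¹ + ‖x - y‖ ^ 2) * |g y|) := by
  obtain ⟨A, hA0, hA⟩ := hg.bdd
  obtain ⟨s, hs0, hs⟩ := hg.supp
  set t := ‖x‖ + s with ht
  have h1 : Integrable (fun y => K1 t (x - y) * A) :=
    ((K1_integrable t).comp_sub_left x).mul_const A
  have h2 : Integrable (fun y => t ^ 2 * |g y|) := hg.abs.integrable.const_mul _
  refine (h1.add h2).mono' ?_ (ae_of_all _ fun y => ?_)
  · apply Measurable.aestronglyMeasurable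
    exact Measurable.mul (by fun_prop) hg.abs.meas
  · rw [norm_mul, Real.norm_of_nonneg (by positivity), Real.norm_eq_abs, abs_abs]
    by_cases hy : g y = 0
    · simp [hy]; exact mul_nonneg (K1_nonneg _ _) hA0
    · have h3 : ‖x - y‖ < t := (norm_sub_le _ _).trans_lt (by rw [ht]; linarith [hs y hy])
      simp only [Pi.add_apply]
      rw [K1_of_lt h3, add_mul]
      apply add_le_add
      · exact mul_le_mul_of_nonneg_left (hA y) (by positivity)
      · apply mul_le_mul_of_nonneg_right _ (abs_nonneg _)
        exact pow_le_pow_left₀ (norm_nonneg _) h3.le 2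

lemma ae_sub_ne (x : E2) : ∀ᵐ y : E2, x - y ≠ 0 := by
  have : ∀ᵐ y : E2, y ≠ x := by
    simp [ae_iff]
  filter_upwards [this] with y hy h
  exact hy (sub_eq_zero.1 h).symm

lemma Ker.integrable {κ : E2 → ℝ} (hκ : Ker κ) {g : E2 → ℝ} (hg : BB g) (x : E2) :
    Integrable (fun y => κ (x - y) * g y) := by
  obtain ⟨hm, C, hC0, hC⟩ := hκ
  refine ((Ker.dom hg x).const_mul C).mono' ?_ ?_
  · apply Measurable.aestronglyMeasurable
    exact Measurable.mul (hm.comp (by fun_prop)) hg.meas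
  · filter_upwards [ae_sub_ne x] with y hy
    rw [norm_mul, ← mul_assoc]
    exact mul_le_mul_of_nonneg_right (hC _ hy) (abs_nonneg _)

lemma abs_log_le {r : ℝ} (hr : 0 < r) : |Real.log r| ≤ r⁻¹ + r := by
  rw [abs_le]
  constructor
  · have := Real.log_le_sub_one_of_pos (inv_pos.2 hr)
    rw [Real.log_inv] at this
    linarith
  · have := Real.log_le_sub_one_of_pos hr
    have := inv_pos.2 hr
    linarith

lemma le_inv_add_sq {r : ℝ} (hr : 0 < r) : r ≤ r⁻¹ + r ^ 2 := by
  rcases le_total r 1 with h | h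
  · have := (one_le_inv₀ hr).2 h
    nlinarith [sq_nonneg r]
  · have := inv_pos.2 hr
    nlinarith

lemma one_le_inv_add_sq {r : ℝ} (hr : 0 < r) : 1 ≤ r⁻¹ + r ^ 2 := by
  rcases le_total r 1 with h | h
  · have := (one_le_inv₀ hr).2 h
    nlinarith [sq_nonneg r]
  · have := inv_pos.2 hr
    nlinarith

lemma Ker.log : Ker (fun z => Real.log ‖z‖) := by
  refine ⟨by fun_prop, 2, by norm_num, fun z hz => ?_⟩
  have hz' := norm_pos_iff.2 hz
  have := abs_log_le hz'
  have := le_inv_add_sq hz'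
  have := sq_nonneg ‖z‖
  nlinarith

lemma Ker.log_div {D : ℝ} (hD : 0 < D) : Ker (fun z => Real.log (D / ‖z‖)) := by
  refine ⟨by fun_prop, 2 + |Real.log D|, by positivity, fun z hz => ?_⟩
  have hz' := norm_pos_iff.2 hz
  beta_reduce
  rw [Real.log_div hD.ne' hz'.ne']
  have h1 := abs_log_le hz'
  have h2 := le_inv_add_sq hz'
  have h3 := one_le_inv_add_sq hz'
  have h4 := abs_sub (Real.log D) (Real.log ‖z‖)
  have h5 := abs_nonneg (Real.log D)
  have h6 := sq_nonneg ‖z‖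
  nlinarith [mul_le_mul_of_nonneg_left h3 h5]

lemma Ker.inv : Ker (fun z => ‖z‖⁻¹) := by
  refine ⟨by fun_prop, 1, by norm_num, fun z hz => ?_⟩
  rw [abs_of_nonneg (by positivity)]
  nlinarith [sq_nonneg ‖z‖]

lemma Ker.coord (j : Fin 2) : Ker (fun z => z j / ‖z‖ ^ 2) := by
  refine ⟨by fun_prop, 1, by norm_num, fun z hz => ?_⟩
  have hz' := norm_pos_iff.2 hz
  rw [abs_div, abs_of_nonneg (sq_nonneg ‖z‖)]
  have : |z j| ≤ ‖z‖ := by simpa using PiLp.norm_apply_le z j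
  have h2 : |z j| / ‖z‖ ^ 2 ≤ ‖z‖⁻¹ := by
    rw [div_le_iff₀ (by positivity)]
    calc |z j| ≤ ‖z‖ := this
      _ = _ := by field_simp
  nlinarith [sq_nonneg ‖z‖]

lemma Ker.of_bound {κ : E2 → ℝ} (hm : Measurable κ) (B : ℝ) (hB : ∀ z, |κ z| ≤ B) : Ker κ := by
  refine ⟨hm, B, (abs_nonneg _).trans (hB 0), fun z hz => ?_⟩
  have hz' := norm_pos_iff.2 hz
  have := one_le_inv_add_sq hz'
  have h0 : 0 ≤ B := (abs_nonneg _).trans (hB 0)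
  nlinarith [hB z, mul_le_mul_of_nonneg_left this h0]

/-! ### Regularised logarithmic kernel -/

/-- `k_{ε,x}(y) = -(1/4π) log(|y-x|²+ε²)`. -/
def kk (ε : ℝ) (x y : E2) : ℝ := -(1 / (4 * π)) * Real.log (‖y - x‖ ^ 2 + ε ^ 2)

lemma kk_contDiff {ε : ℝ} (hε : 0 < ε) (x : E2) {n : WithTop ℕ∞} : ContDiff ℝ n (kk ε x) := by
  unfold kk
  apply contDiff_const.mul
  apply ContDiff.log
  · exact ((contDiff_id.sub contDiff_const).norm_sq ℝ).add contDiff_const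
  · intro y; positivity

lemma kk_hasFDerivAt {ε : ℝ} (hε : 0 < ε) (x y : E2) :
    HasFDerivAt (kk ε x) (-(1 / (2 * π)) • (‖y - x‖ ^ 2 + ε ^ 2)⁻¹ • innerSL ℝ (y - x)) y := by
  have h0 : ‖y - x‖ ^ 2 + ε ^ 2 ≠ 0 := by positivity
  have h1 : HasFDerivAt (fun y : E2 => y - x) (ContinuousLinearMap.id ℝ E2) y :=
    (hasFDerivAt_id y).sub_const x
  have h2 := ((h1.norm_sq.add_const (ε ^ 2)).log h0).const_mul (-(1 / (4 * π)))
  unfold kk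
  refine h2.congr_fderiv ?_
  ext v
  simp
  have := Real.pi_ne_zero
  field_simp
  ring

lemma inner_eb (v : E2) (i : Fin 2) : inner ℝ v (eb i) = v i := by
  rw [EuclideanSpace.inner_single_right]; simp

lemma kk_fderiv {ε : ℝ} (hε : 0 < ε) (x y : E2) (i : Fin 2) :
    fderiv ℝ (kk ε x) y (eb i) = -(1 / (2 * π)) * ((y i - x i) / (‖y - x‖ ^ 2 + ε ^ 2)) := by
  rw [(kk_hasFDerivAt hε x y).fderiv]
  simp [inner_eb]
  ring

lemma kk_lap {ε : ℝ} (hε : 0 < ε) (x y : E2) : lap (kk ε x) y = - rho ε (x - y) := by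
  have h0 : ‖y - x‖ ^ 2 + ε ^ 2 ≠ 0 := by positivity
  have h1 : HasFDerivAt (fun y : E2 => y - x) (ContinuousLinearMap.id ℝ E2) y :=
    (hasFDerivAt_id y).sub_const x
  have key : ∀ i : Fin 2, fderiv ℝ (fun y => fderiv ℝ (kk ε x) y (eb i)) y (eb i)
      = -(1 / (2 * π)) * ((‖y - x‖ ^ 2 + ε ^ 2)⁻¹ - 2 * (y i - x i) ^ 2 /
        (‖y - x‖ ^ 2 + ε ^ 2) ^ 2) := by
    intro i
    simp only [kk_fderiv hε, div_eq_mul_inv]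
    have h2 : HasFDerivAt (fun y : E2 => y i - x i) (EuclideanSpace.proj i : E2 →L[ℝ] ℝ) y :=
      ((EuclideanSpace.proj i : E2 →L[ℝ] ℝ).hasFDerivAt).sub_const _
    have h3 := ((h1.norm_sq.add_const (ε ^ 2)))
    have h4 := h2.mul ((hasDerivAt_inv h0).comp_hasFDerivAt y h3)
    have h5 := (h4.const_mul (-(1 * (2 * π)⁻¹))).fderiv
    simp only [Function.comp_def, Pi.mul_apply] at h5
    rw [h5]
    simp [inner_eb]
    field_simp
    ring
  unfold lap
  rw [Finset.sum_congr rfl (fun i _ => key i), Fin.sum_univ_two]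
  have hn : ‖y - x‖ ^ 2 = (y 0 - x 0) ^ 2 + (y 1 - x 1) ^ 2 := by
    rw [EuclideanSpace.norm_sq_eq]; simp
  unfold rho
  rw [norm_sub_rev x y]
  have hp := Real.pi_ne_zero
  set q := ‖y - x‖ ^ 2 + ε ^ 2 with hq
  have : ε ^ 2 = q - ((y 0 - x 0) ^ 2 + (y 1 - x 1) ^ 2) := by rw [hq, hn]; ring
  rw [this]
  field_simp
  ring

/-- Mollified identities. -/
lemma moll1 {ε : ℝ} (hε : 0 < ε) {w : E2 → ℝ} (hw : ContDiff ℝ 1 w) (hc : HasCompactSupport w)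
    (x : E2) : ∫ y, rho ε (x - y) * w y
      = ∫ y, ∑ i, fderiv ℝ (kk ε x) y (eb i) * fderiv ℝ w y (eb i) := by
  rw [green1' (kk_contDiff hε x) hw hc]
  simp only [kk_lap hε, neg_mul, integral_neg, neg_neg]

lemma moll2 {ε : ℝ} (hε : 0 < ε) {w : E2 → ℝ} (hw : ContDiff ℝ 2 w) (hc : HasCompactSupport w)
    (x : E2) : ∫ y, rho ε (x - y) * w y = ∫ y, kk ε x y * (- lap w y) := by
  rw [moll1 hε (hw.of_le (by norm_num)) hc, eq_comm]
  simp only [mul_neg, integral_neg]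
  rw [green1 (kk_contDiff hε x) hw hc, neg_neg]

lemma fderiv_symm {w : E2 → ℝ} (hw : ContDiff ℝ 2 w) (a b x : E2) :
    fderiv ℝ (fun y => fderiv ℝ w y a) x b = fderiv ℝ (fun y => fderiv ℝ w y b) x a := by
  have hd : DifferentiableAt ℝ (fderiv ℝ w) x :=
    (hw.fderiv_right (m := 1) (by norm_num)).differentiable one_ne_zero x
  rw [fderiv_clm_apply hd (differentiableAt_const _), fderiv_clm_apply hd (differentiableAt_const _)]
  simp
  have := (hw.contDiffAt (x := x)).isSymmSndFDerivAt (by simp)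
  exact this b a

lemma moll3 {ε : ℝ} (hε : 0 < ε) {w : E2 → ℝ} (hw : ContDiff ℝ 2 w) (hc : HasCompactSupport w)
    (x : E2) (j : Fin 2) : ∫ y, rho ε (x - y) * fderiv ℝ w y (eb j)
      = - ∫ y, fderiv ℝ (kk ε x) y (eb j) * (- lap w y) := by
  have hk : ContDiff ℝ 2 (kk ε x) := kk_contDiff hε x
  have hwc : ∀ v, HasCompactSupport (fun y => fderiv ℝ w y v) := fun v => hc.fderiv_apply ℝ v
  rw [moll1 hε (contDiff_pd hw _) (hwc _)]
  have e1 : ∫ y, ∑ i, fderiv ℝ (kk ε x) y (eb i) * fderiv ℝ (fun y => fderiv ℝ w y (eb j)) y (eb i)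
     = - ∫ y, ∑ i, fderiv ℝ (fun y => fderiv ℝ (kk ε x) y (eb j)) y (eb i)
        * fderiv ℝ w y (eb i) := by
    simp only [fun y i => fderiv_symm hw (eb j) (eb i) y, fun y i => fderiv_symm hk (eb j) (eb i) y]
    rw [integral_finsetSum, integral_finsetSum, ← Finset.sum_neg_distrib]
    · exact Finset.sum_congr rfl (fun i _ => ibp (contDiff_pd hk _) (contDiff_pd hw _) (hwc _) _)
    · intro i _
      exact ((((contDiff_pd hk _).continuous_fderiv one_ne_zero).clm_apply continuous_const).mul
        (contDiff_pd hw _).continuous).integrable_of_hasCompactSupport (hwc _).mul_left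
    · intro i _
      exact ((contDiff_pd hk _).continuous.mul (((contDiff_pd hw _).continuous_fderiv
        one_ne_zero).clm_apply continuous_const)).integrable_of_hasCompactSupport
        ((hwc _).fderiv_apply ℝ _).mul_left
  rw [e1, ← green1 (contDiff_pd hk _) hw hc]
  simp only [mul_neg, integral_neg, neg_neg]

lemma ker_dct {κ : ℝ → E2 → ℝ} {κ0 : E2 → ℝ} {C : ℝ} (hm : ∀ ε, Measurable (κ ε))
    (hb : ∀ ε ∈ Set.Ioo (0:ℝ) 1, ∀ z, z ≠ 0 → |κ ε z| ≤ C * (‖z‖⁻¹ + ‖z‖ ^ 2))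
    (hl : ∀ z, z ≠ 0 → Tendsto (fun ε => κ ε z) (𝓝[>] 0) (𝓝 (κ0 z)))
    {g : E2 → ℝ} (hg : BB g) (x : E2) :
    Tendsto (fun ε => ∫ y, κ ε (x - y) * g y) (𝓝[>] 0) (𝓝 (∫ y, κ0 (x - y) * g y)) := by
  apply tendsto_integral_filter_of_dominated_convergence
    (fun y => C * ((‖x - y‖⁻¹ + ‖x - y‖ ^ 2) * |g y|))
  · filter_upwards with ε
    apply Measurable.aestronglyMeasurable
    exact Measurable.mul ((hm ε).comp (by fun_prop)) hg.meas
  · filter_upwards [Ioo_mem_nhdsGT (zero_lt_one' ℝ)] with ε hε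
    filter_upwards [ae_sub_ne x] with y hy
    rw [norm_mul, ← mul_assoc]
    exact mul_le_mul_of_nonneg_right (hb ε hε _ hy) (abs_nonneg _)
  · exact (Ker.dom hg x).const_mul C
  · filter_upwards [ae_sub_ne x] with y hy
    exact (hl _ hy).mul_const _

lemma lap_BB {w : E2 → ℝ} (hw : ContDiff ℝ 2 w) (hc : HasCompactSupport w) :
    BB (fun y => - lap w y) :=
  BB.of_continuous (lap_continuous hw).neg (lap_support hc).neg

lemma log_reg_bound {ε : ℝ} (hε : ε ∈ Set.Ioo (0:ℝ) 1) {r : ℝ} (hr : 0 < r) :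
    |Real.log (r ^ 2 + ε ^ 2)| ≤ 2 * (r⁻¹ + r ^ 2) := by
  have h1 : Real.log (r ^ 2) ≤ Real.log (r ^ 2 + ε ^ 2) :=
    Real.log_le_log (by positivity) (by nlinarith [sq_nonneg ε])
  have h2 : Real.log (r ^ 2 + ε ^ 2) ≤ r ^ 2 + ε ^ 2 - 1 :=
    Real.log_le_sub_one_of_pos (by positivity)
  have h3 := Real.log_le_sub_one_of_pos (inv_pos.2 hr)
  rw [Real.log_inv] at h3
  rw [Real.log_pow] at h1
  have h4 : ε ^ 2 < 1 := by nlinarith [hε.1, hε.2]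
  have h5 := inv_pos.2 hr
  push_cast at h1
  rw [abs_le]
  constructor <;> nlinarith [sq_nonneg r]

lemma log_sq_norm (r : ℝ) : Real.log (r ^ 2) = 2 * Real.log r := by
  rw [Real.log_pow]; norm_num

lemma kk_eq (ε : ℝ) (x y : E2) :
    kk ε x y = -(1 / (4 * π)) * Real.log (‖x - y‖ ^ 2 + ε ^ 2) := by
  unfold kk; rw [norm_sub_rev]

lemma rep1 {w : E2 → ℝ} (hw : ContDiff ℝ 2 w) (hc : HasCompactSupport w) (x : E2) :
    w x = -(1 / (2 * π)) * ∫ y, Real.log ‖x - y‖ * (- lap w y) := by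
  have h1 := rho_tendsto w hw.continuous hc x
  have h2 := ker_dct (κ := fun ε z => Real.log (‖z‖ ^ 2 + ε ^ 2))
    (κ0 := fun z => Real.log (‖z‖ ^ 2)) (C := 2) (fun ε => by fun_prop)
    (fun ε hε z hz => log_reg_bound hε (norm_pos_iff.2 hz))
    (fun z hz => by
      have hz' := norm_pos_iff.2 hz
      apply Tendsto.mono_left _ nhdsWithin_le_nhds
      have : ContinuousAt (fun ε : ℝ => Real.log (‖z‖ ^ 2 + ε ^ 2)) 0 := by
        apply ContinuousAt.log (by fun_prop)
        simp [hz]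
      simpa [ContinuousAt] using this) (lap_BB hw hc) x
  have h3 := h2.const_mul (-(1 / (4 * π)))
  have h4 : Tendsto (fun ε : ℝ => ∫ y, rho ε (x - y) * w y) (𝓝[>] 0)
      (𝓝 (-(1 / (4 * π)) * ∫ y, Real.log (‖x - y‖ ^ 2) * (- lap w y))) := by
    refine h3.congr' ?_
    filter_upwards [self_mem_nhdsWithin] with ε hε
    rw [moll2 hε hw hc x, ← integral_const_mul]
    simp only [kk_eq, mul_assoc]
  rw [tendsto_nhds_unique h1 h4]
  simp only [log_sq_norm, mul_assoc]
  rw [integral_const_mul]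
  have := Real.pi_ne_zero
  field_simp
  ring

lemma rep1D {w : E2 → ℝ} (hw : ContDiff ℝ 2 w) (hc : HasCompactSupport w) {D : ℝ} (hD : 0 < D)
    (x : E2) :
    w x = (1 / (2 * π)) * ∫ y, Real.log (D / ‖x - y‖) * (- lap w y) := by
  have hQ := lap_BB hw hc
  have h1 : ∫ y, Real.log (D / ‖x - y‖) * (- lap w y)
      = ∫ y, (Real.log D * (- lap w y) - Real.log ‖x - y‖ * (- lap w y)) := by
    apply integral_congr_ae
    filter_upwards [ae_sub_ne x] with y hy
    rw [Real.log_div hD.ne' (norm_pos_iff.2 hy).ne']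
    ring
  rw [h1, integral_sub (hQ.integrable.const_mul _) (Ker.log.integrable hQ x), integral_const_mul,
    integral_neg, lap_integral_zero hw hc, rep1 hw hc x]
  ring

/-- Euclidean norm of the gradient. -/
def gn (w : E2 → ℝ) (y : E2) : ℝ := Real.sqrt (∑ i, fderiv ℝ w y (eb i) ^ 2)

lemma gn_nonneg (w : E2 → ℝ) (y : E2) : 0 ≤ gn w y := Real.sqrt_nonneg _

lemma gn_sq (w : E2 → ℝ) (y : E2) : gn w y ^ 2 = ∑ i, fderiv ℝ w y (eb i) ^ 2 :=
  Real.sq_sqrt (Finset.sum_nonneg fun _ _ => sq_nonneg _)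

lemma pd_continuous {w : E2 → ℝ} (hw : ContDiff ℝ 1 w) (v : E2) :
    Continuous (fun y => fderiv ℝ w y v) :=
  (hw.continuous_fderiv one_ne_zero).clm_apply continuous_const

lemma gn_continuous {w : E2 → ℝ} (hw : ContDiff ℝ 1 w) : Continuous (gn w) := by
  unfold gn
  apply Continuous.sqrt
  exact continuous_finsetSum _ fun i _ => (pd_continuous hw _).pow 2

lemma gn_support {w : E2 → ℝ} (hc : HasCompactSupport w) : HasCompactSupport (gn w) := by
  apply HasCompactSupport.intro' hc (isClosed_tsupport w)
  intro y hy
  have h2 : y ∉ tsupport (fderiv ℝ w) := fun h => hy (tsupport_fderiv_subset ℝ h)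
  have h3 : fderiv ℝ w y = 0 := image_eq_zero_of_notMem_tsupport h2
  simp [gn, h3]

lemma dirichlet {w : E2 → ℝ} (hw : ContDiff ℝ 2 w) (hc : HasCompactSupport w) :
    ∫ y, gn w y ^ 2 = ∫ y, w y * (- lap w y) := by
  simp only [gn_sq, mul_neg, integral_neg]
  rw [green1 (hw.of_le (by norm_num)) hw hc, neg_neg]
  simp only [pow_two]

lemma rep2 {w : E2 → ℝ} (hw : ContDiff ℝ 2 w) (hc : HasCompactSupport w) (x : E2) :
    w x ≤ (1 / (2 * π)) * ∫ y, ‖x - y‖⁻¹ * gn w y := by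
  have h1 := rho_tendsto w hw.continuous hc x
  have hw1 : ContDiff ℝ 1 w := hw.of_le (by norm_num)
  refine le_of_tendsto h1 ?_
  filter_upwards [self_mem_nhdsWithin] with ε hε
  have hε' : 0 < ε := hε
  rw [moll1 hε' hw1 hc, ← integral_const_mul]
  apply integral_mono_ae
  · apply integrable_finsetSum
    intro i _
    exact ((pd_continuous (kk_contDiff hε' x) _).mul (pd_continuous hw1 _)
      ).integrable_of_hasCompactSupport (HasCompactSupport.mul_left (hc.fderiv_apply ℝ _))
  · exact (Ker.inv.integrable (BB.of_continuous (gn_continuous hw1) (gn_support hc)) x).const_mul _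
  · filter_upwards [ae_sub_ne x] with y hy
    have hy' := norm_pos_iff.2 hy
    simp only [kk_fderiv hε']
    rw [← mul_assoc]
    have hcs := Finset.sum_mul_sq_le_sq_mul_sq Finset.univ
      (fun i : Fin 2 => -(1 / (2 * π)) * ((y i - x i) / (‖y - x‖ ^ 2 + ε ^ 2)))
      (fun i => fderiv ℝ w y (eb i))
    have hsum : ∑ i : Fin 2, (-(1 / (2 * π)) * ((y i - x i) / (‖y - x‖ ^ 2 + ε ^ 2))) ^ 2
        = (1 / (2 * π)) ^ 2 * (‖y - x‖ ^ 2 / (‖y - x‖ ^ 2 + ε ^ 2) ^ 2) := by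
      have hn : ‖y - x‖ ^ 2 = (y 0 - x 0) ^ 2 + (y 1 - x 1) ^ 2 := by
        rw [EuclideanSpace.norm_sq_eq]; simp
      rw [Fin.sum_univ_two]
      nth_rewrite 3 [hn]
      generalize ‖y - x‖ ^ 2 + ε ^ 2 = q
      ring
    rw [hsum, ← gn_sq] at hcs
    have hb : (1 / (2 * π)) ^ 2 * (‖y - x‖ ^ 2 / (‖y - x‖ ^ 2 + ε ^ 2) ^ 2)
        ≤ ((1 / (2 * π)) * ‖x - y‖⁻¹) ^ 2 := by
      rw [mul_pow, norm_sub_rev y x]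
      apply mul_le_mul_of_nonneg_left _ (by positivity)
      rw [div_le_iff₀ (by positivity), inv_pow, ← div_eq_inv_mul, le_div_iff₀ (by positivity)]
      nlinarith [sq_nonneg ε, sq_nonneg ‖x - y‖, mul_nonneg (sq_nonneg ε) (sq_nonneg ‖x - y‖),
        sq_nonneg (ε ^ 2)]
    have hfin := hcs.trans (mul_le_mul_of_nonneg_right hb (sq_nonneg _))
    rw [← mul_pow] at hfin
    exact (abs_le_of_sq_le_sq' hfin (mul_nonneg (by positivity) (gn_nonneg _ _))).2

lemma rep3 {w : E2 → ℝ} (hw : ContDiff ℝ 2 w) (hc : HasCompactSupport w) (x : E2) (j : Fin 2) :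
    fderiv ℝ w x (eb j) = -(1 / (2 * π)) * ∫ y, (x - y) j / ‖x - y‖ ^ 2 * (- lap w y) := by
  have h1 := rho_tendsto (fun y => fderiv ℝ w y (eb j)) (contDiff_pd hw _).continuous
    (hc.fderiv_apply ℝ _) x
  have h2 := ker_dct (κ := fun ε z => z j / (‖z‖ ^ 2 + ε ^ 2))
    (κ0 := fun z => z j / ‖z‖ ^ 2) (C := 1) (fun ε => by fun_prop)
    (fun ε hε z hz => by
      have hz' := norm_pos_iff.2 hz
      rw [abs_div, abs_of_nonneg (by positivity : 0 ≤ ‖z‖ ^ 2 + ε ^ 2)]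
      have h3 : |z j| ≤ ‖z‖ := by simpa using PiLp.norm_apply_le z j
      have h4 : |z j| / (‖z‖ ^ 2 + ε ^ 2) ≤ ‖z‖⁻¹ := by
        rw [div_le_iff₀ (by positivity), inv_mul_eq_div, le_div_iff₀ hz']
        nlinarith [sq_nonneg ε]
      nlinarith [sq_nonneg ‖z‖])
    (fun z hz => by
      have hz' := norm_pos_iff.2 hz
      apply Tendsto.mono_left _ nhdsWithin_le_nhds
      have : ContinuousAt (fun ε : ℝ => z j / (‖z‖ ^ 2 + ε ^ 2)) 0 := by
        apply ContinuousAt.div (by fun_prop) (by fun_prop)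
        simp [hz]
      simpa [ContinuousAt] using this) (lap_BB hw hc) x
  have h3 := h2.const_mul (-(1 / (2 * π)))
  refine tendsto_nhds_unique h1 (h3.congr' ?_)
  filter_upwards [self_mem_nhdsWithin] with ε hε
  rw [moll3 hε hw hc x, ← integral_const_mul, ← integral_neg]
  congr 1
  ext y
  rw [kk_fderiv hε, norm_sub_rev y x]
  simp
  ring

lemma Ker.log_one_add (ε : ℝ) : Ker (fun z => Real.log (1 + ε ^ 2 / ‖z‖ ^ 2)) := by
  refine ⟨by fun_prop, 2 * |ε|, by positivity, fun z hz => ?_⟩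
  have hz' := norm_pos_iff.2 hz
  rw [abs_of_nonneg (Real.log_nonneg (by have : 0 ≤ ε ^ 2 / ‖z‖ ^ 2 := by positivity
                                         linarith))]
  have h1 : Real.log (1 + ε ^ 2 / ‖z‖ ^ 2) ≤ Real.log ((1 + |ε| / ‖z‖) ^ 2) := by
    apply Real.log_le_log (by positivity)
    rw [← sq_abs ε, ← div_pow]
    have : 0 ≤ |ε| / ‖z‖ := by positivity
    nlinarith
  rw [log_sq_norm] at h1
  have h2 := Real.log_le_sub_one_of_pos (show 0 < 1 + |ε| / ‖z‖ by positivity)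
  have h3 : |ε| / ‖z‖ = |ε| * ‖z‖⁻¹ := div_eq_mul_inv _ _
  have : 0 ≤ |ε| * ‖z‖ ^ 2 := by positivity
  nlinarith

lemma rep4 {w F : E2 → ℝ} (hw : ContDiff ℝ 2 w) (hc : HasCompactSupport w) (hF : BB F)
    (hle : ∀ y, - lap w y ≤ F y) {ε : ℝ} (hε : 0 < ε) (x : E2) :
    w x - ∫ y, rho ε (x - y) * w y
      ≤ (1 / (4 * π)) * ∫ y, Real.log (1 + ε ^ 2 / ‖x - y‖ ^ 2) * F y := by
  have hQ := lap_BB hw hc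
  have hk : Integrable (fun y => kk ε x y * (- lap w y)) :=
    ((kk_contDiff (n := 1) hε x).continuous.mul (lap_continuous hw).neg
      ).integrable_of_hasCompactSupport (HasCompactSupport.mul_left (lap_support hc).neg)
  rw [rep1 hw hc x, moll2 hε hw hc x, ← integral_const_mul, ← integral_const_mul,
    ← integral_sub ((Ker.log.integrable hQ x).const_mul _) hk]
  apply integral_mono_ae
  · exact ((Ker.log.integrable hQ x).const_mul _).sub hk
  · exact ((Ker.log_one_add ε).integrable hF x).const_mul _
  · filter_upwards [ae_sub_ne x] with y hy
    have hy' := norm_pos_iff.2 hy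
    have e1 : Real.log (1 + ε ^ 2 / ‖x - y‖ ^ 2)
        = Real.log (‖x - y‖ ^ 2 + ε ^ 2) - 2 * Real.log ‖x - y‖ := by
      rw [← log_sq_norm, ← Real.log_div (by positivity) (by positivity)]
      congr 1
      field_simp
    have e2 : 0 ≤ Real.log (1 + ε ^ 2 / ‖x - y‖ ^ 2) := Real.log_nonneg (by
      have : 0 ≤ ε ^ 2 / ‖x - y‖ ^ 2 := by positivity
      linarith)
    have e3 := mul_le_mul_of_nonneg_left (hle y) e2
    have e4 := mul_le_mul_of_nonneg_left e3 (show 0 ≤ 1 / (4 * π) by positivity)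
    refine le_trans (le_of_eq ?_) e4
    rw [e1, kk_eq]
    have := Real.pi_ne_zero
    field_simp
    ring

lemma vol_ball (x : E2) {r : ℝ} (hr : 0 ≤ r) : volume.real (ball x r) = π * r ^ 2 := by
  rw [Measure.real, EuclideanSpace.volume_ball_fin_two, ENNReal.toReal_mul, ENNReal.toReal_pow,
    ENNReal.toReal_ofReal hr, ENNReal.toReal_ofReal Real.pi_pos.le]
  ring

lemma gn_sq_BB {w : E2 → ℝ} (hw : ContDiff ℝ 1 w) (hc : HasCompactSupport w) :
    BB (fun y => gn w y ^ 2) := by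
  apply BB.of_continuous ((gn_continuous hw).pow 2)
  simp only [pow_two]
  exact HasCompactSupport.mul_left (gn_support hc)

/-- Bathtub estimate for the logarithmic potential. -/
lemma bathtub {G : E2 → ℝ} (hG : BB G) (h0 : ∀ y, 0 ≤ G y) {A s D : ℝ} (hA : ∀ y, G y ≤ A)
    (hs : 0 < s) (hD : 0 < D) (x : E2) :
    ∫ y, Real.log (D / ‖x - y‖) * G y
      ≤ Real.log (D / s) * (∫ y, G y) + 2 * π * s ^ 2 * A := by
  have hA0 : 0 ≤ A := (h0 0).trans (hA 0)
  have i1 : Integrable (fun y => Real.log (D / s) * G y) := hG.integrable.const_mul _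
  have i2 : Integrable (fun y => s * A * K1 s (x - y)) :=
    ((K1_integrable s).comp_sub_left x).const_mul _
  have e : Real.log (D / s) * (∫ y, G y) + 2 * π * s ^ 2 * A
      = ∫ y, (Real.log (D / s) * G y + s * A * K1 s (x - y)) := by
    rw [integral_add i1 i2, integral_const_mul, integral_const_mul,
      integral_sub_left_eq_self (K1 s) volume x, K1_integral hs.le]
    ring
  rw [e]
  apply integral_mono_ae ((Ker.log_div hD).integrable hG x) (i1.add i2)
  filter_upwards [ae_sub_ne x] with y hy
  have hy' := norm_pos_iff.2 hy
  have e1 : Real.log (D / ‖x - y‖) = Real.log (D / s) + Real.log (s / ‖x - y‖) := by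
    rw [Real.log_div hD.ne' hy'.ne', Real.log_div hD.ne' hs.ne', Real.log_div hs.ne' hy'.ne']
    ring
  rw [e1, add_mul]
  simp only [Pi.add_apply]
  apply add_le_add le_rfl
  by_cases h : ‖x - y‖ < s
  · rw [K1_of_lt h]
    have h1 : Real.log (s / ‖x - y‖) ≤ s / ‖x - y‖ :=
      (Real.log_le_sub_one_of_pos (by positivity)).trans (by linarith)
    calc Real.log (s / ‖x - y‖) * G y ≤ s / ‖x - y‖ * G y :=
          mul_le_mul_of_nonneg_right h1 (h0 y)
      _ ≤ s / ‖x - y‖ * A := mul_le_mul_of_nonneg_left (hA y) (by positivity)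
      _ = _ := by ring
  · have h1 : Real.log (s / ‖x - y‖) ≤ 0 := by
      apply Real.log_nonpos (by positivity)
      rw [div_le_one hy']
      exact not_lt.1 h
    exact (mul_nonpos_of_nonpos_of_nonneg h1 (h0 y)).trans
      (mul_nonneg (mul_nonneg hs.le hA0) (K1_nonneg _ _))

lemma tsupport_le {w : E2 → ℝ} {R : ℝ} (hs : ∀ x, w x ≠ 0 → ‖x‖ < R) {y : E2}
    (hy : y ∈ tsupport w) : ‖y‖ ≤ R := by
  have : tsupport w ⊆ closedBall 0 R := by
    apply closure_minimal _ isClosed_closedBall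
    intro z hz
    simpa using (hs z hz).le
  simpa using this hy

lemma gn_supp {w : E2 → ℝ} {R : ℝ} (hs : ∀ x, w x ≠ 0 → ‖x‖ < R) {y : E2}
    (hy : gn w y ≠ 0) : ‖y‖ ≤ R := by
  apply tsupport_le hs
  by_contra h
  have h2 : y ∉ tsupport (fderiv ℝ w) := fun h' => h (tsupport_fderiv_subset ℝ h')
  have h3 : fderiv ℝ w y = 0 := image_eq_zero_of_notMem_tsupport h2
  simp [gn, h3] at hy

lemma cs_integral {f g : E2 → ℝ} (hf : Integrable (fun x => f x ^ 2))
    (hg : Integrable (fun x => g x ^ 2))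
    (hfm : AEStronglyMeasurable f volume) (hgm : AEStronglyMeasurable g volume)
    (hf0 : ∀ x, 0 ≤ f x) (hg0 : ∀ x, 0 ≤ g x) :
    ∫ x, f x * g x ≤ √(∫ x, f x ^ 2) * √(∫ x, g x ^ 2) := by
  have h := integral_mul_le_Lp_mul_Lq_of_nonneg (μ := (volume : Measure E2)) (f := f) (g := g)
    (p := 2) (q := 2) Real.HolderConjugate.two_two (ae_of_all _ hf0) (ae_of_all _ hg0)
    (by simpa using (memLp_two_iff_integrable_sq hfm).2 hf)
    (by simpa using (memLp_two_iff_integrable_sq hgm).2 hg)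
  simpa [Real.sqrt_eq_rpow] using h

lemma K2_sqrt_sq (s D : ℝ) (z : E2) : (√(K2 s D z)) ^ 2 = K2 s D z :=
  Real.sq_sqrt (K2_nonneg _ _ _)

lemma K2_measurable (s D : ℝ) : Measurable (K2 s D) := by
  unfold K2
  exact (Measurable.indicator (by fun_prop) measurableSet_Icc).comp measurable_norm

lemma K1_measurable (s : ℝ) : Measurable (K1 s) := by
  unfold K1
  exact (Measurable.indicator (by fun_prop) measurableSet_Ioo).comp measurable_norm

open scoped Convolution in
/-- Weak Moser–Trudinger inequality. -/
lemma MT {w : E2 → ℝ} (hw : ContDiff ℝ 2 w) (hc : HasCompactSupport w) {D e l : ℝ}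
    (hD : 0 < D) (he : 0 < e) (hs : ∀ x, w x ≠ 0 → ‖x‖ < D / 2)
    (hE : ∫ y, gn w y ^ 2 ≤ e ^ 2) (hl : 0 ≤ l)
    (ht : 0 < volume.real {x | l < w x}) :
    l ≤ e * (√(Real.log (D ^ 2 / volume.real {x | l < w x}) / (4 * π)) + 1) := by
  have hw1 : ContDiff ℝ 1 w := hw.of_le (by norm_num)
  set S := {x | l < w x} with hS
  set t := volume.real S with htdef
  have hSm : MeasurableSet S := (isOpen_lt continuous_const hw.continuous).measurableSet
  have hSsub : S ⊆ ball 0 (D / 2) := by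
    intro x hx
    have : w x ≠ 0 := by have : l < w x := hx
                         linarith
    simpa using hs x this
  have hSfin : volume S ≠ ⊤ := (measure_mono hSsub).trans_lt measure_ball_lt_top |>.ne
  set s := √t with hsdef
  have hs0 : 0 < s := Real.sqrt_pos.2 ht
  have hs2 : s ^ 2 = t := Real.sq_sqrt ht.le
  have htD : t ≤ D ^ 2 := by
    have h1 : t ≤ volume.real (ball (0:E2) (D / 2)) :=
      measureReal_mono hSsub measure_ball_lt_top.ne
    rw [vol_ball 0 (by positivity : 0 ≤ D / 2)] at h1
    nlinarith [Real.pi_lt_four, sq_nonneg D]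
  have hsD : s ≤ D := by
    rw [hsdef, Real.sqrt_le_left hD.le]; exact htD
  -- the functions
  have gBB : BB (gn w) := BB.of_continuous (gn_continuous hw1) (gn_support hc)
  have g2BB : BB (fun y => gn w y ^ 2) := by
    exact gn_sq_BB hw1 hc
  have iK1 : ∀ x : E2, Integrable (fun y => K1 s (x - y)) := fun x =>
    (K1_integrable s).comp_sub_left x
  set h : E2 → ℝ := (fun y => gn w y ^ 2) ⋆[ContinuousLinearMap.lsmul ℝ ℝ] K1 s with hh
  have hh_int : Integrable h :=
    g2BB.integrable.integrable_convolution _ (K1_integrable s)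
  have hh_eq : ∀ x, h x = ∫ y, gn w y ^ 2 * K1 s (x - y) := fun x => by
    simp [hh, convolution, smul_eq_mul]
  have hh0 : ∀ x, 0 ≤ h x := fun x => by
    rw [hh_eq]; exact integral_nonneg fun y => mul_nonneg (sq_nonneg _) (K1_nonneg _ _)
  have hh_I : ∫ x, h x ≤ e ^ 2 * (2 * π * s) := by
    rw [hh, integral_convolution _ g2BB.integrable (K1_integrable s), K1_integral hs0.le]
    simp only [ContinuousLinearMap.lsmul_apply, smul_eq_mul]
    exact mul_le_mul_of_nonneg_right hE (by positivity)
  -- pointwise bound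
  set B := e * √(Real.log (D ^ 2 / t) / (4 * π)) with hB
  have far : ∀ x, ∫ y, √(K2 s D (x - y)) * gn w y ≤ 2 * π * B := by
    intro x
    have h1 := cs_integral (f := fun y => √(K2 s D (x - y))) (g := gn w)
      (by simp only [K2_sqrt_sq]; exact (K2_integrable D hs0).comp_sub_left x)
      g2BB.integrable
      (((K2_measurable s D).sqrt.comp (by fun_prop)).aestronglyMeasurable)
      gBB.meas.aestronglyMeasurable (fun _ => Real.sqrt_nonneg _) (gn_nonneg w)
    simp only [K2_sqrt_sq] at h1
    rw [integral_sub_left_eq_self (K2 s D) volume x, K2_integral hs0 hsD] at h1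
    refine h1.trans ?_
    have h2 : √(∫ x, gn w x ^ 2) ≤ e := by
      rw [Real.sqrt_le_left he.le]; exact hE
    have h3 : √(2 * π * Real.log (D / s)) = 2 * π * √(Real.log (D ^ 2 / t) / (4 * π)) := by
      rw [← hs2, ← div_pow, log_sq_norm,
        show 2 * π * √(2 * Real.log (D / s) / (4 * π)) = √((2 * π) ^ 2) *
          √(2 * Real.log (D / s) / (4 * π)) by rw [Real.sqrt_sq (by positivity)],
        ← Real.sqrt_mul (by positivity)]
      congr 1
      have := Real.pi_ne_zero
      field_simp
      ring
    rw [h3, hB]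
    calc _ ≤ 2 * π * √(Real.log (D ^ 2 / t) / (4 * π)) * e :=
          mul_le_mul_of_nonneg_left h2 (by positivity)
      _ = _ := by ring
  have pw : ∀ x ∈ S, l ≤ B + e / 2 + s / (4 * π * e) * h x := by
    intro x hx
    have hx' : l < w x := hx
    have hxD : ‖x‖ < D / 2 := by simpa using hSsub hx
    have hr := rep2 hw hc x
    have i1 : Integrable (fun y => √(K2 s D (x - y)) * gn w y) := by
      refine (Ker.inv.integrable gBB x).mono' ?_ ?_
      · exact (((K2_measurable s D).sqrt.comp (by fun_prop)).mul gBB.meas).aestronglyMeasurable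
      · filter_upwards with y
        rw [norm_mul, Real.norm_of_nonneg (Real.sqrt_nonneg _),
          Real.norm_of_nonneg (gn_nonneg _ _)]
        apply mul_le_mul_of_nonneg_right _ (gn_nonneg _ _)
        apply Real.sqrt_le_left (by positivity) |>.2
        unfold K2
        refine (Set.indicator_le_self' (fun _ _ => by positivity) _).trans (by simp)
    have i2 : Integrable (fun y => (e / (2 * s)) * K1 s (x - y)) := (iK1 x).const_mul _
    have i3 : Integrable (fun y => (s / (2 * e)) * (gn w y ^ 2 * K1 s (x - y))) := by
      apply Integrable.const_mul
      obtain ⟨A, hA0, hA⟩ := g2BB.bdd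
      refine ((iK1 x).const_mul A).mono'
        ((g2BB.meas.mul ((K1_measurable s).comp (by fun_prop))).aestronglyMeasurable) ?_
      filter_upwards with y
      rw [norm_mul, Real.norm_of_nonneg (K1_nonneg _ _)]
      exact mul_le_mul_of_nonneg_right (hA y) (K1_nonneg _ _)
    have hmono : ∫ y, ‖x - y‖⁻¹ * gn w y ≤ ∫ y, (√(K2 s D (x - y)) * gn w y
        + ((e / (2 * s)) * K1 s (x - y) + (s / (2 * e)) * (gn w y ^ 2 * K1 s (x - y)))) := by
      apply integral_mono (Ker.inv.integrable gBB x) (i1.add (i2.add i3))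
      intro y
      simp only [Pi.add_apply]
      by_cases hg : gn w y = 0
      · simp only [hg]
        have := K1_nonneg s (x - y)
        simp only [mul_zero, zero_add]
        positivity
      have hyD := gn_supp hs hg
      have hxy : ‖x - y‖ ≤ D := (norm_sub_le _ _).trans (by linarith)
      by_cases hn : ‖x - y‖ < s
      · have h4 : 0 ≤ √(K2 s D (x - y)) * gn w y :=
          mul_nonneg (Real.sqrt_nonneg _) (gn_nonneg _ _)
        rw [K1_of_lt hn]
        have h5 : gn w y ≤ e / (2 * s) + s / (2 * e) * gn w y ^ 2 := by
          have h6 : 0 ≤ (e - s * gn w y) ^ 2 / (2 * s * e) := by positivity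
          have h7 : (e - s * gn w y) ^ 2 / (2 * s * e)
            = e / (2 * s) + s / (2 * e) * gn w y ^ 2 - gn w y := by field_simp; ring
          linarith
        have h8 : 0 ≤ ‖x - y‖⁻¹ := by positivity
        nlinarith [mul_le_mul_of_nonneg_left h5 h8]
      · have h4 : √(K2 s D (x - y)) = ‖x - y‖⁻¹ := by
          unfold K2
          rw [Set.indicator_of_mem (Set.mem_Icc.2 ⟨not_lt.1 hn, hxy⟩), ← inv_pow, Real.sqrt_sq (by positivity)]
        rw [h4]
        have := K1_nonneg s (x - y)
        have : 0 ≤ (e / (2 * s)) * K1 s (x - y) + (s / (2 * e)) * (gn w y ^ 2 * K1 s (x - y)) := by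
          positivity
        linarith
    have i23 : Integrable (fun y => (e / (2 * s)) * K1 s (x - y)
        + (s / (2 * e)) * (gn w y ^ 2 * K1 s (x - y))) := i2.add i3
    rw [integral_add i1 i23, integral_add i2 i3, integral_const_mul, integral_const_mul,
      integral_sub_left_eq_self (K1 s) volume x, K1_integral hs0.le, ← hh_eq] at hmono
    have h9 := far x
    have h10 : w x ≤ (1 / (2 * π)) * (2 * π * B + (e / (2 * s) * (2 * π * s)
        + s / (2 * e) * h x)) :=
      hr.trans (mul_le_mul_of_nonneg_left (by linarith) (by positivity))
    have h11 : (1 / (2 * π)) * (2 * π * B + (e / (2 * s) * (2 * π * s)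
        + s / (2 * e) * h x)) = B + e / 2 + s / (4 * π * e) * h x := by
      have := Real.pi_ne_zero
      field_simp
      ring
    linarith
  have hint : ∫ x in S, l ≤ ∫ x in S, (B + e / 2 + s / (4 * π * e) * h x) := by
    apply setIntegral_mono_on (integrableOn_const hSfin) _ hSm pw
    exact (integrableOn_const hSfin).add (hh_int.const_mul _).integrableOn
  have ic : Integrable (fun _ : E2 => B + e / 2) (volume.restrict S) := integrableOn_const hSfin
  rw [integral_add ic (hh_int.const_mul _).integrableOn,
    setIntegral_const, setIntegral_const, integral_const_mul] at hint
  have hle : ∫ x in S, h x ≤ e ^ 2 * (2 * π * s) :=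
    (setIntegral_le_integral hh_int (ae_of_all _ hh0)).trans hh_I
  have hle2 : s / (4 * π * e) * ∫ x in S, h x ≤ t * (e / 2) := by
    calc _ ≤ s / (4 * π * e) * (e ^ 2 * (2 * π * s)) :=
          mul_le_mul_of_nonneg_left hle (by positivity)
      _ = _ := by
        rw [← hs2]
        have := Real.pi_ne_zero
        field_simp
        ring
  simp only [smul_eq_mul] at hint
  have : t * l ≤ t * (B + e) := by
    change t * l ≤ t * (B + e / 2) + _ at hint
    nlinarith
  have := le_of_mul_le_mul_left this ht
  rw [hB] at this
  linarith

/-- The data used throughout: truncated positive part `U`, smoothed truncation `w`. -/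
structure PD (D p : ℝ) (U w : E2 → ℝ) (x1 : E2) (c R : ℝ) : Prop where
  hD : 1 ≤ D
  hp : 1 < p
  Uc : Continuous U
  U0 : ∀ x, 0 ≤ U x
  Us : ∀ x, U x ≠ 0 → ‖x‖ < D / 2
  w2 : ContDiff ℝ 2 w
  w0 : ∀ x, 0 ≤ w x
  wU : ∀ x, w x ≤ U x
  Uw : ∀ x, U x ≤ w x + c
  c0 : 0 ≤ c
  cp : c ≤ 1 / p
  cM : c ≤ U x1 / 2
  Q : ∀ x, - lap w x ≤ U x ^ p
  M0 : 0 < U x1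
  UM : ∀ x, U x ≤ U x1
  R0 : 0 < R
  loc : ∀ x ∈ ball x1 R, w x = U x - c ∧ - lap w x = U x ^ p

lemma lap_congr {f g : E2 → ℝ} {x : E2} (h : f =ᶠ[𝓝 x] g) : lap f x = lap g x := by
  unfold lap
  apply Finset.sum_congr rfl
  intro i _
  have : (fun y => fderiv ℝ f y (eb i)) =ᶠ[𝓝 x] fun y => fderiv ℝ g y (eb i) := by
    filter_upwards [h.fderiv (𝕜 := ℝ)] with y hy
    rw [hy]
  rw [this.fderiv_eq]

/-- Shifted smooth transition. -/
def st (δ s : ℝ) : ℝ := Real.smoothTransition ((s - δ) / δ)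

lemma st_contDiff (δ : ℝ) {n : ℕ∞} : ContDiff ℝ n (st δ) := by
  unfold st
  exact Real.smoothTransition.contDiff.comp (by fun_prop)

lemma st_mono {δ : ℝ} (hδ : 0 < δ) : Monotone (st δ) := by
  intro a b hab
  apply Real.smoothTransition.monotone
  gcongr

lemma st_nonneg (δ s : ℝ) : 0 ≤ st δ s := Real.smoothTransition.nonneg _
lemma st_le_one (δ s : ℝ) : st δ s ≤ 1 := Real.smoothTransition.le_one _
lemma st_zero {δ s : ℝ} (hδ : 0 < δ) (h : s ≤ δ) : st δ s = 0 :=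
  Real.smoothTransition.zero_of_nonpos (div_nonpos_of_nonpos_of_nonneg (by linarith) hδ.le)
lemma st_one {δ s : ℝ} (hδ : 0 < δ) (h : 2 * δ ≤ s) : st δ s = 1 :=
  Real.smoothTransition.one_of_one_le (by rw [le_div_iff₀ hδ]; linarith)

/-- Smooth truncation. -/
def eta (δ s : ℝ) : ℝ := ∫ r in (0:ℝ)..s, st δ r

lemma st_cont (δ : ℝ) : Continuous (st δ) := (st_contDiff δ (n := 0)).continuous

lemma st_ii (δ a b : ℝ) : IntervalIntegrable (st δ) volume a b :=
  (st_cont δ).intervalIntegrable a b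

lemma eta_hasDerivAt (δ s : ℝ) : HasDerivAt (eta δ) (st δ s) s :=
  intervalIntegral.integral_hasDerivAt_right (st_ii δ 0 s)
    ((st_cont δ).stronglyMeasurableAtFilter _ _) (st_cont δ).continuousAt

lemma eta_contDiff (δ : ℝ) : ContDiff ℝ 2 (eta δ) := by
  have hd : deriv (eta δ) = st δ := funext fun s => (eta_hasDerivAt δ s).deriv
  rw [show (2 : WithTop ℕ∞) = 1 + 1 by norm_num, contDiff_succ_iff_deriv]
  refine ⟨fun s => (eta_hasDerivAt δ s).differentiableAt, by simp, ?_⟩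
  rw [hd]
  exact st_contDiff δ (n := 1)

lemma eta_zero {δ s : ℝ} (hδ : 0 < δ) (h : s ≤ δ) : eta δ s = 0 := by
  unfold eta
  rw [intervalIntegral.integral_congr (g := fun _ => 0), intervalIntegral.integral_zero]
  intro r hr
  apply st_zero hδ
  rcases Set.mem_uIcc.1 hr with h1 | h1 <;> linarith

lemma eta_nonneg {δ s : ℝ} (hs : 0 ≤ s) : 0 ≤ eta δ s :=
  intervalIntegral.integral_nonneg hs fun r _ => st_nonneg δ r

lemma eta_add (δ a b : ℝ) : eta δ b = eta δ a + ∫ r in a..b, st δ r := by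
  unfold eta
  rw [intervalIntegral.integral_add_adjacent_intervals (st_ii _ _ _) (st_ii _ _ _)]

lemma eta_diff_le {δ a b : ℝ} (hab : a ≤ b) : eta δ b - eta δ a ≤ b - a := by
  rw [eta_add δ a b, add_sub_cancel_left]
  have := intervalIntegral.integral_mono_on hab (st_ii δ a b)
    (intervalIntegrable_const (c := (1:ℝ))) (fun r _ => st_le_one δ r)
  simpa using this

lemma eta_mono {δ a b : ℝ} (hab : a ≤ b) : eta δ a ≤ eta δ b := by
  rw [eta_add δ a b]
  have := intervalIntegral.integral_nonneg (μ := volume) hab fun r _ => st_nonneg δ r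
  linarith

lemma eta_le {δ s : ℝ} (hδ : 0 < δ) (hs : 0 ≤ s) : eta δ s ≤ s := by
  have := eta_diff_le (δ := δ) hs
  rw [eta_zero hδ hδ.le] at this
  linarith

/-- Truncation constant. -/
def etac (δ : ℝ) : ℝ := 2 * δ - eta δ (2 * δ)

lemma eta_large {δ s : ℝ} (hδ : 0 < δ) (h : 2 * δ ≤ s) : eta δ s = s - etac δ := by
  rw [eta_add δ (2 * δ) s, intervalIntegral.integral_congr (g := fun _ => (1:ℝ))]
  · simp [etac]; ring
  · intro r hr
    rw [Set.uIcc_of_le h] at hr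
    exact st_one hδ hr.1

lemma etac_nonneg {δ : ℝ} (hδ : 0 < δ) : 0 ≤ etac δ := by
  have := eta_le hδ (s := 2 * δ) (by linarith)
  unfold etac; linarith

lemma etac_le {δ : ℝ} (hδ : 0 < δ) : etac δ ≤ 2 * δ := by
  have := eta_nonneg (δ := δ) (s := 2 * δ) (by linarith)
  unfold etac; linarith

lemma le_eta_add {δ s : ℝ} (hδ : 0 < δ) : s ≤ eta δ s + etac δ := by
  rcases le_total (2 * δ) s with h | h
  · rw [eta_large hδ h]; linarith
  · have := eta_diff_le (δ := δ) h
    unfold etac; linarith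

lemma lap_comp {f : ℝ → ℝ} {f' : ℝ → ℝ} (hf : ∀ s, HasDerivAt f (f' s) s)
    (hf' : Differentiable ℝ f')
    {u : E2 → ℝ} {x : E2} (hu : ContDiffAt ℝ 2 u x) :
    lap (fun y => f (u y)) x = f' (u x) * lap u x
      + deriv f' (u x) * ∑ i, fderiv ℝ u x (eb i) ^ 2 := by
  have hev : ∀ᶠ y in 𝓝 x, ContDiffAt ℝ 2 u y := hu.eventually (by simp)
  have key : ∀ i : Fin 2, (fun y => fderiv ℝ (fun y => f (u y)) y (eb i)) =ᶠ[𝓝 x]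
      fun y => f' (u y) * fderiv ℝ u y (eb i) := by
    intro i
    filter_upwards [hev] with y hy
    have h1 := (hf (u y)).comp_hasFDerivAt y (hy.differentiableAt (by norm_num)).hasFDerivAt
    have h2 : fderiv ℝ (fun y => f (u y)) y = f' (u y) • fderiv ℝ u y := h1.fderiv
    rw [h2]; simp
  unfold lap
  rw [Finset.mul_sum, Finset.mul_sum, ← Finset.sum_add_distrib]
  apply Finset.sum_congr rfl
  intro i _
  rw [(key i).fderiv_eq]
  have hd : DifferentiableAt ℝ (fderiv ℝ u) x :=
    (hu.fderiv_right (m := 1) (by norm_num)).differentiableAt one_ne_zero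
  have h3 : DifferentiableAt ℝ (fun y => fderiv ℝ u y (eb i)) x :=
    hd.clm_apply (differentiableAt_const _)
  have h4 := (hf' (u x)).hasDerivAt.comp_hasFDerivAt x
    (hu.differentiableAt (by norm_num)).hasFDerivAt
  have h5 := (h4.mul h3.hasFDerivAt).fderiv
  have h6 : fderiv ℝ (fun y => f' (u y) * fderiv ℝ u y (eb i)) x
      = fderiv ℝ ((f' ∘ u) * fun y => fderiv ℝ u y (eb i)) x := rfl
  rw [h6, h5]
  simp
  ring

/-- Truncated positive part. -/
def UU (Ω : Set E2) (u : E2 → ℝ) : E2 → ℝ := Ω.indicator (fun x => max (u x) 0)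

lemma UU_continuous {Ω : Set E2} {p : ℝ} {u : E2 → ℝ} (h : IsSolution Ω p u) :
    Continuous (UU Ω u) := by
  obtain ⟨h1, h2, h3, h4⟩ := h
  apply continuous_indicator
  · intro a ha; simp [h4 a ha]
  · exact h2.sup continuousOn_const

lemma UU_nonneg (Ω : Set E2) (u : E2 → ℝ) (x : E2) : 0 ≤ UU Ω u x :=
  Set.indicator_nonneg (fun _ _ => le_max_right _ _) _

lemma exists_PD {Ω : Set E2} (hΩ : IsOpen Ω) {p : ℝ} (hp : 1 < p) {u : E2 → ℝ}
    (hsol : IsSolution Ω p u) {x1 : E2} (hx1 : x1 ∈ Ω) (hmax : ∀ y ∈ closure Ω, u y ≤ u x1)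
    (hpos : 0 < u x1) {R : ℝ} (hR : 0 < R) (hball : ball x1 R ⊆ Ω)
    (hsign : ∀ y ∈ ball x1 R, 1 / p ≤ u y) {D : ℝ} (hD : 1 ≤ D) (hΩD : Ω ⊆ ball 0 (D / 2)) :
    ∃ w c, PD D p (UU Ω u) w x1 c R := by
  have hUc := UU_continuous hsol
  have hU0 := UU_nonneg Ω u
  have hUx1 : UU Ω u x1 = u x1 := by simp [UU, hx1, hpos.le]
  obtain ⟨h1, h2, h3, h4⟩ := hsol
  have hp0 : 0 < p := by linarith
  set δ := min (1 / p) (u x1 / 2) / 2 with hδ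
  have hδ0 : 0 < δ := by rw [hδ]; positivity
  have hδ1 : 2 * δ ≤ 1 / p := by rw [hδ]; linarith [min_le_left (1 / p) (u x1 / 2)]
  have hδ2 : 2 * δ ≤ u x1 / 2 := by rw [hδ]; linarith [min_le_right (1 / p) (u x1 / 2)]
  set w : E2 → ℝ := fun x => eta δ (UU Ω u x) with hw
  have win : ∀ x ∈ Ω, w x = eta δ (u x) := by
    intro x hx
    simp only [hw, UU, Set.indicator_of_mem hx]
    rcases le_total (u x) 0 with h | h
    · rw [max_eq_right h, eta_zero hδ0 hδ0.le, eta_zero hδ0 (by linarith)]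
    · rw [max_eq_left h]
  have wev : ∀ x ∈ Ω, w =ᶠ[𝓝 x] fun y => eta δ (u y) := fun x hx => by
    filter_upwards [hΩ.mem_nhds hx] with y hy using win y hy
  have wout : ∀ x ∉ Ω, w =ᶠ[𝓝 x] fun _ => 0 := fun x hx => by
    have h5 : UU Ω u x < δ := by simpa [UU, hx] using hδ0
    filter_upwards [hUc.continuousAt.eventually_lt_const h5] with y hy
    exact eta_zero hδ0 hy.le
  have hu : ∀ x ∈ Ω, ContDiffAt ℝ 2 u x := fun x hx => h1.contDiffAt (hΩ.mem_nhds hx)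
  have w2 : ContDiff ℝ 2 w := by
    rw [contDiff_iff_contDiffAt]
    intro x
    by_cases hx : x ∈ Ω
    · exact ((eta_contDiff δ).contDiffAt.comp x (hu x hx)).congr_of_eventuallyEq (wev x hx)
    · exact contDiffAt_const.congr_of_eventuallyEq (wout x hx)
  refine ⟨w, etac δ, hD, hp, hUc, hU0, ?_, w2, fun x => eta_nonneg (hU0 x),
    fun x => eta_le hδ0 (hU0 x), fun x => le_eta_add hδ0, etac_nonneg hδ0,
    (etac_le hδ0).trans hδ1, ?_, ?_, by rwa [hUx1], ?_, hR, ?_⟩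
  · intro x hx
    have : x ∈ Ω := by
      by_contra h; simp [UU, h] at hx
    simpa using hΩD this
  · rw [hUx1]; exact (etac_le hδ0).trans hδ2
  · intro x
    by_cases hx : x ∈ Ω
    · rw [lap_congr (wev x hx), lap_comp (eta_hasDerivAt δ)
        ((st_contDiff δ (n := 1)).differentiable (by norm_num)) (hu x hx)]
      have h6 := h3 x hx
      have h7 : 0 ≤ deriv (st δ) (u x) * ∑ i, fderiv ℝ u x (eb i) ^ 2 :=
        mul_nonneg ((st_mono hδ0).deriv_nonneg) (Finset.sum_nonneg fun _ _ => sq_nonneg _)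
      have h8 : -(st δ (u x) * lap u x) = st δ (u x) * (|u x| ^ (p - 1) * u x) := by
        rw [← h6]; ring
      have h9 : st δ (u x) * (|u x| ^ (p - 1) * u x) ≤ UU Ω u x ^ p := by
        rcases le_or_gt (u x) 0 with h | h
        · rw [st_zero hδ0 (by linarith), zero_mul]
          exact Real.rpow_nonneg (hU0 x) _
        · have h10 : UU Ω u x = u x := by simp [UU, hx, h.le]
          rw [h10, abs_of_pos h]
          have h11 : u x ^ (p - 1) * u x = u x ^ p := by
            rw [← Real.rpow_add_one h.ne']; congr 1; ring
          rw [h11]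
          have := Real.rpow_nonneg h.le p
          nlinarith [st_le_one δ (u x)]
      linarith
    · rw [lap_congr (wout x hx)]
      have : lap (fun _ : E2 => (0:ℝ)) x = 0 := by simp [lap]
      rw [this, neg_zero]
      exact Real.rpow_nonneg (hU0 x) _
  · intro x
    rw [hUx1]
    by_cases hx : x ∈ Ω
    · simp only [UU, Set.indicator_of_mem hx]
      exact max_le (hmax x (subset_closure hx)) hpos.le
    · simp [UU, hx, hpos.le]
  · intro x hx
    have hxΩ := hball hx
    have hux : 1 / p ≤ u x := hsign x hx
    have hux0 : 0 < u x := lt_of_lt_of_le (by positivity) hux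
    have h10 : UU Ω u x = u x := by simp [UU, hxΩ, hux0.le]
    constructor
    · rw [win x hxΩ, h10, eta_large hδ0 (by linarith)]
    · have hev : w =ᶠ[𝓝 x] fun y => u y - etac δ := by
        filter_upwards [isOpen_ball.mem_nhds hx] with y hy
        rw [win y (hball hy), eta_large hδ0 (by linarith [hsign y hy])]
      have h11 : lap (fun y => u y - etac δ) x = lap u x := by
        unfold lap
        simp only [fderiv_sub_const]
      rw [lap_congr hev, h11, h3 x hxΩ, h10, abs_of_pos hux0, ← Real.rpow_add_one hux0.ne']
      congr 1; ring

namespace PD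

variable {D p : ℝ} {U w : E2 → ℝ} {x1 : E2} {c R : ℝ}

lemma hp0 (h : PD D p U w x1 c R) : 0 < p := by linarith [h.hp]
lemma hD0 (h : PD D p U w x1 c R) : 0 < D := by linarith [h.hD]

lemma ws (h : PD D p U w x1 c R) : ∀ x, w x ≠ 0 → ‖x‖ < D / 2 := by
  intro x hx
  apply h.Us
  intro h0
  have := h.wU x
  exact hx (le_antisymm (by linarith) (h.w0 x))

lemma hc (h : PD D p U w x1 c R) : HasCompactSupport w :=
  HasCompactSupport.intro (isCompact_closedBall (0:E2) (D / 2)) fun x hx => by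
    by_contra h0
    exact hx (by simpa using (h.ws x h0).le)

lemma UcS (h : PD D p U w x1 c R) : HasCompactSupport U :=
  HasCompactSupport.intro (isCompact_closedBall (0:E2) (D / 2)) fun x hx => by
    by_contra h0
    exact hx (by simpa using (h.Us x h0).le)

lemma x1D (h : PD D p U w x1 c R) : ‖x1‖ < D / 2 := h.Us x1 h.M0.ne'

lemma powc (h : PD D p U w x1 c R) {q : ℝ} (hq : 0 < q) : Continuous (fun x => U x ^ q) :=
  h.Uc.rpow_const fun _ => Or.inr hq.le

lemma pow0 (h : PD D p U w x1 c R) (q : ℝ) (x : E2) : 0 ≤ U x ^ q := Real.rpow_nonneg (h.U0 x) q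

lemma pow_ne (h : PD D p U w x1 c R) {q : ℝ} (hq : 0 < q) {x : E2} (hx : U x ^ q ≠ 0) :
    U x ≠ 0 := fun h0 => hx (by rw [h0, Real.zero_rpow hq.ne'])

lemma powBB (h : PD D p U w x1 c R) {q : ℝ} (hq : 0 < q) : BB (fun x => U x ^ q) := by
  apply BB.of_continuous (h.powc hq)
  refine HasCompactSupport.intro (isCompact_closedBall (0:E2) (D / 2)) fun x hx => ?_
  by_contra h0
  exact hx (by simpa using (h.Us x (h.pow_ne hq h0)).le)

lemma FBB (h : PD D p U w x1 c R) : BB (fun x => U x ^ p) := h.powBB h.hp0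

lemma FM (h : PD D p U w x1 c R) (x : E2) : U x ^ p ≤ U x1 ^ p :=
  Real.rpow_le_rpow (h.U0 x) (h.UM x) h.hp0.le

lemma pow_succ (h : PD D p U w x1 c R) (x : E2) : U x ^ (p + 1) = U x * U x ^ p := by
  rcases (h.U0 x).eq_or_lt with h0 | h0
  · rw [← h0, Real.zero_rpow (by linarith [h.hp]), zero_mul]
  · rw [Real.rpow_add_one h0.ne', mul_comm]

lemma EBB (h : PD D p U w x1 c R) : BB (fun x => U x ^ (p + 1)) := h.powBB (by linarith [h.hp])

lemma m0 (h : PD D p U w x1 c R) : 0 ≤ ∫ x, U x ^ p := integral_nonneg fun x => h.pow0 p x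

lemma E0 (h : PD D p U w x1 c R) : 0 < ∫ x, U x ^ (p + 1) := by
  have hq : 0 < p + 1 := by linarith [h.hp]
  apply integral_pos_of_integrable_nonneg_nonzero (x := x1) (h.powc hq) h.EBB.integrable
    (fun x => h.pow0 _ x)
  exact (Real.rpow_pos_of_pos h.M0 _).ne'

lemma QBB (h : PD D p U w x1 c R) : BB (fun y => - lap w y) := lap_BB h.w2 h.hc

lemma Q_supp (h : PD D p U w x1 c R) {y : E2} (hy : - lap w y ≠ 0) : ‖y‖ ≤ D / 2 := by
  apply tsupport_le h.ws
  by_contra hn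
  apply hy
  have : w =ᶠ[𝓝 y] fun _ => 0 := by
    filter_upwards [(isClosed_tsupport w).isOpen_compl.mem_nhds hn] with z hz
    exact image_eq_zero_of_notMem_tsupport hz
  rw [lap_congr this]
  simp [lap]

lemma dir (h : PD D p U w x1 c R) : ∫ y, gn w y ^ 2 ≤ ∫ x, U x ^ (p + 1) := by
  rw [dirichlet h.w2 h.hc]
  apply integral_mono _ h.EBB.integrable
  · intro y
    simp only [h.pow_succ]
    calc w y * (- lap w y) ≤ w y * U y ^ p := mul_le_mul_of_nonneg_left (h.Q y) (h.w0 y)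
      _ ≤ _ := mul_le_mul_of_nonneg_right (h.wU y) (h.pow0 p y)
  · exact (h.w2.continuous.mul (lap_continuous h.w2).neg).integrable_of_hasCompactSupport
      h.hc.mul_right

lemma Q_abs (h : PD D p U w x1 c R) : ∫ y, |(- lap w y)| ≤ 2 * ∫ x, U x ^ p := by
  have h1 : ∀ y, |(- lap w y)| ≤ 2 * U y ^ p - (- lap w y) := by
    intro y
    have := h.Q y
    have := h.pow0 p y
    rw [abs_le]; constructor <;> linarith
  calc ∫ y, |(- lap w y)| ≤ ∫ y, (2 * U y ^ p - (- lap w y)) :=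
        integral_mono h.QBB.abs.integrable ((h.FBB.integrable.const_mul 2).sub h.QBB.integrable) h1
    _ = _ := by
      rw [integral_sub (h.FBB.integrable.const_mul 2) h.QBB.integrable, integral_const_mul,
        integral_neg, lap_integral_zero h.w2 h.hc]
      ring

lemma wx1 (h : PD D p U w x1 c R) : w x1 = U x1 - c := (h.loc x1 (mem_ball_self h.R0)).1

lemma w_le (h : PD D p U w x1 c R) {x : E2} (hx : ‖x‖ ≤ D / 2) :
    w x ≤ (1 / (2 * π)) * ∫ y, Real.log (D / ‖x - y‖) * U y ^ p := by
  rw [rep1D h.w2 h.hc h.hD0 x]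
  apply mul_le_mul_of_nonneg_left _ (by positivity)
  apply integral_mono ((Ker.log_div h.hD0).integrable h.QBB x)
    ((Ker.log_div h.hD0).integrable h.FBB x)
  intro y
  simp only
  by_cases hy : ‖y‖ ≤ D / 2
  · apply mul_le_mul_of_nonneg_left (h.Q y)
    have hxy : ‖x - y‖ ≤ D := (norm_sub_le _ _).trans (by linarith)
    rcases (norm_nonneg (x - y)).eq_or_lt with h0 | h0
    · rw [← h0]; simp
    · exact Real.log_nonneg (by rw [le_div_iff₀ h0]; linarith)
  · have h1 : - lap w y = 0 := by by_contra h2; exact hy (h.Q_supp h2)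
    have h2 : U y ^ p = 0 := by
      by_contra h2; exact hy (h.Us y (h.pow_ne h.hp0 h2)).le
    rw [h1, h2]

lemma m_le (h : PD D p U w x1 c R) {B : ℝ} (hB : p * ∫ x, U x ^ (p + 1) ≤ B) :
    p * ∫ x, U x ^ p ≤ 2 * B + D ^ 2 := by
  have hp := h.hp
  have hp0 := h.hp0
  have h2p : p ≤ 2 ^ p := by
    have := one_add_mul_self_le_rpow_one_add (s := 1) (by norm_num) hp.le
    norm_num at this
    linarith
  set a : ℝ := (1 / 2 : ℝ) ^ p with ha
  have ha2 : p * a ≤ 1 := by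
    rw [ha, one_div, Real.inv_rpow (by norm_num), ← div_eq_mul_inv,
      div_le_one (by positivity)]
    exact h2p
  have ha0 : 0 < a := by positivity
  have i1 : Integrable ((ball (0:E2) (D / 2)).indicator fun _ => a) := by
    rw [integrable_indicator_iff measurableSet_ball]
    exact integrableOn_const measure_ball_lt_top.ne
  have hpt : ∀ y, U y ^ p ≤ 2 * U y ^ (p + 1) + (ball (0:E2) (D / 2)).indicator (fun _ => a) y := by
    intro y
    rw [h.pow_succ]
    have hF := h.pow0 p y
    rcases le_total (U y) (1 / 2) with h1 | h1
    · by_cases h0 : U y = 0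
      · rw [h0, Real.zero_rpow hp0.ne']
        simp only [mul_zero, zero_add]
        exact Set.indicator_nonneg (fun _ _ => ha0.le) _
      · rw [Set.indicator_of_mem (by simpa using h.Us y h0)]
        have := Real.rpow_le_rpow (h.U0 y) h1 hp0.le
        have := mul_nonneg (h.U0 y) hF
        linarith
    · have : 0 ≤ (ball (0:E2) (D / 2)).indicator (fun _ => a) y :=
        Set.indicator_nonneg (fun _ _ => ha0.le) _
      nlinarith
  have hI : ∫ y, U y ^ p ≤ 2 * (∫ y, U y ^ (p + 1)) + π * (D / 2) ^ 2 * a := by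
    have := integral_mono h.FBB.integrable ((h.EBB.integrable.const_mul 2).add i1) hpt
    simp only [Pi.add_apply] at this
    rw [integral_add (h.EBB.integrable.const_mul 2) i1, integral_const_mul,
      integral_indicator measurableSet_ball, setIntegral_const, vol_ball 0 (by linarith [h.hD]),
      smul_eq_mul] at this
    exact this
  have h3 : p * ∫ y, U y ^ p ≤ 2 * (p * ∫ y, U y ^ (p + 1)) + π * (D / 2) ^ 2 * (p * a) := by
    nlinarith
  have h4 : π * (D / 2) ^ 2 * (p * a) ≤ D ^ 2 := by
    have : π * (D / 2) ^ 2 * (p * a) ≤ π * (D / 2) ^ 2 * 1 :=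
      mul_le_mul_of_nonneg_left ha2 (by positivity)
    nlinarith [Real.pi_lt_four, sq_nonneg D]
  linarith

lemma M_low (h : PD D p U w x1 c R) : 1 / (2 * D ^ 2) ≤ U x1 ^ (p - 1) := by
  have hM := h.M0
  have h1 := h.w_le h.x1D.le
  have h2 := bathtub h.FBB (h.pow0 p) h.FM h.hD0 h.hD0 x1
  rw [div_self h.hD0.ne', Real.log_one, zero_mul, zero_add] at h2
  have h3 : w x1 ≤ D ^ 2 * U x1 ^ p := by
    calc w x1 ≤ (1 / (2 * π)) * (2 * π * D ^ 2 * U x1 ^ p) :=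
          h1.trans (mul_le_mul_of_nonneg_left h2 (by positivity))
      _ = _ := by have := Real.pi_ne_zero
                  field_simp
  rw [h.wx1] at h3
  have h4 : U x1 ^ p = U x1 ^ (p - 1) * U x1 := by
    rw [← Real.rpow_add_one hM.ne']; congr 1; ring
  rw [h4] at h3
  have h5 := h.cM
  have h6 : U x1 * (1 / 2) ≤ U x1 * (D ^ 2 * U x1 ^ (p - 1)) := by nlinarith
  have h7 := le_of_mul_le_mul_left h6 hM
  have := h.hD0
  rw [div_le_iff₀ (by positivity)]
  nlinarith

end PD

/-- The concentration scale. -/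
def eps (p M : ℝ) : ℝ := (√(p * M ^ (p - 1)))⁻¹

lemma eps_pos {p M : ℝ} (hp : 0 < p) (hM : 0 < M) : 0 < eps p M := by
  unfold eps; positivity

lemma eps_sq {p M : ℝ} (hp : 0 < p) (hM : 0 < M) : M ^ p * eps p M ^ 2 = M / p := by
  unfold eps
  rw [inv_pow, Real.sq_sqrt (by positivity)]
  have h4 : M ^ p = M ^ (p - 1) * M := by
    rw [← Real.rpow_add_one hM.ne']; congr 1; ring
  have : M ^ (p - 1) ≠ 0 := by positivity
  rw [h4]
  field_simp

lemma eps_log {p M : ℝ} (hp : 0 < p) (hM : 0 < M) {D : ℝ} (hD : 0 < D) :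
    Real.log (D / eps p M) = Real.log D + (Real.log p + (p - 1) * Real.log M) / 2 := by
  have : M ^ (p - 1) ≠ 0 := by positivity
  unfold eps
  rw [div_inv_eq_mul, Real.log_mul hD.ne' (by positivity), Real.log_sqrt (by positivity),
    Real.log_mul hp.ne' this, Real.log_rpow hM]

lemma log_le_div_add {x k : ℝ} (hx : 0 < x) (hk : 0 < k) :
    Real.log x ≤ x / k + Real.log k := by
  have := Real.log_le_sub_one_of_pos (div_pos hx hk)
  rw [Real.log_div hx.ne' hk.ne'] at this
  linarith

/-- Soft lower bound on the maximum. -/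
lemma M_ge (D : ℝ) {a : ℝ} (ha : a < 1) : ∀ᶠ p : ℝ in atTop, ∀ (U w : E2 → ℝ) (x1 : E2) (c R : ℝ),
    PD D p U w x1 c R → a ≤ U x1 := by
  rcases le_or_gt a 0 with ha0 | ha0
  · filter_upwards with p U w x1 c R h
    linarith [h.M0]
  have hl : Real.log a < 0 := Real.log_neg ha0 ha
  have : Tendsto (fun p : ℝ => (p - 1) * Real.log a) atTop atBot :=
    (tendsto_atTop_add_const_right _ _ tendsto_id).atTop_mul_const_of_neg hl
  filter_upwards [this.eventually_lt_atBot (Real.log (1 / (2 * D ^ 2)))] with p hp U w x1 c R h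
  by_contra! hlt
  have hD := h.hD0
  have h1 := Real.log_le_log (by positivity) h.M_low
  rw [Real.log_rpow h.M0] at h1
  have h2 : Real.log (U x1) ≤ Real.log a := Real.log_le_log h.M0 hlt.le
  have h3 : 0 ≤ p - 1 := by linarith [h.hp]
  nlinarith

/-- Soft upper bound on the maximum. -/
lemma M_le (D B : ℝ) : ∃ C, 1 ≤ C ∧ ∀ p : ℝ, 8 ≤ p → ∀ (U w : E2 → ℝ) (x1 : E2) (c R : ℝ),
    PD D p U w x1 c R → p * ∫ x, U x ^ (p + 1) ≤ B → U x1 ≤ C := by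
  set m := 2 * |B| + D ^ 2 + 1 with hm
  have hm0 : 0 < m := by positivity
  set L := |Real.log D| + 1 with hL
  refine ⟨8 * (m * (L + |Real.log (8 * m)|) + 1) + 1, ?_, ?_⟩
  · have : 0 ≤ m * (L + |Real.log (8 * m)|) := by positivity
    linarith
  intro p hp8 U w x1 c R h hB
  have hp0 := h.hp0
  have hM := h.M0
  set M := U x1 with hMdef
  have hpm : p * ∫ x, U x ^ p ≤ m := by
    have := h.m_le (hB.trans (le_abs_self B))
    linarith
  have he := eps_pos hp0 hM
  have h1 := h.w_le h.x1D.le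
  have h2 := bathtub h.FBB (h.pow0 p) h.FM he h.hD0 x1
  have h3 : w x1 ≤ (1 / (2 * π)) * (Real.log (D / eps p M) * (∫ y, U y ^ p)) + M / p := by
    refine (h1.trans (mul_le_mul_of_nonneg_left h2 (by positivity))).trans (le_of_eq ?_)
    rw [← eps_sq hp0 hM, ← hMdef]
    have := Real.pi_ne_zero
    field_simp
  rw [h.wx1] at h3
  have h5 := h.cM
  have h6 := log_le_div_add hM (show 0 < 8 * m by positivity)
  rw [eps_log hp0 hM h.hD0] at h3
  have h7 : Real.log p ≤ p := (Real.log_le_sub_one_of_pos hp0).trans (by linarith)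
  have hlk := le_abs_self (Real.log (8 * m))
  have h8 : Real.log D + (Real.log p + (p - 1) * Real.log M) / 2
      ≤ p * (L + M / (8 * m) + |Real.log (8 * m)|) := by
    have h9 : (p - 1) * Real.log M ≤ p * (M / (8 * m) + |Real.log (8 * m)|) := by
      have h10 : 0 ≤ M / (8 * m) + |Real.log (8 * m)| := by positivity
      have h11 : (p - 1) * Real.log M ≤ (p - 1) * (M / (8 * m) + |Real.log (8 * m)|) :=
        mul_le_mul_of_nonneg_left (by linarith) (by linarith)
      nlinarith
    have h12 : 0 ≤ p * (M / (8 * m) + |Real.log (8 * m)|) := by positivity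
    have h13 := le_abs_self (Real.log D)
    have h14 : |Real.log D| ≤ p * |Real.log D| := by nlinarith [abs_nonneg (Real.log D)]
    have h15 : p * L = p * |Real.log D| + p := by rw [hL]; ring
    nlinarith
  have h16 : (Real.log D + (Real.log p + (p - 1) * Real.log M) / 2) * (∫ y, U y ^ p)
      ≤ m * (L + M / (8 * m) + |Real.log (8 * m)|) := by
    have h17 : 0 ≤ L + M / (8 * m) + |Real.log (8 * m)| := by positivity
    calc _ ≤ p * (L + M / (8 * m) + |Real.log (8 * m)|) * (∫ y, U y ^ p) :=
          mul_le_mul_of_nonneg_right h8 h.m0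
      _ = (p * ∫ y, U y ^ p) * (L + M / (8 * m) + |Real.log (8 * m)|) := by ring
      _ ≤ _ := mul_le_mul_of_nonneg_right hpm h17
  have h18 : m * (L + M / (8 * m) + |Real.log (8 * m)|)
      = m * (L + |Real.log (8 * m)|) + M / 8 := by field_simp; ring
  rw [h18] at h16
  have h19 : (1 / (2 * π)) * ((Real.log D + (Real.log p + (p - 1) * Real.log M) / 2)
      * (∫ y, U y ^ p)) ≤ m * (L + |Real.log (8 * m)|) + M / 8 := by
    have h20 : 0 ≤ m * (L + |Real.log (8 * m)|) + M / 8 := by positivity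
    have h21 : 1 / (2 * π) ≤ 1 := by
      rw [div_le_one (by positivity)]; linarith [Real.pi_gt_three]
    have h22 : 0 ≤ 1 / (2 * π) := by positivity
    nlinarith [mul_le_mul_of_nonneg_left h16 h22]
  have h23 : M / p ≤ M / 8 := div_le_div_of_nonneg_left hM.le (by norm_num) hp8
  linarith

lemma log_one_add_sq_le {r ε : ℝ} (hr : 0 < r) (hε : 0 < ε) :
    Real.log (1 + ε ^ 2 / r ^ 2) ≤ 2 * (ε * r⁻¹) := by
  have hx : 0 < ε * r⁻¹ := by positivity
  have h1 : 1 + ε ^ 2 / r ^ 2 ≤ (1 + ε * r⁻¹) ^ 2 := by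
    have : ε ^ 2 / r ^ 2 = (ε * r⁻¹) ^ 2 := by field_simp
    rw [this]; nlinarith
  calc Real.log (1 + ε ^ 2 / r ^ 2) ≤ Real.log ((1 + ε * r⁻¹) ^ 2) :=
        Real.log_le_log (by positivity) h1
    _ = 2 * Real.log (1 + ε * r⁻¹) := log_sq_norm _
    _ ≤ _ := by
      have := Real.log_le_sub_one_of_pos (show 0 < 1 + ε * r⁻¹ by positivity)
      linarith

lemma log_one_add_K1 {ε : ℝ} (hε : 0 < ε) (z : E2) (hz : z ≠ 0) :
    Real.log (1 + ε ^ 2 / ‖z‖ ^ 2) ≤ 1 + 2 * ε * K1 ε z := by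
  have hz0 : 0 < ‖z‖ := norm_pos_iff.2 hz
  rcases lt_or_ge ‖z‖ ε with h | h
  · rw [K1_of_lt h]
    have := log_one_add_sq_le hz0 hε
    linarith
  · have h1 := Real.log_le_sub_one_of_pos (show 0 < 1 + ε ^ 2 / ‖z‖ ^ 2 by positivity)
    have h2 : ε ^ 2 / ‖z‖ ^ 2 ≤ 1 := by
      rw [div_le_one (by positivity)]; exact pow_le_pow_left₀ hε.le h 2
    have := mul_nonneg (mul_nonneg zero_le_two hε.le) (K1_nonneg ε z)
    linarith

namespace PD

variable {D p : ℝ} {U w : E2 → ℝ} {x1 : E2} {c R : ℝ}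

lemma eps0 (h : PD D p U w x1 c R) : 0 < eps p (U x1) := eps_pos h.hp0 h.M0

lemma rho_est (h : PD D p U w x1 c R) :
    ∫ y, rho (eps p (U x1)) (x1 - y) * (U x1 - w y) ≤ (1 + (p * ∫ y, U y ^ p) + U x1) / p := by
  set ε := eps p (U x1) with hεd
  have hε : 0 < ε := h.eps0
  have hp := h.hp0
  have hr4 := rep4 h.w2 h.hc h.FBB h.Q hε x1
  have iK : Integrable (fun y => K1 ε (x1 - y)) := (K1_integrable ε).comp_sub_left x1
  have h1 : ∫ y, Real.log (1 + ε ^ 2 / ‖x1 - y‖ ^ 2) * U y ^ p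
      ≤ (∫ y, U y ^ p) + 4 * π * (U x1 / p) := by
    have i2 : Integrable (fun y => 2 * ε * U x1 ^ p * K1 ε (x1 - y)) := iK.const_mul _
    have : ∫ y, Real.log (1 + ε ^ 2 / ‖x1 - y‖ ^ 2) * U y ^ p
        ≤ ∫ y, (U y ^ p + 2 * ε * U x1 ^ p * K1 ε (x1 - y)) := by
      apply integral_mono_ae ((Ker.log_one_add ε).integrable h.FBB x1) (h.FBB.integrable.add i2)
      filter_upwards [ae_sub_ne x1] with y hy
      have a1 := log_one_add_K1 hε _ hy
      have a2 := h.FM y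
      have a3 := h.pow0 p y
      have a4 := K1_nonneg ε (x1 - y)
      have a5 : 2 * ε * K1 ε (x1 - y) * U y ^ p ≤ 2 * ε * K1 ε (x1 - y) * U x1 ^ p :=
        mul_le_mul_of_nonneg_left a2 (by positivity)
      have a6 := mul_le_mul_of_nonneg_right a1 a3
      simp only [Pi.add_apply]
      linarith
    rw [integral_add h.FBB.integrable i2, integral_const_mul,
      integral_sub_left_eq_self (fun y => K1 ε y) volume x1, K1_integral hε.le] at this
    refine this.trans (le_of_eq ?_)
    rw [← eps_sq hp h.M0]
    ring
  have ir : Integrable (fun y => rho ε (x1 - y)) := (rho_integrable hε).comp_sub_left x1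
  have hwb : ∀ y, ‖w y‖ ≤ U x1 := fun y => by
    rw [Real.norm_eq_abs, abs_of_nonneg (h.w0 y)]; exact (h.wU y).trans (h.UM y)
  have irw : Integrable (fun y => rho ε (x1 - y) * w y) :=
    ir.mul_bdd h.w2.continuous.aestronglyMeasurable (Eventually.of_forall hwb)
  have h2 : ∫ y, rho ε (x1 - y) * (U x1 - w y) = U x1 - ∫ y, rho ε (x1 - y) * w y := by
    have : (fun y => rho ε (x1 - y) * (U x1 - w y))
      = fun y => rho ε (x1 - y) * U x1 - rho ε (x1 - y) * w y := by ext y; ring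
    rw [this, integral_sub (ir.mul_const _) irw, integral_mul_const,
      integral_sub_left_eq_self (fun y => rho ε y) volume x1, rho_integral hε, one_mul]
  rw [h2]
  have h3 := h.wx1
  have h4 := h.cp
  have h5 : (1 / (4 * π)) * ((∫ y, U y ^ p) + 4 * π * (U x1 / p)) ≤ (∫ y, U y ^ p) + U x1 / p := by
    have : (1 / (4 * π)) * ((∫ y, U y ^ p) + 4 * π * (U x1 / p))
        = (1 / (4 * π)) * (∫ y, U y ^ p) + U x1 / p := by
      have := Real.pi_ne_zero
      field_simp
    rw [this]
    have h6 : 1 / (4 * π) ≤ 1 := by rw [div_le_one (by positivity)]; linarith [Real.pi_gt_three]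
    nlinarith [h.m0]
  have h7 : (1 / (4 * π)) * (∫ y, Real.log (1 + ε ^ 2 / ‖x1 - y‖ ^ 2) * U y ^ p) ≤
      (1 / (4 * π)) * ((∫ y, U y ^ p) + 4 * π * (U x1 / p)) :=
    mul_le_mul_of_nonneg_left h1 (by positivity)
  have h8 : (1 + (p * ∫ y, U y ^ p) + U x1) / p = 1 / p + (∫ y, U y ^ p) + U x1 / p := by
    field_simp
  rw [h8]
  linarith

/-- Good set at the concentration scale. -/
lemma good_vol (h : PD D p U w x1 c R) {K : ℝ} (hK : 1 ≤ K) (hm : p * ∫ y, U y ^ p ≤ K)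
    (hM : U x1 ≤ K) :
    π * eps p (U x1) ^ 2 / 2 ≤
      volume.real (ball x1 (eps p (U x1)) ∩ {y | U x1 - 24 * K / p ≤ w y}) := by
  set ε := eps p (U x1) with hεd
  have hε : 0 < ε := h.eps0
  have hp := h.hp0
  set T := 24 * K / p with hT
  have hT0 : 0 < T := by positivity
  set G := ball x1 ε ∩ {y | w y < U x1 - T} with hG
  have hGm : MeasurableSet G :=
    measurableSet_ball.inter (measurableSet_lt h.w2.continuous.measurable measurable_const)
  have hGf : volume G ≠ ⊤ := (measure_mono_top (Set.inter_subset_left) · |> measure_ball_lt_top.ne)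
  have ir : Integrable (fun y => rho ε (x1 - y)) := (rho_integrable hε).comp_sub_left x1
  have hwb : ∀ y, ‖U x1 - w y‖ ≤ U x1 := fun y => by
    have h1 := (h.wU y).trans (h.UM y)
    have h2 := h.w0 y
    rw [Real.norm_eq_abs, abs_of_nonneg (by linarith)]; linarith
  have irw : Integrable (fun y => rho ε (x1 - y) * (U x1 - w y)) :=
    ir.mul_bdd (continuous_const.sub h.w2.continuous).aestronglyMeasurable (Eventually.of_forall hwb)
  have h1 : T / (4 * π * ε ^ 2) * volume.real G ≤ ∫ y, rho ε (x1 - y) * (U x1 - w y) := by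
    have : ∫ y, G.indicator (fun _ => T / (4 * π * ε ^ 2)) y
        ≤ ∫ y, rho ε (x1 - y) * (U x1 - w y) := by
      apply integral_mono _ irw
      · intro y
        by_cases hy : y ∈ G
        · simp only [Set.indicator_of_mem hy]
          have hy1 : ‖x1 - y‖ < ε := by
            have := hy.1; rwa [mem_ball, dist_comm, dist_eq_norm] at this
          have hy2 : w y < U x1 - T := hy.2
          have hr : 1 / (4 * π * ε ^ 2) ≤ rho ε (x1 - y) := by
            unfold rho
            rw [div_le_div_iff₀ (by positivity) (by positivity)]
            have : ‖x1 - y‖ ^ 2 ≤ ε ^ 2 := pow_le_pow_left₀ (norm_nonneg _) hy1.le 2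
            have : (‖x1 - y‖ ^ 2 + ε ^ 2) ^ 2 ≤ (2 * ε ^ 2) ^ 2 :=
              pow_le_pow_left₀ (by positivity) (by linarith) 2
            nlinarith [Real.pi_pos]
          calc T / (4 * π * ε ^ 2) = 1 / (4 * π * ε ^ 2) * T := by ring
            _ ≤ _ := mul_le_mul hr (by linarith) hT0.le (rho_nonneg _ _)
        · simp only [Set.indicator_of_notMem hy]
          have h1 := (h.wU y).trans (h.UM y)
          exact mul_nonneg (rho_nonneg _ _) (by linarith)
      · rw [integrable_indicator_iff hGm]
        exact integrableOn_const hGf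
    rw [integral_indicator hGm, setIntegral_const, smul_eq_mul] at this
    linarith
  have h2 := h1.trans h.rho_est
  have h3 : (1 + (p * ∫ y, U y ^ p) + U x1) / p ≤ 3 * K / p := by
    apply div_le_div_of_nonneg_right _ hp.le; linarith
  have h4 : volume.real G ≤ π * ε ^ 2 / 2 := by
    have h5 : T / (4 * π * ε ^ 2) * volume.real G ≤ T / (4 * π * ε ^ 2) * (π * ε ^ 2 / 2) := by
      refine (h2.trans h3).trans (le_of_eq ?_)
      rw [hT]
      have := Real.pi_ne_zero
      field_simp
      norm_num
    exact le_of_mul_le_mul_left h5 (by positivity)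
  have h6 : ball x1 ε ∩ {y | U x1 - T ≤ w y} = ball x1 ε \ G := by
    ext y; simp only [hG, Set.mem_inter_iff, Set.mem_ofPred_eq, Set.mem_sdiff, not_and, not_lt]
    tauto
  rw [h6, measureReal_sdiff Set.inter_subset_left hGm measure_ball_lt_top.ne, vol_ball x1 hε.le]
  linarith

lemma F_low (h : PD D p U w x1 c R) {K : ℝ} (hK : 1 ≤ K)
    (hM2 : 1 / 2 ≤ U x1) (hpK : 96 * K ≤ p) {y : E2} (hy : U x1 - 24 * K / p ≤ w y) :
    U x1 ^ p * Real.exp (-(96 * K)) ≤ U y ^ p := by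
  have hp := h.hp0
  have hM := h.M0
  set x := 24 * K / (p * U x1) with hx
  have hx0 : 0 < x := by positivity
  have hx1 : x ≤ 1 / 2 := by
    rw [hx, div_le_div_iff₀ (by positivity) (by norm_num)]
    nlinarith
  have hle : U x1 * Real.exp (-(2 * x)) ≤ U y := by
    have h1 : Real.exp (-(2 * x)) ≤ 1 - x := by
      rw [Real.exp_neg, inv_le_comm₀ (Real.exp_pos _) (by linarith)]
      have := Real.add_one_le_exp (2 * x)
      refine le_trans ?_ this
      rw [inv_le_iff_one_le_mul₀ (by linarith)]
      nlinarith
    have h2 : U x1 * (1 - x) = U x1 - 24 * K / p := by rw [hx]; field_simp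
    have := mul_le_mul_of_nonneg_left h1 hM.le
    linarith [h.wU y]
  have := Real.rpow_le_rpow (by positivity) hle hp.le
  rw [Real.mul_rpow hM.le (Real.exp_pos _).le, ← Real.exp_mul] at this
  refine le_trans ?_ this
  apply mul_le_mul_of_nonneg_left _ (by positivity)
  apply Real.exp_le_exp.2
  have : x * p = 24 * K / U x1 := by rw [hx]; field_simp
  have h3 : 24 * K / U x1 ≤ 48 * K := by
    rw [div_le_iff₀ hM]; nlinarith
  nlinarith

lemma m_eps (h : PD D p U w x1 c R) {K : ℝ} (hK : 1 ≤ K) (hm : p * ∫ y, U y ^ p ≤ K)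
    (hM : U x1 ≤ K) (hM2 : 1 / 2 ≤ U x1) (hpK : 96 * K ≤ p) :
    Real.exp (-(96 * K)) / 2 ≤ p * ∫ y in ball x1 (eps p (U x1)), U y ^ p := by
  have hp := h.hp0
  set ε := eps p (U x1) with hεd
  have hε : 0 < ε := h.eps0
  have hv := h.good_vol hK hm hM
  rw [← hεd] at hv
  set S := ball x1 ε ∩ {y | U x1 - 24 * K / p ≤ w y} with hS
  have hSm : MeasurableSet S :=
    measurableSet_ball.inter (measurableSet_le measurable_const h.w2.continuous.measurable)
  have hSf : volume S ≠ ⊤ := (measure_mono_top (Set.inter_subset_left) · |> measure_ball_lt_top.ne)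
  have h1 : U x1 ^ p * Real.exp (-(96 * K)) * volume.real S ≤ ∫ y in S, U y ^ p := by
    have := setIntegral_mono_on (μ := volume) (s := S)
      (f := fun _ => U x1 ^ p * Real.exp (-(96 * K))) (g := fun y => U y ^ p)
      (integrableOn_const hSf) h.FBB.integrable.integrableOn hSm
      (fun y hy => h.F_low hK hM2 hpK hy.2)
    rw [setIntegral_const, smul_eq_mul] at this
    linarith
  have h2 : ∫ y in S, U y ^ p ≤ ∫ y in ball x1 ε, U y ^ p :=
    setIntegral_mono_set h.FBB.integrable.integrableOn
      (Eventually.of_forall fun y => h.pow0 p y) (Set.inter_subset_left.eventuallyLE)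
  have h3 : U x1 ^ p * Real.exp (-(96 * K)) * (π * ε ^ 2 / 2)
      ≤ U x1 ^ p * Real.exp (-(96 * K)) * volume.real S :=
    mul_le_mul_of_nonneg_left hv (by have := h.M0; positivity)
  have h4 : p * (U x1 ^ p * Real.exp (-(96 * K)) * (π * ε ^ 2 / 2))
      = Real.exp (-(96 * K)) / 2 * (π * U x1) := by
    have : p * (U x1 ^ p * ε ^ 2) = U x1 := by rw [eps_sq hp h.M0]; field_simp
    calc _ = Real.exp (-(96 * K)) / 2 * π * (p * (U x1 ^ p * ε ^ 2)) := by ring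
      _ = _ := by rw [this]; ring
  have h5 : 1 ≤ π * U x1 := by nlinarith [Real.pi_gt_three]
  have h6 : Real.exp (-(96 * K)) / 2 * 1 ≤ Real.exp (-(96 * K)) / 2 * (π * U x1) :=
    mul_le_mul_of_nonneg_left h5 (by positivity)
  rw [← h4, mul_one] at h6
  refine h6.trans (mul_le_mul_of_nonneg_left (h3.trans (h1.trans h2)) hp.le)

/-- Moser-Trudinger at the top level. -/
lemma MT_top (h : PD D p U w x1 c R) {K : ℝ} (hK : 1 ≤ K) (hm : p * ∫ y, U y ^ p ≤ K)
    (hM : U x1 ≤ K) (hM2 : 1 / 2 ≤ U x1) (hpK : 96 * K ≤ p) :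
    U x1 - 25 * K / p ≤ √(∫ y, U y ^ (p + 1)) *
      (√((2 * Real.log D + Real.log p + (p - 1) * Real.log (U x1)) / (4 * π)) + 1) := by
  have hp := h.hp0
  have hE := h.E0
  set ε := eps p (U x1) with hεd
  have hε : 0 < ε := h.eps0
  have hv := h.good_vol hK hm hM
  rw [← hεd] at hv
  set l := U x1 - 25 * K / p with hl
  have hl0 : 0 ≤ l := by
    have : 25 * K / p ≤ 1 / 2 := by rw [div_le_iff₀ hp]; linarith
    linarith
  have hfin : volume {x | l < w x} ≠ ⊤ := by
    refine ((measure_mono ?_).trans_lt (measure_ball_lt_top (x := (0:E2)) (r := D / 2))).ne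
    intro x hx
    have hx : l < w x := hx
    have := h.ws x (by linarith)
    simpa using this
  have hV : ε ^ 2 ≤ volume.real {x | l < w x} := by
    have h1 : volume.real (ball x1 ε ∩ {y | U x1 - 24 * K / p ≤ w y}) ≤ volume.real {x | l < w x} := by
      apply measureReal_mono _ hfin
      intro y hy
      have h2 : U x1 - 24 * K / p ≤ w y := hy.2
      have h3 : 24 * K / p < 25 * K / p := by
        apply div_lt_div_of_pos_right _ hp; linarith
      show l < w y
      linarith
    nlinarith [Real.pi_gt_three, sq_nonneg ε]
  have hV0 : 0 < volume.real {x | l < w x} := lt_of_lt_of_le (by positivity) hV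
  have hmt := MT h.w2 h.hc h.hD0 (Real.sqrt_pos.2 hE) h.ws
    (by rw [Real.sq_sqrt hE.le]; exact h.dir) hl0 hV0
  refine hmt.trans ?_
  have hD0 := h.hD0
  have h5 : Real.log (D ^ 2 / volume.real {x | l < w x})
      ≤ 2 * Real.log D + Real.log p + (p - 1) * Real.log (U x1) := by
    calc Real.log (D ^ 2 / volume.real {x | l < w x}) ≤ Real.log (D ^ 2 / ε ^ 2) := by
          apply Real.log_le_log (by positivity)
          exact div_le_div_of_nonneg_left (by positivity) (by positivity) hV
      _ = Real.log ((D / ε) ^ 2) := by rw [div_pow]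
      _ = 2 * Real.log (D / ε) := log_sq_norm _
      _ = _ := by rw [hεd, eps_log hp h.M0 h.hD0]; ring
  gcongr

end PD

lemma log_div_tendsto : Tendsto (fun p : ℝ => Real.log p / p) atTop (𝓝 0) :=
  Real.isLittleO_log_id_atTop.tendsto_div_nhds_zero

lemma const_div_tendsto (K : ℝ) : Tendsto (fun p : ℝ => K / p) atTop (𝓝 0) :=
  tendsto_const_nhds.div_atTop tendsto_id

/-- A uniform bound constant. -/
lemma K_bd (D B : ℝ) : ∃ K, 1 ≤ K ∧ ∀ᶠ p : ℝ in atTop, ∀ (U w : E2 → ℝ) (x1 : E2) (c R : ℝ),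
    PD D p U w x1 c R → p * ∫ x, U x ^ (p + 1) ≤ B →
    9 / 10 ≤ U x1 ∧ U x1 ≤ K ∧ p * ∫ x, U x ^ p ≤ K ∧ 96 * K ≤ p := by
  obtain ⟨C, hC, h1⟩ := M_le D B
  refine ⟨C + |2 * B + D ^ 2|, by linarith [abs_nonneg (2 * B + D ^ 2)], ?_⟩
  filter_upwards [eventually_ge_atTop 8, M_ge D (show (9/10:ℝ) < 1 by norm_num),
    eventually_ge_atTop (96 * (C + |2 * B + D ^ 2|))] with p hp hp2 hp3 U w x1 c R h hB
  refine ⟨hp2 _ _ _ _ _ h, ?_, ?_, hp3⟩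
  · linarith [abs_nonneg (2 * B + D ^ 2), h1 p hp U w x1 c R h hB]
  · linarith [le_abs_self (2 * B + D ^ 2), h.m_le hB]

lemma raw (D B : ℝ) {δ : ℝ} (hδ : 0 < δ) :
    ∀ᶠ p : ℝ in atTop, ∀ (U w : E2 → ℝ) (x1 : E2) (c R : ℝ),
    PD D p U w x1 c R → p * ∫ x, U x ^ (p + 1) ≤ B →
    U x1 ^ 2 - 2 * δ * U x1 ≤
      (p * ∫ x, U x ^ (p + 1)) * (max 0 (Real.log (U x1)) + δ) / (4 * π) := by
  obtain ⟨K, hK, hev⟩ := K_bd D B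
  have e1 := (const_div_tendsto (25 * K)).eventually_lt_const (half_pos hδ)
  have e2 := ((const_div_tendsto B).sqrt).eventually_lt_const
    (show √0 < δ / 2 by simpa using half_pos hδ)
  have e3 := ((const_div_tendsto (2 * Real.log D)).add log_div_tendsto).eventually_lt_const
    (show (0:ℝ) + 0 < δ by simpa using hδ)
  filter_upwards [hev, e1, e2, e3, eventually_gt_atTop 1] with p hp e1 e2 e3 hp1 U w x1 c R h hB
  obtain ⟨hM, hMK, hmK, hpK⟩ := hp U w x1 c R h hB
  have hp0 := h.hp0
  have hmt := h.MT_top hK hmK hMK (by linarith) hpK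
  have hE := h.E0
  set M := U x1 with hMd
  set E := ∫ x, U x ^ (p + 1) with hEd
  have hsE : √E ≤ δ / 2 := by
    refine le_trans (Real.sqrt_le_sqrt ?_) e2.le
    rw [le_div_iff₀ hp0]; linarith
  set L := max 0 (Real.log M) with hL
  have hL0 : 0 ≤ L := le_max_left _ _
  have h1 : √E * √((2 * Real.log D + Real.log p + (p - 1) * Real.log M) / (4 * π))
      ≤ √(p * E * (L + δ) / (4 * π)) := by
    rw [← Real.sqrt_mul hE.le]
    apply Real.sqrt_le_sqrt
    have h2 : 2 * Real.log D + Real.log p ≤ δ * p := by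
      have : 2 * Real.log D / p + Real.log p / p = (2 * Real.log D + Real.log p) / p := by ring
      rw [this, div_lt_iff₀ hp0] at e3; linarith
    have h3 : (p - 1) * Real.log M ≤ p * L := by
      have a1 : (p - 1) * Real.log M ≤ (p - 1) * L :=
        mul_le_mul_of_nonneg_left (le_max_right _ _) (by linarith)
      nlinarith
    have h4 : E * ((2 * Real.log D + Real.log p + (p - 1) * Real.log M) / (4 * π)) ≤
        E * ((p * (L + δ)) / (4 * π)) := by
      apply mul_le_mul_of_nonneg_left _ hE.le
      apply div_le_div_of_nonneg_right _ (by positivity)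
      linarith
    refine h4.trans (le_of_eq (by ring))
  have h5 : M - δ ≤ √(p * E * (L + δ) / (4 * π)) := by
    rw [mul_add, mul_one] at hmt
    linarith
  have hA : 0 ≤ p * E * (L + δ) / (4 * π) := by positivity
  rcases le_or_gt 0 (M - δ) with h6 | h6
  · have := pow_le_pow_left₀ h6 h5 2
    rw [Real.sq_sqrt hA] at this
    nlinarith
  · nlinarith

lemma log_le_sq {M : ℝ} (hM : 0 < M) : Real.log M ≤ M ^ 2 / (2 * Real.exp 1) := by
  have he := Real.exp_pos 1
  have := Real.log_le_sub_one_of_pos (show 0 < M ^ 2 / Real.exp 1 by positivity)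
  rw [Real.log_div (by positivity) he.ne', log_sq_norm, Real.log_exp] at this
  have h2 : M ^ 2 / (2 * Real.exp 1) = M ^ 2 / Real.exp 1 / 2 := by ring
  rw [h2]; linarith

lemma E_ge (D B : ℝ) {δ : ℝ} (hδ : 0 < δ) :
    ∀ᶠ p : ℝ in atTop, ∀ (U w : E2 → ℝ) (x1 : E2) (c R : ℝ),
    PD D p U w x1 c R → p * ∫ x, U x ^ (p + 1) ≤ B →
    8 * π * Real.exp 1 - δ ≤ p * ∫ x, U x ^ (p + 1) := by
  obtain ⟨K, hK, hev⟩ := K_bd D B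
  set e := Real.exp 1 with hed
  have he : 0 < e := Real.exp_pos 1
  set S := 32 * π * e + 4 * e * (|B| + 1) with hS
  have hS0 : 0 < S := by have := Real.pi_pos; positivity
  filter_upwards [hev, raw D B (show 0 < δ / S by positivity)] with p hp hr U w x1 c R h hB
  obtain ⟨hM, -, -, -⟩ := hp U w x1 c R h hB
  have hr := hr U w x1 c R h hB
  have hp0 := h.hp0
  have hA : 0 < p * ∫ x, U x ^ (p + 1) := mul_pos hp0 h.E0
  set A := p * ∫ x, U x ^ (p + 1) with hAd
  set M := U x1 with hMd
  set d := δ / S with hd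
  have hd0 : 0 < d := by positivity
  have hdS : d * S = δ := by rw [hd]; field_simp
  have h1 : max 0 (Real.log M) ≤ M ^ 2 / (2 * e) := max_le (by positivity) (log_le_sq h.M0)
  have hpi := Real.pi_pos
  have h2 : M ^ 2 - 2 * d * M ≤ A * (M ^ 2 / (2 * e) + d) / (4 * π) := by
    refine hr.trans ?_
    gcongr
  rw [le_div_iff₀ (by positivity)] at h2
  have h3 : A * (M ^ 2 / (2 * e) + d) = A * M ^ 2 / (2 * e) + A * d := by ring
  have h4 : A * M ^ 2 / (2 * e) ≥ 4 * π * M ^ 2 - 8 * π * d * M - |B| * d := by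
    have : A * d ≤ |B| * d := mul_le_mul_of_nonneg_right (hB.trans (le_abs_self B)) hd0.le
    linarith
  rw [ge_iff_le, le_div_iff₀ (by positivity)] at h4
  have h5 : (8 * π * e - A) * M ^ 2 ≤ d * (16 * π * e * M + 2 * e * |B|) := by linarith
  have h6 : 16 * π * e * M + 2 * e * |B| ≤ S * M ^ 2 := by
    have a1 : M ≤ 2 * M ^ 2 := by nlinarith
    have a2 : 1 ≤ 2 * M ^ 2 := by nlinarith
    have a3 : 16 * π * e * M ≤ 16 * π * e * (2 * M ^ 2) := mul_le_mul_of_nonneg_left a1 (by positivity)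
    have a4 : 2 * e * |B| * 1 ≤ 2 * e * |B| * (2 * M ^ 2) := mul_le_mul_of_nonneg_left a2 (by positivity)
    have a5 : 0 ≤ 4 * e * M ^ 2 := by positivity
    rw [hS]
    nlinarith
  have h7 : (8 * π * e - A) * M ^ 2 ≤ δ * M ^ 2 := by
    rw [← hdS]; nlinarith
  have h8 := le_of_mul_le_mul_right h7 (show 0 < M ^ 2 by have := h.M0; positivity)
  linarith

lemma M_lim (D B : ℝ) {δ : ℝ} (hδ : 0 < δ) :
    ∃ κ > 0, ∀ᶠ p : ℝ in atTop, ∀ (U w : E2 → ℝ) (x1 : E2) (c R : ℝ),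
    PD D p U w x1 c R → p * ∫ x, U x ^ (p + 1) ≤ B →
    p * ∫ x, U x ^ (p + 1) ≤ 8 * π * Real.exp 1 + κ → |U x1 - √(Real.exp 1)| ≤ δ := by
  obtain ⟨K, hK, hev⟩ := K_bd D B
  set e := Real.exp 1 with hed
  have he : 0 < e := Real.exp_pos 1
  have he2 : e < 3 := by linarith [Real.exp_one_lt_d9]
  have he1 : 2 < e := by linarith [Real.exp_one_gt_d9]
  have hpi := Real.pi_gt_three
  -- `d` is the smallness parameter
  set d := min (δ ^ 2) (1 / 2) / (40 * K) with hd
  have hmin : 0 < min (δ ^ 2) (1 / 2) := lt_min (by positivity) (by norm_num)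
  have hd0 : 0 < d := by positivity
  have hd1 : d * (40 * K) = min (δ ^ 2) (1 / 2) := by rw [hd]; field_simp
  refine ⟨d, hd0, ?_⟩
  filter_upwards [hev, raw D B hd0] with p hp hr U w x1 c R h hB hκ
  obtain ⟨hM, hMK, -, -⟩ := hp U w x1 c R h hB
  have hr := hr U w x1 c R h hB
  have hp0 := h.hp0
  have hA : 0 < p * ∫ x, U x ^ (p + 1) := mul_pos hp0 h.E0
  set A := p * ∫ x, U x ^ (p + 1) with hAd
  set M := U x1 with hMd
  have hM0 := h.M0
  have hlog : Real.log M ≤ K := (Real.log_le_sub_one_of_pos hM0).trans (by linarith)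
  set L := max 0 (Real.log M) with hL
  have hL0 : 0 ≤ L := le_max_left _ _
  have hLK : L ≤ K := max_le (by linarith) hlog
  have hdm : d ≤ 1 := by
    have : min (δ ^ 2) (1 / 2) ≤ 1 / 2 := min_le_right _ _
    nlinarith
  have h1 : M ^ 2 - 2 * d * M ≤ (8 * π * e + d) * (L + d) / (4 * π) := by
    refine hr.trans ?_
    gcongr
  have h2 : (8 * π * e + d) * (L + d) / (4 * π) ≤ 2 * e * L + d * (6 + 2 * K) := by
    rw [div_le_iff₀ (by positivity)]
    have a1 : d * (L + d) ≤ d * (2 * K) := mul_le_mul_of_nonneg_left (by linarith) hd0.le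
    have a2 : 8 * π * e * d ≤ 8 * π * 3 * d := by gcongr
    have a3 : d * (2 * K) * 1 ≤ d * (2 * K) * (4 * π) :=
      mul_le_mul_of_nonneg_left (by linarith) (by positivity)
    nlinarith
  have h3 : M ^ 2 ≤ 2 * e * L + min (δ ^ 2) (1 / 2) := by
    rw [← hd1]
    have a1 : 2 * d * M ≤ 2 * d * K := mul_le_mul_of_nonneg_left hMK (by positivity)
    nlinarith
  have hm1 : min (δ ^ 2) (1 / 2) ≤ δ ^ 2 := min_le_left _ _
  have hm2 : min (δ ^ 2) (1 / 2) ≤ 1 / 2 := min_le_right _ _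
  have hlogpos : 0 < Real.log M := by
    by_contra! hn
    have : L = 0 := max_eq_left hn
    rw [this] at h3
    nlinarith
  have hLe : L = Real.log M := max_eq_right hlogpos.le
  rw [hLe] at h3
  set q := √e with hq
  have hq0 : 0 < q := Real.sqrt_pos.2 he
  have hqq : q ^ 2 = e := Real.sq_sqrt he.le
  have hlq : Real.log q = 1 / 2 := by rw [hq, Real.log_sqrt he.le, hed, Real.log_exp]
  have h4 := Real.log_le_sub_one_of_pos (div_pos hM0 hq0)
  rw [Real.log_div hM0.ne' hq0.ne', hlq] at h4
  have h5 : Real.log M ≤ M / q - 1 / 2 := by linarith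
  have h6 : 2 * e * Real.log M ≤ 2 * q * M - q ^ 2 := by
    have : 2 * e * (M / q - 1 / 2) = 2 * q * M - q ^ 2 := by
      rw [← hqq]; field_simp
    rw [← this]
    exact mul_le_mul_of_nonneg_left h5 (by positivity)
  apply abs_le_of_sq_le_sq _ hδ.le
  nlinarith

lemma p_exp_tendsto {k : ℝ} (hk : 0 < k) : Tendsto (fun p : ℝ => p * Real.exp (-(k * p))) atTop (𝓝 0) := by
  have h := (Real.tendsto_pow_mul_exp_neg_atTop_nhds_zero 1).comp (tendsto_id.const_mul_atTop hk)
  have h2 := h.const_mul (k⁻¹)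
  rw [mul_zero] at h2
  refine h2.congr fun p => ?_
  simp only [Function.comp, id, pow_one]
  field_simp

namespace PD
variable {D p : ℝ} {U w : E2 → ℝ} {x1 : E2} {c R : ℝ}

lemma lev_fin (h : PD D p U w x1 c R) {l : ℝ} (hl : 0 ≤ l) : volume {x | l < w x} ≠ ⊤ := by
  refine ((measure_mono ?_).trans_lt (measure_ball_lt_top (x := (0:E2)) (r := D / 2))).ne
  intro x hx
  have hx : l < w x := hx
  have := h.ws x (by linarith)
  simpa using this

lemma vol_level (h : PD D p U w x1 c R) {b l : ℝ} (hb : 1 ≤ b) (hE : p * ∫ x, U x ^ (p + 1) ≤ b ^ 2)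
    (hl0 : 0 < l) (hl2 : l ≤ 2) (hl : b ≤ l * √p) :
    volume.real {x | l < w x} ≤ D ^ 2 * Real.exp (-(4 * π * l ^ 2 / b ^ 2 * p) + 16 * π * √p) := by
  have hD := h.hD0
  have hp := h.hp0
  have hE0 := h.E0
  rcases (measureReal_nonneg (μ := volume) (s := {x | l < w x})).eq_or_lt with h0 | h0
  · rw [← h0]; positivity
  have hmt := MT h.w2 h.hc h.hD0 (Real.sqrt_pos.2 hE0) h.ws
    (by rw [Real.sq_sqrt hE0.le]; exact h.dir) hl0.le h0
  set t := volume.real {x | l < w x} with ht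
  have hs : 0 < √p := Real.sqrt_pos.2 hp
  have hss : √p ^ 2 = p := Real.sq_sqrt hp.le
  have h1 : √(∫ x, U x ^ (p + 1)) ≤ b / √p := by
    rw [Real.sqrt_le_left (by positivity), div_pow, hss, le_div_iff₀ hp]
    linarith
  set S := √(Real.log (D ^ 2 / t) / (4 * π)) with hS
  have hS0 : 0 ≤ S := Real.sqrt_nonneg _
  have h2 : l ≤ b / √p * (S + 1) := hmt.trans (mul_le_mul_of_nonneg_right h1 (by positivity))
  have h3 : l * √p / b - 1 ≤ S := by
    rw [div_mul_eq_mul_div, le_div_iff₀ hs] at h2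
    have : l * √p / b ≤ S + 1 := by rw [div_le_iff₀ (by linarith)]; linarith
    linarith
  have h4 : 0 ≤ l * √p / b - 1 := by
    rw [sub_nonneg, le_div_iff₀ (by linarith)]; linarith
  have h5 : (l * √p / b - 1) ^ 2 ≤ Real.log (D ^ 2 / t) / (4 * π) := by
    by_contra! hn
    have : S < l * √p / b - 1 := by
      rw [hS, Real.sqrt_lt' (lt_of_le_of_ne h4 ?_)]
      · exact hn
      · intro h6
        rw [← h6] at hn h3
        have : Real.log (D ^ 2 / t) / (4 * π) ≤ 0 := by nlinarith
        have hv : t ≤ D ^ 2 := by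
          have : t ≤ volume.real (ball (0:E2) (D / 2)) := by
            apply measureReal_mono _ measure_ball_lt_top.ne
            intro x hx
            have hx : l < w x := hx
            have := h.ws x (by linarith)
            simpa using this
          rw [vol_ball 0 (by linarith)] at this
          nlinarith [Real.pi_lt_four, sq_nonneg D]
        have : 0 ≤ Real.log (D ^ 2 / t) / (4 * π) :=
          div_nonneg (Real.log_nonneg (by rw [le_div_iff₀ h0]; linarith)) (by positivity)
        norm_num at hn
        linarith
    linarith
  rw [le_div_iff₀ (by positivity)] at h5
  have h6 : Real.exp ((l * √p / b - 1) ^ 2 * (4 * π)) ≤ D ^ 2 / t := by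
    rw [← Real.le_log_iff_exp_le (by positivity)]; exact h5
  rw [le_div_iff₀ h0] at h6
  have h7 : t ≤ D ^ 2 * Real.exp (-((l * √p / b - 1) ^ 2 * (4 * π))) := by
    rw [Real.exp_neg, ← div_eq_mul_inv, le_div_iff₀ (Real.exp_pos _)]; linarith
  refine h7.trans ?_
  apply mul_le_mul_of_nonneg_left _ (by positivity)
  apply Real.exp_le_exp.2
  have h8 : (l * √p / b - 1) ^ 2 * (4 * π) =
      4 * π * l ^ 2 / b ^ 2 * p - 8 * π * (l / b) * √p + 4 * π := by
    rw [← hss]; field_simp; rw [Real.sqrt_sq hs.le]; ring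
  rw [h8]
  have h9 : l / b ≤ 2 := by rw [div_le_iff₀ (by linarith)]; linarith
  have h10 : 8 * π * (l / b) * √p ≤ 8 * π * 2 * √p := by gcongr
  have := Real.pi_pos
  linarith

end PD

lemma level_exponent {l η τ κ : ℝ} (hη : 0 < η) (hl : 1 / 4 ≤ l) (hlq : l ≤ √(Real.exp 1) - η)
    (hτ : 0 < τ) (hτ2 : 8 * τ ≤ η ^ 2 / 25) (hκ : 0 ≤ κ) (hκ2 : κ ≤ η ^ 2 / 25) :
    Real.log (l + 2 * τ) - 4 * π * l ^ 2 / (8 * π * Real.exp 1 + κ) ≤ -(η ^ 2 / 15) := by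
  set e := Real.exp 1 with hed
  have he : 0 < e := Real.exp_pos 1
  have he2 : e < 3 := by linarith [Real.exp_one_lt_d9]
  have he1 : 2 < e := by linarith [Real.exp_one_gt_d9]
  have hpi := Real.pi_gt_three
  have hl0 : 0 < l := by linarith
  set q := √e with hq
  have hq0 : 0 < q := Real.sqrt_pos.2 he
  have hqq : q ^ 2 = e := Real.sq_sqrt he.le
  have hq2 : q < 2 := by nlinarith
  have hlq2 : Real.log q = 1 / 2 := by rw [hq, Real.log_sqrt he.le, hed, Real.log_exp]
  have h4 := Real.log_le_sub_one_of_pos (div_pos hl0 hq0)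
  rw [Real.log_div hl0.ne' hq0.ne', hlq2] at h4
  have h5 : Real.log (l + 2 * τ) ≤ Real.log l + 8 * τ := by
    have h6 := Real.log_le_sub_one_of_pos (show 0 < (l + 2 * τ) / l by positivity)
    rw [Real.log_div (by positivity) hl0.ne'] at h6
    have h7 : (l + 2 * τ) / l - 1 ≤ 8 * τ := by
      rw [sub_le_iff_le_add, div_le_iff₀ hl0]; nlinarith
    linarith
  have h8 : l ^ 2 / (2 * e) - κ ≤ 4 * π * l ^ 2 / (8 * π * e + κ) := by
    rw [le_div_iff₀ (by positivity)]
    have : (l ^ 2 / (2 * e) - κ) * (8 * π * e + κ)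
        = 4 * π * l ^ 2 + κ * (l ^ 2 / (2 * e) - 8 * π * e) - κ ^ 2 := by
      field_simp; ring
    rw [this]
    have h9 : l ^ 2 / (2 * e) ≤ 1 := by
      rw [div_le_one (by positivity)]; nlinarith
    have h10 : 1 ≤ 8 * π * e := by nlinarith
    nlinarith [sq_nonneg κ]
  have h11 : l / q - 1 / 2 - l ^ 2 / (2 * e) = -(1 / 2) * (1 - l / q) ^ 2 := by
    rw [← hqq]; field_simp; ring
  have h12 : η / 2 * (η / 2) * (4 / 3) ≤ (1 - l / q) ^ 2 := by
    have : 1 - l / q = (q - l) / q := by field_simp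
    rw [this, div_pow, hqq, le_div_iff₀ he]
    have : η ^ 2 ≤ (q - l) ^ 2 := pow_le_pow_left₀ hη.le (by linarith) 2
    nlinarith [sq_nonneg η]
  nlinarith

/-- The mass away from the top level is negligible. -/
lemma tail (D : ℝ) {η : ℝ} (hη : 0 < η) :
    ∃ κ > 0, ∀ᶠ p : ℝ in atTop, ∀ (U w : E2 → ℝ) (x1 : E2) (c R : ℝ),
    PD D p U w x1 c R → p * ∫ x, U x ^ (p + 1) ≤ 8 * π * Real.exp 1 + κ →
    p * ∫ y in {y | U y ≤ √(Real.exp 1) - η}, U y ^ p ≤ η := by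
  set e := Real.exp 1 with hed
  have he : 0 < e := Real.exp_pos 1
  have he2 : e < 3 := by linarith [Real.exp_one_lt_d9]
  have he1 : 2 < e := by linarith [Real.exp_one_gt_d9]
  have hpi := Real.pi_gt_three
  set q := √e with hq
  have hq0 : 0 < q := Real.sqrt_pos.2 he
  have hqq : q ^ 2 = e := Real.sq_sqrt he.le
  have hq2 : q < 2 := by nlinarith
  set τ := min (η ^ 2 / 200) (1 / 4) with hτd
  have hτ : 0 < τ := lt_min (by positivity) (by norm_num)
  have hτ1 : 8 * τ ≤ η ^ 2 / 25 := by have := min_le_left (η ^ 2 / 200) (1 / 4 : ℝ); linarith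
  have hτ4 : τ ≤ 1 / 4 := min_le_right _ _
  obtain ⟨N, hN⟩ := exists_nat_gt (2 / τ)
  set κ := η ^ 2 / 25 with hκd
  have hκ : 0 < κ := by positivity
  refine ⟨κ, hκ, ?_⟩
  set b := √(8 * π * e + κ) with hbd
  have hbb : b ^ 2 = 8 * π * e + κ := Real.sq_sqrt (by positivity)
  have hb : 1 ≤ b := by rw [hbd, Real.one_le_sqrt]; nlinarith
  set a := η ^ 2 / 15 with had
  have ha : 0 < a := by positivity
  set G := Real.exp ((16 * π) ^ 2 / (2 * a)) with hG
  have t1 := ((p_exp_tendsto (Real.log_pos one_lt_two)).const_mul (D ^ 2)).add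
    ((p_exp_tendsto (half_pos ha)).const_mul (N * (D ^ 2 * G)))
  have t2 := t1.eventually_lt_const (show D ^ 2 * 0 + N * (D ^ 2 * G) * 0 < η by simpa using hη)
  have t3 := (tendsto_sqrt_atTop).eventually_ge_atTop (4 * b)
  filter_upwards [t2, t3, eventually_gt_atTop (1 / τ)] with p t2 t3 hpτ U w x1 c R h hE
  have hp := h.hp0
  have hD := h.hD0
  have h1p : 1 / p < τ := by
    rw [div_lt_iff₀ hp]; rw [div_lt_iff₀ hτ] at hpτ; linarith
  have hs : √p ^ 2 = p := Real.sq_sqrt hp.le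
  -- levels
  set l : ℕ → ℝ := fun i => 1 / 2 + i * τ - τ with hl
  set I := (Finset.range N).filter (fun i => l i ≤ q - η) with hI
  have hmeas : ∀ i, MeasurableSet {x | l i < w x} := fun i =>
    measurableSet_lt measurable_const h.w2.continuous.measurable
  have hl4 : ∀ i, 1 / 4 ≤ l i := fun i => by
    have : 0 ≤ (i:ℝ) * τ := by positivity
    simp only [hl]; linarith
  have hfin : ∀ i, volume {x | l i < w x} ≠ ⊤ := fun i => h.lev_fin (by linarith [hl4 i])
  have hterm : ∀ i ∈ I, (l i + 2 * τ) ^ p * volume.real {x | l i < w x}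
      ≤ D ^ 2 * G * Real.exp (-(a / 2 * p)) := by
    intro i hi
    have hlq : l i ≤ q - η := (Finset.mem_filter.1 hi).2
    have h4 := hl4 i
    have hlp : 0 < l i + 2 * τ := by linarith
    have hv := h.vol_level (l := l i) hb (by rw [hbb]; exact hE) (by linarith) (by linarith)
      (by nlinarith)
    have hex := level_exponent hη h4 hlq hτ hτ1 hκ.le le_rfl
    rw [← had, ← hed] at hex
    have hle : (l i + 2 * τ) ^ p = Real.exp (Real.log (l i + 2 * τ) * p) :=
      Real.rpow_def_of_pos hlp p
    calc (l i + 2 * τ) ^ p * volume.real {x | l i < w x}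
        ≤ Real.exp (Real.log (l i + 2 * τ) * p) *
          (D ^ 2 * Real.exp (-(4 * π * l i ^ 2 / b ^ 2 * p) + 16 * π * √p)) := by
          rw [hle]; exact mul_le_mul_of_nonneg_left hv (Real.exp_pos _).le
      _ = D ^ 2 * Real.exp (Real.log (l i + 2 * τ) * p + (-(4 * π * l i ^ 2 / b ^ 2 * p) + 16 * π * √p)) := by
          rw [Real.exp_add (Real.log (l i + 2 * τ) * p)]; ring
      _ ≤ D ^ 2 * Real.exp ((16 * π) ^ 2 / (2 * a) + -(a / 2 * p)) := by
          apply mul_le_mul_of_nonneg_left _ (by positivity)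
          apply Real.exp_le_exp.2
          rw [hbb]
          have e1 := mul_le_mul_of_nonneg_right hex hp.le
          have e2 : 16 * π * √p ≤ (16 * π) ^ 2 / (2 * a) + a / 2 * p := by
            have e3 : 0 ≤ (16 * π - a * √p) ^ 2 / (2 * a) := by positivity
            have e4 : (16 * π - a * √p) ^ 2 / (2 * a)
                = (16 * π) ^ 2 / (2 * a) + a / 2 * p - 16 * π * √p := by
              rw [sub_sq, mul_pow a, hs]; field_simp; ring
            linarith
          linarith
      _ = _ := by rw [Real.exp_add, hG]; ring
  have hpt : ∀ y, ({y | U y ≤ q - η}.indicator (fun y => U y ^ p)) y ≤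
      (ball (0:E2) (D / 2)).indicator (fun _ => (1/2:ℝ) ^ p) y +
      ∑ i ∈ I, {x | l i < w x}.indicator (fun _ => (l i + 2 * τ) ^ p) y := by
    intro y
    have n1 : 0 ≤ (ball (0:E2) (D / 2)).indicator (fun _ => (1/2:ℝ) ^ p) y :=
      Set.indicator_nonneg (fun _ _ => by positivity) _
    have n2' : ∀ i ∈ I, 0 ≤ {x | l i < w x}.indicator (fun _ => (l i + 2 * τ) ^ p) y :=
      fun i _ => Set.indicator_nonneg (fun _ _ => Real.rpow_nonneg (by linarith [hl4 i]) _) _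
    have n2 := Finset.sum_nonneg n2'
    by_cases hy : U y ≤ q - η
    swap
    · rw [Set.indicator_of_notMem (by simpa using hy)]; linarith
    rw [Set.indicator_of_mem (by simpa using hy)]
    rcases le_total (U y) (1 / 2) with hU | hU
    · by_cases h0 : U y = 0
      · rw [h0, Real.zero_rpow hp.ne']; linarith
      · rw [Set.indicator_of_mem (show y ∈ ball (0:E2) (D / 2) by simpa using h.Us y h0)]
        have := Real.rpow_le_rpow (h.U0 y) hU hp.le
        linarith
    · set i := ⌊(U y - 1 / 2) / τ⌋₊ with hi
      have hi0 : 0 ≤ (U y - 1 / 2) / τ := div_nonneg (by linarith) hτ.le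
      have hi1 : i * τ ≤ U y - 1 / 2 := by
        rw [← le_div_iff₀ hτ]; exact Nat.floor_le hi0
      have hi2 : U y - 1 / 2 < (i + 1) * τ := by
        rw [← div_lt_iff₀ hτ]; exact Nat.lt_floor_add_one _
      have hiN : i < N := by
        have : (i:ℝ) < N := by
          refine lt_trans ?_ hN
          rw [lt_div_iff₀ hτ]; linarith
        exact_mod_cast this
      have hiI : i ∈ I := by
        rw [hI, Finset.mem_filter, Finset.mem_range]
        refine ⟨hiN, ?_⟩
        simp only [hl]; linarith
      have hwi : l i < w y := by
        have := h.Uw y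
        have := h.cp
        simp only [hl]; linarith
      have s1 := Finset.single_le_sum n2' hiI
      rw [Set.indicator_of_mem (show y ∈ {x | l i < w x} from hwi)] at s1
      have s2 : U y ^ p ≤ (l i + 2 * τ) ^ p := by
        apply Real.rpow_le_rpow (h.U0 y) _ hp.le
        simp only [hl]; linarith
      linarith
  have hUm : MeasurableSet {y | U y ≤ q - η} := measurableSet_le h.Uc.measurable measurable_const
  have i1 : Integrable ((ball (0:E2) (D / 2)).indicator fun _ => (1/2:ℝ) ^ p) := by
    rw [integrable_indicator_iff measurableSet_ball]
    exact integrableOn_const measure_ball_lt_top.ne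
  have i2' : ∀ i ∈ I, Integrable ({x | l i < w x}.indicator fun _ => (l i + 2 * τ) ^ p) := by
    intro i _
    rw [integrable_indicator_iff (hmeas i)]
    exact integrableOn_const (hfin i)
  have i2 : Integrable (fun y => ∑ i ∈ I, {x | l i < w x}.indicator (fun _ => (l i + 2 * τ) ^ p) y) :=
    integrable_finsetSum _ i2'
  have hint := integral_mono (h.FBB.indicator hUm).integrable (i1.add i2) hpt
  simp only [Pi.add_apply] at hint
  rw [integral_indicator hUm, integral_add i1 i2, integral_indicator measurableSet_ball,
    setIntegral_const, vol_ball 0 (by linarith), smul_eq_mul, integral_finsetSum _ i2'] at hint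
  have hsum : ∑ i ∈ I, ∫ y, {x | l i < w x}.indicator (fun _ => (l i + 2 * τ) ^ p) y
      ≤ N * (D ^ 2 * G * Real.exp (-(a / 2 * p))) := by
    calc _ ≤ ∑ i ∈ I, D ^ 2 * G * Real.exp (-(a / 2 * p)) := by
          apply Finset.sum_le_sum
          intro i hi
          rw [integral_indicator (hmeas i), setIntegral_const, smul_eq_mul, mul_comm]
          exact hterm i hi
      _ = I.card * (D ^ 2 * G * Real.exp (-(a / 2 * p))) := by
          rw [Finset.sum_const, nsmul_eq_mul]
      _ ≤ _ := by
          apply mul_le_mul_of_nonneg_right _ (by positivity)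
          exact_mod_cast (Finset.card_filter_le _ _).trans (Finset.card_range N).le
  have hhalf : (1/2:ℝ) ^ p = Real.exp (-(Real.log 2 * p)) := by
    rw [Real.rpow_def_of_pos (by norm_num), one_div, Real.log_inv, neg_mul]
  have hv : π * (D / 2) ^ 2 * (1/2:ℝ) ^ p ≤ D ^ 2 * Real.exp (-(Real.log 2 * p)) := by
    rw [hhalf]
    apply mul_le_mul_of_nonneg_right _ (Real.exp_pos _).le
    nlinarith [Real.pi_lt_four, sq_nonneg D]
  have hfinal : ∫ y in {y | U y ≤ q - η}, U y ^ p ≤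
      D ^ 2 * Real.exp (-(Real.log 2 * p)) + N * (D ^ 2 * G * Real.exp (-(a / 2 * p))) :=
    hint.trans (add_le_add hv hsum)
  have := mul_le_mul_of_nonneg_left hfinal hp.le
  refine this.trans (le_trans (le_of_eq ?_) t2.le)
  ring

namespace PD
variable {D p : ℝ} {U w : E2 → ℝ} {x1 : E2} {c R : ℝ}

lemma FMU_eq (h : PD D p U w x1 c R) :
    ∫ y, U y ^ p * (U x1 - U y) = U x1 * (∫ y, U y ^ p) - ∫ y, U y ^ (p + 1) := by
  have : (fun y => U y ^ p * (U x1 - U y)) = fun y => U x1 * U y ^ p - U y ^ (p + 1) := by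
    ext y; rw [h.pow_succ]; ring
  rw [this, integral_sub (h.FBB.integrable.const_mul _) h.EBB.integrable, integral_const_mul]

lemma FMU_nonneg (h : PD D p U w x1 c R) (y : E2) : 0 ≤ U y ^ p * (U x1 - U y) :=
  mul_nonneg (h.pow0 p y) (by linarith [h.UM y])

lemma FMU_BB (h : PD D p U w x1 c R) : BB (fun y => U y ^ p * (U x1 - U y)) := by
  have := h.FBB.mul (h := fun y => U x1 - U y) (h.Uc.measurable.const_sub _) (B := U x1)
    (fun y => by rw [abs_of_nonneg (by linarith [h.UM y])]; linarith [h.U0 y])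
  simpa only [mul_comm] using this

end PD

lemma q_bounds : 8 / 5 < √(Real.exp 1) ∧ √(Real.exp 1) < 5 / 3 := by
  have he2 : Real.exp 1 < 2.7182818286 := Real.exp_one_lt_d9
  have he1 : 2.7182818283 < Real.exp 1 := Real.exp_one_gt_d9
  constructor
  · rw [Real.lt_sqrt (by norm_num)]; norm_num at *; linarith
  · rw [Real.sqrt_lt' (by norm_num)]; norm_num at *; linarith

set_option maxHeartbeats 1000000 in
/-- All first order limits. -/
lemma limits (D : ℝ) {δ : ℝ} (hδ : 0 < δ) :
    ∃ κ > 0, κ ≤ 1 ∧ ∀ᶠ p : ℝ in atTop, ∀ (U w : E2 → ℝ) (x1 : E2) (c R : ℝ),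
    PD D p U w x1 c R → p * ∫ x, U x ^ (p + 1) ≤ 8 * π * Real.exp 1 + κ →
    |U x1 - √(Real.exp 1)| ≤ δ ∧ |p * (∫ x, U x ^ p) - 8 * π * √(Real.exp 1)| ≤ δ ∧
    p * (∫ x, U x ^ p * (U x1 - U x)) ≤ δ := by
  obtain ⟨hq1, hq2⟩ := q_bounds
  set e := Real.exp 1 with hed
  have he : 0 < e := Real.exp_pos 1
  have hpi := Real.pi_gt_three
  have hpi2 := Real.pi_lt_d2
  set q := √e with hq
  have hqq : q ^ 2 = e := Real.sq_sqrt he.le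
  set d := min δ 1 / 1000 with hd
  have hd0 : 0 < d := by have : 0 < min δ 1 := lt_min hδ one_pos
                         positivity
  have hdδ : 1000 * d ≤ δ := by have := min_le_left δ 1; rw [hd]; linarith
  have hd1 : d ≤ 1 / 1000 := by have := min_le_right δ 1; rw [hd]; linarith
  obtain ⟨κ1, hκ1, ev1⟩ := M_lim D (8 * π * e + 1) hd0
  obtain ⟨κ2, hκ2, ev2⟩ := tail D hd0
  have ev3 := E_ge D (8 * π * e + 1) hd0
  refine ⟨min (min κ1 κ2) d, lt_min (lt_min hκ1 hκ2) hd0,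
    (min_le_right _ _).trans (by linarith), ?_⟩
  filter_upwards [ev1, ev2, ev3] with p ev1 ev2 ev3 U w x1 c R h hE
  have k1 : min (min κ1 κ2) d ≤ κ1 := (min_le_left _ _).trans (min_le_left _ _)
  have k2 : min (min κ1 κ2) d ≤ κ2 := (min_le_left _ _).trans (min_le_right _ _)
  have k3 : min (min κ1 κ2) d ≤ d := min_le_right _ _
  have hM := ev1 U w x1 c R h (by linarith) (by linarith)
  have hT := ev2 U w x1 c R h (by linarith)
  have hEl := ev3 U w x1 c R h (by linarith)
  have hp := h.hp0
  rw [abs_le] at hM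
  obtain ⟨hM1, hM2⟩ := hM
  have hEu : p * ∫ x, U x ^ (p + 1) ≤ 8 * π * e + d := by linarith
  set A := p * ∫ x, U x ^ (p + 1) with hA
  set M := U x1
  have hfm := h.FMU_eq
  have hfn : 0 ≤ ∫ y, U y ^ p * (U x1 - U y) := integral_nonneg h.FMU_nonneg
  -- lower bound
  have hlow : A ≤ M * (p * ∫ x, U x ^ p) := by
    rw [hfm] at hfn
    have := mul_nonneg hp.le hfn
    rw [hA]; nlinarith
  have hup : (q - d) * (p * (∫ x, U x ^ p) - p * ∫ y in {y | U y ≤ q - d}, U y ^ p) ≤ A := by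
    have hUm : MeasurableSet {y | U y ≤ q - d} := measurableSet_le h.Uc.measurable measurable_const
    have h1 : (∫ x, U x ^ p) - ∫ y in {y | U y ≤ q - d}, U y ^ p
        = ∫ y, (U y ^ p - {y | U y ≤ q - d}.indicator (fun y => U y ^ p) y) := by
      rw [integral_sub h.FBB.integrable (h.FBB.indicator hUm).integrable, integral_indicator hUm]
    have h2 : ∫ y, (q - d) * (U y ^ p - {y | U y ≤ q - d}.indicator (fun y => U y ^ p) y)
        ≤ ∫ x, U x ^ (p + 1) := by
      apply integral_mono ((h.FBB.sub (h.FBB.indicator hUm)).integrable.const_mul _) h.EBB.integrable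
      intro y
      simp only
      rw [h.pow_succ]
      have hF := h.pow0 p y
      by_cases hy : U y ≤ q - d
      · rw [Set.indicator_of_mem (show y ∈ {y | U y ≤ q - d} from hy), sub_self, mul_zero]
        exact mul_nonneg (h.U0 y) hF
      · rw [Set.indicator_of_notMem (by simpa using hy), sub_zero]
        push Not at hy
        exact mul_le_mul_of_nonneg_right hy.le hF
    rw [integral_const_mul, ← h1] at h2
    have := mul_le_mul_of_nonneg_left h2 hp.le
    rw [hA]; linarith
  set m := p * ∫ x, U x ^ p with hm
  have hm0 : 0 ≤ m := mul_nonneg hp.le h.m0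
  have m1 : m ≤ 8 * π * q + 101 * d := by
    by_contra! hn
    have a1 : (q - d) * (8 * π * q + 100 * d) ≤ 8 * π * e + d := by
      refine le_trans ?_ (hup.trans hEu)
      apply mul_le_mul_of_nonneg_left _ (by linarith)
      linarith
    rw [← hqq] at a1
    have a2 : π * q < 3.15 * (5 / 3) := by nlinarith
    nlinarith
  have m2 : 8 * π * q - 100 * d ≤ m := by
    by_contra! hn
    have a1 : 8 * π * e - d ≤ (q + d) * (8 * π * q - 100 * d) := by
      refine hEl.trans (hlow.trans ?_)
      calc M * m ≤ (q + d) * m := mul_le_mul_of_nonneg_right (by linarith) hm0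
        _ ≤ _ := mul_le_mul_of_nonneg_left hn.le (by linarith)
    rw [← hqq] at a1
    have a2 : π * q < 3.15 * (5 / 3) := by nlinarith
    nlinarith
  refine ⟨abs_le.2 ⟨by linarith, by linarith⟩, abs_le.2 ⟨by linarith, by linarith⟩, ?_⟩
  rw [hfm]
  have : p * (M * (∫ x, U x ^ p) - ∫ x, U x ^ (p + 1)) = M * m - A := by rw [hA, hm]; ring
  rw [this]
  have b1 : M * m ≤ (q + d) * (8 * π * q + 101 * d) :=
    mul_le_mul (by linarith) m1 hm0 (by linarith)
  rw [← hed, ← hqq] at hEl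
  have a2 : π * q < 3.15 * (5 / 3) := by nlinarith
  nlinarith

/-- Divergence of a vector field. -/
def dv (X : E2 → E2) (x : E2) : ℝ := ∑ j : Fin 2, fderiv ℝ (fun y => X y j) x (eb j)

/-- Localized dilation fields around `x1` at scale `r`. -/
structure Xf (x1 : E2) (r Λ L L2 : ℝ) (X : E2 → E2) : Prop where
  smooth : ContDiff ℝ 1 X
  one : ∀ x, ‖x - x1‖ < r → X x = x - x1
  zero : ∀ x, Λ * r ≤ ‖x - x1‖ → X x = 0
  bd : ∀ x, ‖X x‖ ≤ ‖x - x1‖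
  lip : ∀ x y, ‖X x - X y‖ ≤ L * ‖x - y‖
  div : ∀ x, |dv X x| ≤ L2
  div1 : ∀ x, ‖x - x1‖ < r → dv X x = 2
  div0 : ∀ x, Λ * r ≤ ‖x - x1‖ → dv X x = 0

lemma dv_congr {X Y : E2 → E2} {x : E2} (h : X =ᶠ[𝓝 x] Y) : dv X x = dv Y x := by
  unfold dv
  refine Finset.sum_congr rfl fun j _ => ?_
  have : (fun y => X y j) =ᶠ[𝓝 x] fun y => Y y j := h.fun_comp (fun v : E2 => v j)
  rw [this.fderiv_eq]

lemma comp_fderiv {X : E2 → E2} (hX : ContDiff ℝ 1 X) (x v : E2) (j : Fin 2) :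
    fderiv ℝ (fun y => X y j) x v = (fderiv ℝ X x v) j := by
  have h1 := (hX.differentiable one_ne_zero x).hasFDerivAt
  have h2 := (EuclideanSpace.proj (𝕜 := ℝ) j : E2 →L[ℝ] ℝ).hasFDerivAt.comp x h1
  have h3 : fderiv ℝ (fun y => X y j) x = _ := h2.fderiv
  rw [h3]; rfl

lemma exists_X {Λ : ℝ} (hΛ : 1 < Λ) : ∃ L L2 : ℝ, 0 ≤ L ∧ 0 ≤ L2 ∧ ∀ (x1 : E2) (r : ℝ), 0 < r →
    ∃ X, Xf x1 r Λ L L2 X := by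
  let a0 : ContDiffBump (0:E2) := ⟨1, (1 + Λ) / 2, one_pos, by linarith⟩
  set V : E2 → E2 := fun z => a0 z • z with hV
  have hVs : ContDiff ℝ 1 V := a0.contDiff.smul contDiff_id
  have hVc : HasCompactSupport V := a0.hasCompactSupport.smul_right
  obtain ⟨L, hL⟩ := hVs.lipschitzWith_of_hasCompactSupport hVc one_ne_zero
  have hfd : Continuous (fderiv ℝ V) := hVs.continuous_fderiv one_ne_zero
  obtain ⟨C, hC⟩ := (hVc.fderiv ℝ).exists_bound_of_continuous hfd
  refine ⟨L, 2 * C, L.2, ?_, fun x1 r hr => ?_⟩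
  · linarith [(norm_nonneg _).trans (hC 0)]
  set X : E2 → E2 := fun x => r • V (r⁻¹ • (x - x1)) with hX
  have hXs : ContDiff ℝ 1 X := by
    apply ContDiff.const_smul
    apply hVs.comp
    fun_prop
  have hns : ∀ x : E2, ‖r⁻¹ • (x - x1)‖ = ‖x - x1‖ / r := fun x => by
    rw [norm_smul, norm_inv, Real.norm_eq_abs, abs_of_pos hr]; field_simp
  have hone : ∀ x, ‖x - x1‖ < r → X x = x - x1 := by
    intro x hx
    have : a0 (r⁻¹ • (x - x1)) = 1 := by
      apply a0.one_of_mem_closedBall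
      rw [mem_closedBall_zero_iff, hns]
      show _ ≤ (1:ℝ)
      rw [div_le_one hr]; exact hx.le
    simp only [hX, hV, this, one_smul]
    rw [smul_smul, mul_inv_cancel₀ hr.ne', one_smul]
  have hzero : ∀ x, (1 + Λ) / 2 * r ≤ ‖x - x1‖ → X x = 0 := by
    intro x hx
    have : a0 (r⁻¹ • (x - x1)) = 0 := by
      apply a0.zero_of_le_dist
      rw [dist_zero_right, hns]
      show (1 + Λ) / 2 ≤ _
      rw [le_div_iff₀ hr]; exact hx
    simp only [hX, hV, this, zero_smul, smul_zero]
  have hc : Continuous (fun x : E2 => ‖x - x1‖) := by fun_prop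
  refine ⟨X, hXs, hone, fun x hx => hzero x ?_, ?_, ?_, ?_, ?_, ?_⟩
  · nlinarith
  · intro x
    simp only [hX, hV]
    rw [norm_smul, norm_smul, hns, Real.norm_eq_abs, Real.norm_eq_abs, abs_of_pos hr,
      abs_of_nonneg a0.nonneg]
    have h1 : a0 (r⁻¹ • (x - x1)) ≤ 1 := a0.le_one
    have h2 : r * (a0 (r⁻¹ • (x - x1)) * (‖x - x1‖ / r)) = a0 (r⁻¹ • (x - x1)) * ‖x - x1‖ := by
      field_simp
    rw [h2]
    nlinarith [norm_nonneg (x - x1)]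
  · intro x y
    simp only [hX]
    rw [← smul_sub, norm_smul, Real.norm_eq_abs, abs_of_pos hr]
    have := hL.dist_le_mul (r⁻¹ • (x - x1)) (r⁻¹ • (y - x1))
    rw [dist_eq_norm, dist_eq_norm, ← smul_sub, sub_sub_sub_cancel_right, norm_smul, norm_inv,
      Real.norm_eq_abs, abs_of_pos hr] at this
    calc _ ≤ r * (L * (r⁻¹ * ‖x - y‖)) := mul_le_mul_of_nonneg_left this hr.le
      _ = _ := by field_simp
  · intro x
    have hder : ∀ v, fderiv ℝ X x v = fderiv ℝ V (r⁻¹ • (x - x1)) v := by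
      intro v
      have h1 : HasFDerivAt (fun x : E2 => r⁻¹ • (x - x1)) (r⁻¹ • ContinuousLinearMap.id ℝ E2) x :=
        ((hasFDerivAt_id x).sub_const x1).const_smul r⁻¹
      have h2 := ((hVs.differentiable one_ne_zero (r⁻¹ • (x - x1))).hasFDerivAt.comp x h1).const_smul r
      have h3 : fderiv ℝ X x = _ := h2.fderiv
      rw [h3]
      simp [smul_smul, mul_inv_cancel₀ hr.ne']
    have hj : ∀ j, |fderiv ℝ (fun y => X y j) x (eb j)| ≤ C := by
      intro j
      rw [comp_fderiv hXs, hder]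
      have h1 := PiLp.norm_apply_le (fderiv ℝ V (r⁻¹ • (x - x1)) (eb j)) j
      have h2 := (fderiv ℝ V (r⁻¹ • (x - x1))).le_opNorm (eb j)
      have h3 : ‖eb j‖ = 1 := by simp
      rw [h3, mul_one] at h2
      rw [Real.norm_eq_abs] at h1
      exact (h1.trans h2).trans (hC _)
    unfold dv
    refine (Finset.abs_sum_le_sum_abs _ _).trans ?_
    rw [Fin.sum_univ_two]
    linarith [hj 0, hj 1]
  · intro x hx
    have : X =ᶠ[𝓝 x] fun y => y - x1 := by
      filter_upwards [(isOpen_lt hc continuous_const).mem_nhds hx] with y hy using hone y hy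
    rw [dv_congr this]
    unfold dv
    have hs : ContDiff ℝ 1 (fun y : E2 => y - x1) := by fun_prop
    have : ∀ j : Fin 2, fderiv ℝ (fun y : E2 => (y - x1) j) x (eb j) = 1 := by
      intro j
      rw [comp_fderiv hs, fderiv_sub_const, fderiv_fun_id]
      simp
    rw [Fin.sum_univ_two, this, this]; norm_num
  · intro x hx
    have hx' : (1 + Λ) / 2 * r < ‖x - x1‖ := by nlinarith
    have : X =ᶠ[𝓝 x] fun _ => 0 := by
      filter_upwards [(isOpen_lt continuous_const hc).mem_nhds hx'] with y hy
      exact hzero y (le_of_lt hy)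
    rw [dv_congr this]
    simp [dv]

/-- Integrability on the product of singular kernels. -/
lemma prod_int {f g κ : E2 → ℝ} (hf : BB f) (hg : BB g) (hm : Measurable κ)
    (hκ : ∀ z, |κ z| ≤ ‖z‖⁻¹) :
    Integrable (fun q : E2 × E2 => f q.1 * (κ (q.1 - q.2) * g q.2)) (volume.prod volume) := by
  obtain ⟨A, hA0, hA⟩ := hf.bdd
  obtain ⟨s, hs, hfs⟩ := hf.supp
  obtain ⟨t, ht, hgs⟩ := hg.supp
  have h1 := Integrable.convolution_integrand (ContinuousLinearMap.mul ℝ ℝ) hg.abs.integrable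
    (K1_integrable (s + t)) (μ := volume) (ν := volume)
  refine (h1.const_mul A).mono' ?_ (Eventually.of_forall fun q => ?_)
  · apply Measurable.aestronglyMeasurable
    have := hf.meas
    have := hg.meas
    fun_prop
  · simp only [ContinuousLinearMap.mul_apply']
    have hK := K1_nonneg (s + t) (q.1 - q.2)
    by_cases hf0 : f q.1 = 0
    · rw [hf0]; simp only [zero_mul, norm_zero]; positivity
    by_cases hg0 : g q.2 = 0
    · rw [hg0]; simp
    have hlt : ‖q.1 - q.2‖ < s + t :=
      (norm_sub_le _ _).trans_lt (add_lt_add (hfs _ hf0) (hgs _ hg0))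
    rw [K1_of_lt hlt, norm_mul, norm_mul, Real.norm_eq_abs, Real.norm_eq_abs, Real.norm_eq_abs]
    have := mul_le_mul_of_nonneg_right (hκ (q.1 - q.2)) (abs_nonneg (g q.2))
    calc |f q.1| * (|κ (q.1 - q.2)| * |g q.2|) ≤ A * (‖q.1 - q.2‖⁻¹ * |g q.2|) :=
          mul_le_mul (hA _) this (by positivity) hA0
      _ = _ := by ring

lemma ae_ne_prod : ∀ᵐ q : E2 × E2 ∂(volume.prod volume), q.1 - q.2 ≠ 0 := by
  have hms : MeasurableSet {q : E2 × E2 | q.1 - q.2 = 0} :=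
    (isClosed_eq (by fun_prop) continuous_const).measurableSet
  have := (Measure.measure_prod_null (μ := (volume : Measure E2)) (ν := (volume : Measure E2)) hms).2
    (Eventually.of_forall fun x => by
      have : (Prod.mk x ⁻¹' {q : E2 × E2 | q.1 - q.2 = 0}) = {x} := by
        ext y; simp [sub_eq_zero, eq_comm]
      simp [this])
  rw [ae_iff]
  simpa using this

lemma coord_bd (j : Fin 2) (z : E2) : |z j / ‖z‖ ^ 2| ≤ ‖z‖⁻¹ := by
  rcases eq_or_ne z 0 with rfl | hz
  · simp
  have hz' := norm_pos_iff.2 hz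
  rw [abs_div, abs_of_nonneg (sq_nonneg ‖z‖)]
  have : |z j| ≤ ‖z‖ := by simpa using PiLp.norm_apply_le z j
  rw [div_le_iff₀ (by positivity)]
  calc |z j| ≤ ‖z‖ := this
    _ = _ := by field_simp

/-- The symmetrized kernel. -/
def Sk (X : E2 → E2) (x y : E2) : ℝ := ∑ j : Fin 2, (X x - X y) j * ((x - y) j / ‖x - y‖ ^ 2)

lemma dot_le (a b : E2) : |∑ j : Fin 2, a j * b j| ≤ ‖a‖ * ‖b‖ := by
  have := abs_real_inner_le_norm b a
  simp only [PiLp.inner_apply, RCLike.inner_apply, conj_trivial] at this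
  rw [mul_comm ‖a‖]; exact this

lemma dot_self (a : E2) : ∑ j : Fin 2, a j * a j = ‖a‖ ^ 2 := by
  rw [EuclideanSpace.real_norm_sq_eq]
  exact Finset.sum_congr rfl fun j _ => by ring

lemma Sk_eq (X : E2 → E2) (x y : E2) :
    Sk X x y = (∑ j : Fin 2, (X x - X y) j * (x - y) j) / ‖x - y‖ ^ 2 := by
  unfold Sk; rw [Finset.sum_div]; exact Finset.sum_congr rfl fun j _ => by ring

lemma Sk_le (X : E2 → E2) {x y : E2} (hxy : x - y ≠ 0) {b : ℝ} (hb : ‖X x - X y‖ ≤ b * ‖x - y‖) :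
    |Sk X x y| ≤ b := by
  have h0 := norm_pos_iff.2 hxy
  rw [Sk_eq, abs_div, abs_of_nonneg (sq_nonneg ‖x - y‖), div_le_iff₀ (by positivity)]
  refine (dot_le _ _).trans ?_
  nlinarith

lemma Sk_one (X : E2 → E2) {x y : E2} (hxy : x - y ≠ 0) (hb : X x - X y = x - y) :
    Sk X x y = 1 := by
  have h0 := norm_pos_iff.2 hxy
  rw [Sk_eq, hb, dot_self, div_self (by positivity)]

lemma Xf.cs {x1 : E2} {r Λ L L2 : ℝ} {X : E2 → E2} (hX : Xf x1 r Λ L L2 X) :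
    HasCompactSupport X :=
  HasCompactSupport.intro (isCompact_closedBall x1 (Λ * r)) fun x hx => by
    apply hX.zero
    rw [mem_closedBall, dist_eq_norm] at hx
    linarith

lemma Xf.comp_smooth {x1 : E2} {r Λ L L2 : ℝ} {X : E2 → E2} (hX : Xf x1 r Λ L L2 X) (j : Fin 2) :
    ContDiff ℝ 1 (fun x => X x j) :=
  (EuclideanSpace.proj (𝕜 := ℝ) j : E2 →L[ℝ] ℝ).contDiff.comp hX.smooth

lemma Xf.comp_cs {x1 : E2} {r Λ L L2 : ℝ} {X : E2 → E2} (hX : Xf x1 r Λ L L2 X) (j : Fin 2) :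
    HasCompactSupport (fun x => X x j) := by
  refine HasCompactSupport.intro (isCompact_closedBall x1 (Λ * r)) fun x hx => ?_
  rw [hX.zero x]
  · simp
  · rw [mem_closedBall, dist_eq_norm] at hx
    linarith

namespace PD
variable {D p : ℝ} {U w : E2 → ℝ} {x1 : E2} {c R : ℝ} {r Λ L L2 : ℝ} {X : E2 → E2}

/-- Step A: the divergence identity. -/
lemma poho_div (h : PD D p U w x1 c R) (hX : Xf x1 r Λ L L2 X) (hR : Λ * r ≤ R / 2) :
    ∑ j : Fin 2, ∫ x, U x ^ p * X x j * fderiv ℝ w x (eb j)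
      = -(1 / (p + 1)) * ∫ x, U x ^ (p + 1) * dv X x := by
  have hp := h.hp
  have hR0 := h.R0
  have hp1 : p + 1 ≠ 0 := by linarith
  set f : E2 → ℝ := fun x => (w x + c) ^ (p + 1) with hf
  have hfc : ContDiff ℝ 1 f := by
    have := Real.contDiff_rpow_const_of_le (p := p + 1) (n := 1) (by push_cast; linarith)
    exact this.comp ((h.w2.of_le (by norm_num)).add contDiff_const)
  have hfd : ∀ x v, fderiv ℝ f x v = (p + 1) * (w x + c) ^ p * fderiv ℝ w x v := by
    intro x v
    have h1 : HasFDerivAt (fun x => w x + c) (fderiv ℝ w x) x :=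
      ((h.w2.differentiable (by norm_num) x).hasFDerivAt).add_const c
    have h2 := Real.hasDerivAt_rpow_const (x := w x + c) (p := p + 1) (Or.inr (by linarith))
    have h3 := h2.comp_hasFDerivAt x h1
    have h4 : fderiv ℝ f x = _ := h3.fderiv
    rw [h4]
    simp
  have hloc : ∀ x, X x ≠ 0 → w x + c = U x := by
    intro x hx
    have h1 : ‖x - x1‖ < Λ * r := by
      by_contra! hn; exact hx (hX.zero x hn)
    have := (h.loc x (by rw [mem_ball, dist_eq_norm]; linarith)).1
    linarith
  have hlocd : ∀ x, dv X x ≠ 0 → w x + c = U x := by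
    intro x hx
    have h1 : ‖x - x1‖ < Λ * r := by
      by_contra! hn; exact hx (hX.div0 x hn)
    have := (h.loc x (by rw [mem_ball, dist_eq_norm]; linarith)).1
    linarith
  have hj : ∀ j : Fin 2, ∫ x, U x ^ p * X x j * fderiv ℝ w x (eb j)
      = -(1 / (p + 1)) * ∫ x, f x * fderiv ℝ (fun y => X y j) x (eb j) := by
    intro j
    rw [ibp hfc (hX.comp_smooth j) (hX.comp_cs j) (eb j)]
    have : ∀ x, fderiv ℝ f x (eb j) * X x j = (p + 1) * (U x ^ p * X x j * fderiv ℝ w x (eb j)) := by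
      intro x
      by_cases hx : X x = 0
      · rw [hx]; simp
      · rw [hfd, hloc x hx]; ring
    simp only [this]
    rw [integral_const_mul]
    field_simp
  rw [Finset.sum_congr rfl fun j _ => hj j, ← Finset.mul_sum, ← integral_finsetSum]
  · congr 2
    ext x
    rw [← Finset.mul_sum]
    change f x * dv X x = _
    by_cases hx : dv X x = 0
    · rw [hx]; simp
    · simp only [hf]; rw [hlocd x hx]
  · intro j _
    exact (hfc.continuous.mul (pd_continuous (hX.comp_smooth j) _)).integrable_of_hasCompactSupport
      (HasCompactSupport.mul_left ((hX.comp_cs j).fderiv_apply ℝ _))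

/-- Local right-hand side. -/
def F1 (U : E2 → ℝ) (p : ℝ) (x1 : E2) (R : ℝ) : E2 → ℝ := (ball x1 R).indicator (fun x => U x ^ p)

lemma F1BB (h : PD D p U w x1 c R) : BB (F1 U p x1 R) := h.FBB.indicator measurableSet_ball

lemma F1_nonneg (h : PD D p U w x1 c R) (x : E2) : 0 ≤ F1 U p x1 R x :=
  Set.indicator_nonneg (fun _ _ => h.pow0 p _) _

lemma F1_le (h : PD D p U w x1 c R) (x : E2) : F1 U p x1 R x ≤ U x ^ p :=
  Set.indicator_le_self' (fun _ _ => h.pow0 p _) _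

lemma F1_of (x : E2) (hx : ‖x - x1‖ < R) : F1 U p x1 R x = U x ^ p :=
  Set.indicator_of_mem (by rw [mem_ball, dist_eq_norm]; exact hx) _

lemma gBB (h : PD D p U w x1 c R) (hX : Xf x1 r Λ L L2 X) (j : Fin 2) :
    BB (fun x => X x j * F1 U p x1 R x) := by
  obtain ⟨C, hC⟩ := (hX.comp_cs j).exists_bound_of_continuous (hX.comp_smooth j).continuous
  exact h.F1BB.mul (hX.comp_smooth j).continuous.measurable (B := C) hC

/-- Step B. -/
lemma poho_rep (h : PD D p U w x1 c R) (hX : Xf x1 r Λ L L2 X) (hR : Λ * r ≤ R / 2) (j : Fin 2) :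
    ∫ x, U x ^ p * X x j * fderiv ℝ w x (eb j) = -(1 / (2 * π)) *
      ((∫ q : E2 × E2, (X q.1 j * F1 U p x1 R q.1) *
          ((q.1 - q.2) j / ‖q.1 - q.2‖ ^ 2 * F1 U p x1 R q.2) ∂(volume.prod volume)) +
       ∫ q : E2 × E2, (X q.1 j * F1 U p x1 R q.1) *
          ((q.1 - q.2) j / ‖q.1 - q.2‖ ^ 2 * (- lap w q.2 - F1 U p x1 R q.2)) ∂(volume.prod volume)) := by
  have hR0 := h.R0
  have hk : Measurable (fun z : E2 => z j / ‖z‖ ^ 2) := (Ker.coord j).1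
  have i1 := prod_int (h.gBB hX j) h.F1BB hk (coord_bd j)
  have i2 := prod_int (h.gBB hX j) (h.QBB.sub h.F1BB) hk (coord_bd j)
  have i3 := prod_int (h.gBB hX j) h.QBB hk (coord_bd j)
  rw [← integral_add i1 i2]
  have : (fun q : E2 × E2 => (X q.1 j * F1 U p x1 R q.1) *
          ((q.1 - q.2) j / ‖q.1 - q.2‖ ^ 2 * F1 U p x1 R q.2) + (X q.1 j * F1 U p x1 R q.1) *
          ((q.1 - q.2) j / ‖q.1 - q.2‖ ^ 2 * (- lap w q.2 - F1 U p x1 R q.2)))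
      = fun q => (X q.1 j * F1 U p x1 R q.1) *
          ((q.1 - q.2) j / ‖q.1 - q.2‖ ^ 2 * (- lap w q.2)) := by
    ext q; ring
  rw [this, integral_prod _ i3, ← integral_const_mul]
  congr 1
  ext x
  simp only []
  rw [integral_const_mul, rep3 h.w2 h.hc x j]
  by_cases hx : X x = 0
  · rw [hx]; simp
  · have h1 : ‖x - x1‖ < Λ * r := by
      by_contra! hn; exact hx (hX.zero x hn)
    rw [F1_of x (by linarith)]
    ring

/-- Step C: symmetrization. -/
lemma poho_symm (h : PD D p U w x1 c R) (hX : Xf x1 r Λ L L2 X) :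
    Integrable (fun q : E2 × E2 => F1 U p x1 R q.1 * F1 U p x1 R q.2 * Sk X q.1 q.2)
      (volume.prod volume) ∧
    2 * ∑ j : Fin 2, (∫ q : E2 × E2, (X q.1 j * F1 U p x1 R q.1) *
          ((q.1 - q.2) j / ‖q.1 - q.2‖ ^ 2 * F1 U p x1 R q.2) ∂(volume.prod volume))
      = ∫ q : E2 × E2, F1 U p x1 R q.1 * F1 U p x1 R q.2 * Sk X q.1 q.2 ∂(volume.prod volume) := by
  have hk : ∀ j : Fin 2, Measurable (fun z : E2 => z j / ‖z‖ ^ 2) := fun j => (Ker.coord j).1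
  have i1 := fun j => prod_int (h.gBB hX j) h.F1BB (hk j) (coord_bd j)
  set H : Fin 2 → E2 × E2 → ℝ := fun j q => (X q.1 j * F1 U p x1 R q.1) *
          ((q.1 - q.2) j / ‖q.1 - q.2‖ ^ 2 * F1 U p x1 R q.2) with hH
  have hsw : ∀ j, ∫ q : E2 × E2, H j q.swap ∂(volume.prod volume)
      = ∫ q : E2 × E2, H j q ∂(volume.prod volume) := fun j =>
    integral_prod_swap (μ := (volume : Measure E2)) (ν := (volume : Measure E2)) (H j)
  have i2 : ∀ j, Integrable (fun q : E2 × E2 => H j q.swap) (volume.prod volume) := fun j =>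
    (i1 j).swap
  have hS : (fun q : E2 × E2 => F1 U p x1 R q.1 * F1 U p x1 R q.2 * Sk X q.1 q.2)
      = fun q => ∑ j : Fin 2, (H j q + H j q.swap) := by
    ext q
    unfold Sk
    rw [Finset.mul_sum]
    refine Finset.sum_congr rfl fun j _ => ?_
    simp only [hH, Prod.fst_swap, Prod.snd_swap]
    rw [norm_sub_rev q.2 q.1]
    have h1 : (q.2 - q.1) j = -(q.1 - q.2) j := by simp
    have h2 : (X q.1 - X q.2) j = X q.1 j - X q.2 j := by simp
    rw [h1, h2]
    ring
  have i3 : ∀ j ∈ Finset.univ, Integrable (fun q : E2 × E2 => H j q + H j q.swap)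
    (volume.prod volume) := fun j _ => (i1 j).add (i2 j)
  rw [hS]
  refine ⟨integrable_finsetSum _ i3, ?_⟩
  rw [integral_finsetSum _ i3, Finset.mul_sum]
  refine Finset.sum_congr rfl fun j _ => ?_
  rw [integral_add (i1 j) (i2 j), hsw]
  ring

/-- Step D: the outer contribution. -/
lemma poho_out (h : PD D p U w x1 c R) (hX : Xf x1 r Λ L L2 X) (hR : Λ * r ≤ R / 2) :
    |∑ j : Fin 2, ∫ q : E2 × E2, (X q.1 j * F1 U p x1 R q.1) *
          ((q.1 - q.2) j / ‖q.1 - q.2‖ ^ 2 * (- lap w q.2 - F1 U p x1 R q.2)) ∂(volume.prod volume)|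
      ≤ 4 / R * (∫ y, U y ^ p) * ∫ x in ball x1 (Λ * r), U x ^ p * ‖x - x1‖ := by
  have hR0 := h.R0
  have hk : ∀ j : Fin 2, Measurable (fun z : E2 => z j / ‖z‖ ^ 2) := fun j => (Ker.coord j).1
  have hQo := h.QBB.sub h.F1BB
  have i2 := fun j => prod_int (h.gBB hX j) hQo (hk j) (coord_bd j)
  rw [← integral_finsetSum _ fun j _ => i2 j]
  set G : E2 → ℝ := (ball x1 (Λ * r)).indicator (fun x => U x ^ p * ‖x - x1‖) with hG
  have hGi : Integrable G := by
    rw [hG, integrable_indicator_iff measurableSet_ball]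
    have hcn : Continuous (fun x : E2 => U x ^ p * ‖x - x1‖) :=
      (h.powc h.hp0).mul (continuous_id.sub continuous_const).norm
    exact hcn.continuousOn.integrableOn_of_subset_isCompact (isCompact_closedBall x1 (Λ * r))
      measurableSet_ball ball_subset_closedBall measure_ball_lt_top.ne
  have hG0 : ∀ x, 0 ≤ G x := fun x =>
    Set.indicator_nonneg (fun _ _ => mul_nonneg (h.pow0 p _) (norm_nonneg _)) _
  have hpt : ∀ q : E2 × E2, ‖∑ j : Fin 2, (X q.1 j * F1 U p x1 R q.1) *
          ((q.1 - q.2) j / ‖q.1 - q.2‖ ^ 2 * (- lap w q.2 - F1 U p x1 R q.2))‖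
      ≤ (2 / R * G q.1) * |(- lap w q.2 - F1 U p x1 R q.2)| := by
    intro q
    have hn : 0 ≤ (2 / R * G q.1) * |(- lap w q.2 - F1 U p x1 R q.2)| :=
      mul_nonneg (mul_nonneg (by positivity) (hG0 _)) (abs_nonneg _)
    by_cases hx : X q.1 = 0
    · rw [hx]; simpa using hn
    by_cases hy : - lap w q.2 - F1 U p x1 R q.2 = 0
    · rw [hy]; simp
    have h1 : ‖q.1 - x1‖ < Λ * r := by
      by_contra! hn; exact hx (hX.zero q.1 hn)
    have h2 : R ≤ ‖q.2 - x1‖ := by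
      by_contra! hn
      apply hy
      rw [F1_of q.2 hn, (h.loc q.2 (by rw [mem_ball, dist_eq_norm]; exact hn)).2, sub_self]
    have h3 : R / 2 ≤ ‖q.1 - q.2‖ := by
      have : ‖q.2 - x1‖ ≤ ‖q.1 - q.2‖ + ‖q.1 - x1‖ := by
        have := norm_sub_le (q.1 - x1) (q.1 - q.2)
        rw [sub_sub_sub_cancel_left] at this
        linarith
      linarith
    have h30 : 0 < ‖q.1 - q.2‖ := by linarith
    have h4 : ∑ j : Fin 2, (X q.1 j * F1 U p x1 R q.1) *
          ((q.1 - q.2) j / ‖q.1 - q.2‖ ^ 2 * (- lap w q.2 - F1 U p x1 R q.2))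
        = (∑ j : Fin 2, X q.1 j * (q.1 - q.2) j) * (F1 U p x1 R q.1 / ‖q.1 - q.2‖ ^ 2 *
          (- lap w q.2 - F1 U p x1 R q.2)) := by
      rw [Finset.sum_mul]
      exact Finset.sum_congr rfl fun j _ => by ring
    rw [h4, Real.norm_eq_abs, abs_mul, abs_mul, abs_div, abs_of_nonneg (h.F1_nonneg _),
      abs_of_nonneg (sq_nonneg ‖q.1 - q.2‖)]
    rw [F1_of q.1 (by linarith)]
    have h5 : G q.1 = U q.1 ^ p * ‖q.1 - x1‖ :=
      Set.indicator_of_mem (by rw [mem_ball, dist_eq_norm]; exact h1) _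
    rw [h5, ← mul_assoc]
    apply mul_le_mul_of_nonneg_right _ (abs_nonneg _)
    have h6 := (dot_le (X q.1) (q.1 - q.2)).trans
      (mul_le_mul_of_nonneg_right (hX.bd q.1) (norm_nonneg _))
    have hF := h.pow0 p q.1
    calc _ ≤ ‖q.1 - x1‖ * ‖q.1 - q.2‖ * (U q.1 ^ p / ‖q.1 - q.2‖ ^ 2) :=
          mul_le_mul_of_nonneg_right h6 (by positivity)
      _ = (‖q.1 - q.2‖)⁻¹ * (U q.1 ^ p * ‖q.1 - x1‖) := by field_simp
      _ ≤ (R / 2)⁻¹ * (U q.1 ^ p * ‖q.1 - x1‖) := by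
          apply mul_le_mul_of_nonneg_right _ (by positivity)
          exact inv_anti₀ (by positivity) h3
      _ = _ := by rw [inv_div]
  have hint : Integrable (fun q : E2 × E2 => (2 / R * G q.1) * |(- lap w q.2 - F1 U p x1 R q.2)|)
      (volume.prod volume) := Integrable.mul_prod (hGi.const_mul _) hQo.abs.integrable
  have h1 := norm_integral_le_of_norm_le hint (Eventually.of_forall hpt)
  rw [Real.norm_eq_abs] at h1
  refine h1.trans ?_
  rw [integral_prod_mul (fun x => 2 / R * G x) (fun y => |(- lap w y - F1 U p x1 R y)|),
    integral_const_mul, hG, integral_indicator measurableSet_ball]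
  have h2 : ∫ y, |(- lap w y - F1 U p x1 R y)| ≤ 2 * ∫ y, U y ^ p := by
    refine le_trans (integral_mono hQo.abs.integrable h.QBB.abs.integrable fun y => ?_) h.Q_abs
    simp only
    by_cases hy : y ∈ ball x1 R
    · have e1 : - lap w y - F1 U p x1 R y = 0 := by
        rw [(h.loc y hy).2, F1, Set.indicator_of_mem hy, sub_self]
      rw [e1, abs_zero]
      exact abs_nonneg _
    · rw [F1, Set.indicator_of_notMem hy, sub_zero]
  have h3 : 0 ≤ ∫ x in ball x1 (Λ * r), U x ^ p * ‖x - x1‖ :=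
    integral_nonneg fun x => mul_nonneg (h.pow0 p x) (norm_nonneg _)
  calc _ ≤ 2 / R * (∫ x in ball x1 (Λ * r), U x ^ p * ‖x - x1‖) * (2 * ∫ y, U y ^ p) :=
        mul_le_mul_of_nonneg_left h2 (by positivity)
    _ = _ := by ring

end PD

/-- Mass of the nonlinearity in a ball. -/
def mb (U : E2 → ℝ) (p : ℝ) (x1 : E2) (s : ℝ) : ℝ := ∫ y in ball x1 s, U y ^ p

namespace PD
variable {D p : ℝ} {U w : E2 → ℝ} {x1 : E2} {c R : ℝ} {r Λ L L2 : ℝ} {X : E2 → E2}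

lemma F1BB' (h : PD D p U w x1 c R) (s : ℝ) : BB (F1 U p x1 s) := h.FBB.indicator measurableSet_ball

lemma F1_int (s : ℝ) : ∫ y, F1 U p x1 s y = mb U p x1 s := by
  unfold F1 mb; rw [integral_indicator measurableSet_ball]

lemma F1_nonneg' (h : PD D p U w x1 c R) (s : ℝ) (x : E2) : 0 ≤ F1 U p x1 s x :=
  Set.indicator_nonneg (fun _ _ => h.pow0 p _) _

lemma F1_le' (h : PD D p U w x1 c R) (s : ℝ) (x : E2) : F1 U p x1 s x ≤ U x ^ p :=
  Set.indicator_le_self' (fun _ _ => h.pow0 p _) _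

lemma F1_out {s : ℝ} (x : E2) (hx : s ≤ ‖x - x1‖) : F1 U p x1 s x = 0 :=
  Set.indicator_of_notMem (by rw [mem_ball, dist_eq_norm]; exact not_lt.2 hx) _

lemma mb_nonneg (h : PD D p U w x1 c R) (s : ℝ) : 0 ≤ mb U p x1 s :=
  integral_nonneg fun x => h.pow0 p x

lemma mb_le (h : PD D p U w x1 c R) (s : ℝ) : mb U p x1 s ≤ ∫ y, U y ^ p :=
  setIntegral_le_integral h.FBB.integrable (Eventually.of_forall fun x => h.pow0 p x)

lemma mb_mono (h : PD D p U w x1 c R) {s t : ℝ} (hst : s ≤ t) : mb U p x1 s ≤ mb U p x1 t :=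
  setIntegral_mono_set h.FBB.integrable.integrableOn (Eventually.of_forall fun x => h.pow0 p x)
    (Eventually.of_forall (ball_subset_ball hst))

/-- Step E. -/
lemma poho_E (h : PD D p U w x1 c R) (hr : 0 < r) (hΛ : 1 < Λ) (hL : 0 ≤ L)
    (hX : Xf x1 r Λ L L2 X) (hR : Λ * r ≤ R / 2) :
    |(∫ q : E2 × E2, F1 U p x1 R q.1 * F1 U p x1 R q.2 * Sk X q.1 q.2 ∂(volume.prod volume))
        - mb U p x1 r ^ 2|
      ≤ 2 * (∫ y, U y ^ p) * (((∫ y, U y ^ p) - mb U p x1 (Λ * r)) / (Λ - 1)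
        + L * (mb U p x1 (Λ * r) - mb U p x1 r)) := by
  have hR0 := h.R0
  have hrΛ : r < Λ * r := by nlinarith
  set b : ℝ := 1 / (Λ - 1) with hb
  have hb0 : 0 < b := by rw [hb]; apply one_div_pos.2; linarith
  set g : E2 → ℝ := fun x => b * (F1 U p x1 R x - F1 U p x1 (Λ * r) x)
    + L * (F1 U p x1 (Λ * r) x - F1 U p x1 r x) with hg
  have hi := fun s => (h.F1BB' s).integrable
  have hg1 : Integrable (fun x => b * (F1 U p x1 R x - F1 U p x1 (Λ * r) x)) :=
    ((hi R).sub (hi _)).const_mul b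
  have hg2 : Integrable (fun x => L * (F1 U p x1 (Λ * r) x - F1 U p x1 r x)) :=
    ((hi _).sub (hi _)).const_mul L
  have hgi : Integrable g := hg1.add hg2
  have hgint : ∫ x, g x = b * (mb U p x1 R - mb U p x1 (Λ * r))
      + L * (mb U p x1 (Λ * r) - mb U p x1 r) := by
    rw [hg, integral_add hg1 hg2, integral_const_mul, integral_const_mul,
      integral_sub (hi _) (hi _), integral_sub (hi _) (hi _), F1_int, F1_int, F1_int]
  have hcase : ∀ x, (‖x - x1‖ < r ∧ F1 U p x1 r x = F1 U p x1 R x ∧ g x = 0) ∨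
      ((r ≤ ‖x - x1‖ ∧ ‖x - x1‖ < Λ * r) ∧ F1 U p x1 r x = 0 ∧ g x = L * F1 U p x1 R x) ∨
      (Λ * r ≤ ‖x - x1‖ ∧ F1 U p x1 r x = 0 ∧ g x = b * F1 U p x1 R x) := by
    intro x
    rcases lt_or_ge ‖x - x1‖ r with h1 | h1
    · left
      have e1 : F1 U p x1 r x = U x ^ p := F1_of x h1
      have e2 : F1 U p x1 (Λ * r) x = U x ^ p := F1_of x (by linarith)
      have e3 : F1 U p x1 R x = U x ^ p := F1_of x (by linarith)
      refine ⟨h1, by rw [e1, e3], ?_⟩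
      simp only [hg]; rw [e1, e2, e3]; ring
    · right
      rcases lt_or_ge ‖x - x1‖ (Λ * r) with h2 | h2
      · left
        have e1 : F1 U p x1 r x = 0 := F1_out x h1
        have e2 : F1 U p x1 (Λ * r) x = U x ^ p := F1_of x (by linarith)
        have e3 : F1 U p x1 R x = U x ^ p := F1_of x (by linarith)
        refine ⟨⟨h1, h2⟩, e1, ?_⟩
        simp only [hg]; rw [e1, e2, e3]; ring
      · right
        have e1 : F1 U p x1 r x = 0 := F1_out x h1
        have e2 : F1 U p x1 (Λ * r) x = 0 := F1_out x (by linarith)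
        refine ⟨h2, e1, ?_⟩
        simp only [hg]; rw [e1, e2]; ring
  have hpt : ∀ q : E2 × E2, q.1 - q.2 ≠ 0 → ‖F1 U p x1 R q.1 * F1 U p x1 R q.2 * Sk X q.1 q.2
      - F1 U p x1 r q.1 * F1 U p x1 r q.2‖ ≤ g q.1 * F1 U p x1 R q.2 + F1 U p x1 R q.1 * g q.2 := by
    rintro ⟨x, y⟩ hxy
    simp only at hxy ⊢
    have ha := h.F1_nonneg x
    have ha' := h.F1_nonneg y
    have hxy0 : 0 < ‖x - y‖ := norm_pos_iff.2 hxy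
    have hgen : ∀ t, |Sk X x y| ≤ t → |F1 U p x1 R x * F1 U p x1 R y * Sk X x y|
        ≤ F1 U p x1 R x * F1 U p x1 R y * t := by
      intro t ht
      rw [abs_mul, abs_of_nonneg (mul_nonneg ha ha')]
      exact mul_le_mul_of_nonneg_left ht (mul_nonneg ha ha')
    have hSL := hgen L (Sk_le X hxy (hX.lip x y))
    rw [Real.norm_eq_abs]
    have haa := mul_nonneg ha ha'
    have hLaa := mul_nonneg hL haa
    have hbaa := mul_nonneg hb0.le haa
    rcases hcase x with ⟨c1, c2, c3⟩ | ⟨c1, c2, c3⟩ | ⟨c1, c2, c3⟩ <;>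
    rcases hcase y with ⟨d1, d2, d3⟩ | ⟨d1, d2, d3⟩ | ⟨d1, d2, d3⟩ <;>
    rw [c2, c3, d2, d3]
    · rw [Sk_one X hxy (by rw [hX.one x c1, hX.one y d1]; abel)]
      simp
    · simp only [mul_zero, sub_zero, zero_mul, zero_add]; linarith
    · simp only [mul_zero, sub_zero, zero_mul, zero_add]
      refine (hgen b (Sk_le X hxy ?_)).trans (by linarith)
      rw [hX.zero y d1, sub_zero]
      have e1 := hX.bd x
      have e2 : ‖y - x1‖ ≤ ‖x - y‖ + ‖x - x1‖ := by
        have := norm_sub_le (x - x1) (x - y)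
        rw [sub_sub_sub_cancel_left] at this
        linarith
      have e3 : (Λ - 1) * r ≤ ‖x - y‖ := by linarith
      rw [hb, one_div, ← div_eq_inv_mul, le_div_iff₀ (by linarith)]
      nlinarith
    · simp only [mul_zero, sub_zero, zero_mul, add_zero]; linarith
    · simp only [mul_zero, sub_zero]; linarith
    · simp only [mul_zero, sub_zero]; linarith
    · simp only [mul_zero, sub_zero, zero_mul, add_zero]
      refine (hgen b (Sk_le X hxy ?_)).trans (by linarith)
      rw [hX.zero x c1, zero_sub, norm_neg]
      have e1 := hX.bd y
      have e2 : ‖x - x1‖ ≤ ‖x - y‖ + ‖y - x1‖ := by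
        have := norm_add_le (x - y) (y - x1)
        rw [sub_add_sub_cancel] at this
        linarith
      have e3 : (Λ - 1) * r ≤ ‖x - y‖ := by linarith
      rw [hb, one_div, ← div_eq_inv_mul, le_div_iff₀ (by linarith)]
      nlinarith
    · simp only [mul_zero, sub_zero]; linarith
    · simp only [mul_zero, sub_zero]
      refine (hgen 0 (Sk_le X hxy ?_)).trans (by linarith)
      rw [hX.zero x c1, hX.zero y d1]; simp
  have j1 : Integrable (fun q : E2 × E2 => g q.1 * F1 U p x1 R q.2) (volume.prod volume) :=
    hgi.mul_prod (hi R)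
  have j2 : Integrable (fun q : E2 × E2 => F1 U p x1 R q.1 * g q.2) (volume.prod volume) :=
    (hi R).mul_prod hgi
  have j3 : Integrable (fun q : E2 × E2 => F1 U p x1 r q.1 * F1 U p x1 r q.2) (volume.prod volume) :=
    (hi r).mul_prod (hi r)
  have j4 : Integrable (fun q : E2 × E2 => g q.1 * F1 U p x1 R q.2 + F1 U p x1 R q.1 * g q.2)
    (volume.prod volume) := j1.add j2
  have hae : ∀ᵐ q : E2 × E2 ∂(volume.prod volume),
      ‖F1 U p x1 R q.1 * F1 U p x1 R q.2 * Sk X q.1 q.2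
      - F1 U p x1 r q.1 * F1 U p x1 r q.2‖ ≤ g q.1 * F1 U p x1 R q.2 + F1 U p x1 R q.1 * g q.2 := by
    filter_upwards [ae_ne_prod] with q hq using hpt q hq
  have h1 := norm_integral_le_of_norm_le j4 hae
  rw [integral_sub (h.poho_symm hX).1 j3, integral_add j1 j2, Real.norm_eq_abs,
    integral_prod_mul (F1 U p x1 r) (F1 U p x1 r), integral_prod_mul g (F1 U p x1 R),
    integral_prod_mul (F1 U p x1 R) g, F1_int, F1_int, ← pow_two, hgint] at h1
  refine h1.trans ?_
  have k1 := h.mb_le R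
  have k2 := h.mb_nonneg R
  have k3 := h.mb_mono (s := Λ * r) (t := R) (by linarith)
  have k4 := h.mb_mono hrΛ.le
  set m := ∫ y, U y ^ p
  have e1 : (m - mb U p x1 (Λ * r)) / (Λ - 1) = b * (m - mb U p x1 (Λ * r)) := by
    rw [hb]; ring
  rw [e1]
  have e2 : b * (mb U p x1 R - mb U p x1 (Λ * r)) + L * (mb U p x1 (Λ * r) - mb U p x1 r)
      ≤ b * (m - mb U p x1 (Λ * r)) + L * (mb U p x1 (Λ * r) - mb U p x1 r) := by
    gcongr
  have e3 : 0 ≤ b * (mb U p x1 R - mb U p x1 (Λ * r)) + L * (mb U p x1 (Λ * r) - mb U p x1 r) :=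
    add_nonneg (mul_nonneg hb0.le (by linarith)) (mul_nonneg hL (by linarith))
  nlinarith

/-- Localized Pohozaev identity with errors. -/
lemma pohozaev (h : PD D p U w x1 c R) (hr : 0 < r) (hΛ : 1 < Λ) (hL : 0 ≤ L)
    (hX : Xf x1 r Λ L L2 X) (hR : Λ * r ≤ R / 2) :
    |mb U p x1 r ^ 2 / (4 * π) - 2 / (p + 1) * ∫ x in ball x1 r, U x ^ (p + 1)|
      ≤ 1 / (4 * π) * (2 * (∫ y, U y ^ p) * (((∫ y, U y ^ p) - mb U p x1 (Λ * r)) / (Λ - 1)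
        + L * (mb U p x1 (Λ * r) - mb U p x1 r)))
        + L2 / (p + 1) * U x1 * (mb U p x1 (Λ * r) - mb U p x1 r)
        + 1 / (2 * π) * (4 / R * (∫ y, U y ^ p) * ∫ x in ball x1 (Λ * r), U x ^ p * ‖x - x1‖) := by
  have hp := h.hp
  have hrΛ : r < Λ * r := by nlinarith
  have hA := h.poho_div hX hR
  rw [Finset.sum_congr rfl fun j _ => h.poho_rep hX hR j, ← Finset.mul_sum,
    Finset.sum_add_distrib] at hA
  have hS := (h.poho_symm hX).2
  have hO := h.poho_out hX hR
  have hE := h.poho_E hr hΛ hL hX hR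
  set S := ∑ j : Fin 2, (∫ q : E2 × E2, (X q.1 j * F1 U p x1 R q.1) *
          ((q.1 - q.2) j / ‖q.1 - q.2‖ ^ 2 * F1 U p x1 R q.2) ∂(volume.prod volume))
  set O := ∑ j : Fin 2, ∫ q : E2 × E2, (X q.1 j * F1 U p x1 R q.1) *
          ((q.1 - q.2) j / ‖q.1 - q.2‖ ^ 2 * (- lap w q.2 - F1 U p x1 R q.2)) ∂(volume.prod volume)
  set I := ∫ q : E2 × E2, F1 U p x1 R q.1 * F1 U p x1 R q.2 * Sk X q.1 q.2 ∂(volume.prod volume)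
  -- the divergence term
  have hi := fun s => (h.F1BB' s).integrable
  have hEi := h.EBB.integrable
  have hdc : Continuous (dv X) := by
    unfold dv
    exact continuous_finsetSum _ fun j _ => pd_continuous (hX.comp_smooth j) (eb j)
  have hdi : Integrable (fun x => U x ^ (p + 1) * dv X x) := by
    have := (h.EBB.mul hdc.measurable hX.div).integrable
    refine this.congr (Eventually.of_forall fun x => ?_)
    simp only; ring
  have hB : |(∫ x, U x ^ (p + 1) * dv X x) - 2 * ∫ x in ball x1 r, U x ^ (p + 1)|
      ≤ L2 * U x1 * (mb U p x1 (Λ * r) - mb U p x1 r) := by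
    rw [← integral_indicator measurableSet_ball, ← integral_const_mul, ← integral_sub hdi
      ((hEi.indicator measurableSet_ball).const_mul 2), ← F1_int, ← F1_int,
      ← integral_sub (hi _) (hi _), ← integral_const_mul, ← Real.norm_eq_abs]
    refine norm_integral_le_of_norm_le (((hi _).sub (hi _)).const_mul _)
      (Eventually.of_forall fun x => ?_)
    have hM := h.M0
    have hL2 : 0 ≤ L2 := (abs_nonneg _).trans (hX.div x)
    rcases lt_or_ge ‖x - x1‖ r with h1 | h1
    · have e1 : F1 U p x1 r x = U x ^ p := F1_of x h1
      have e2 : F1 U p x1 (Λ * r) x = U x ^ p := F1_of x (by linarith)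
      rw [e1, e2, Set.indicator_of_mem (by rw [mem_ball, dist_eq_norm]; exact h1), hX.div1 x h1]
      rw [mul_comm, sub_self]; simp
    · rw [Set.indicator_of_notMem (by rw [mem_ball, dist_eq_norm]; exact not_lt.2 h1)]
      have e1 : F1 U p x1 r x = 0 := F1_out x h1
      rw [e1, mul_zero, sub_zero, sub_zero]
      rcases lt_or_ge ‖x - x1‖ (Λ * r) with h2 | h2
      · have e2 : F1 U p x1 (Λ * r) x = U x ^ p := F1_of x (by linarith)
        rw [e2, h.pow_succ, norm_mul, Real.norm_eq_abs, Real.norm_eq_abs,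
          abs_of_nonneg (mul_nonneg (h.U0 x) (h.pow0 p x))]
        calc _ ≤ U x1 * U x ^ p * L2 :=
              mul_le_mul (mul_le_mul_of_nonneg_right (h.UM x) (h.pow0 p x)) (hX.div x)
                (abs_nonneg _) (mul_nonneg hM.le (h.pow0 p x))
          _ = _ := by ring
      · rw [hX.div0 x h2]
        simp only [mul_zero, norm_zero]
        exact mul_nonneg (mul_nonneg hL2 hM.le) (h.F1_nonneg' _ _)
  set Dv := ∫ x, U x ^ (p + 1) * dv X x
  set Er := ∫ x in ball x1 r, U x ^ (p + 1)
  set m := ∫ y, U y ^ p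
  set V := ∫ x in ball x1 (Λ * r), U x ^ p * ‖x - x1‖
  have hpi := Real.pi_pos
  have key : mb U p x1 r ^ 2 / (4 * π) - 2 / (p + 1) * Er
      = -(1 / (4 * π)) * (I - mb U p x1 r ^ 2) + 1 / (p + 1) * (Dv - 2 * Er)
        + -(1 / (2 * π)) * O := by
    have h1 : 1 / (p + 1) * Dv = 1 / (2 * π) * (S + O) := by linarith
    have h2 : S = I / 2 := by linarith
    have h3 : 1 / (p + 1) * (Dv - 2 * Er) = 1 / (2 * π) * (I / 2 + O) - 2 / (p + 1) * Er := by
      rw [mul_sub, h1, h2]; ring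
    rw [h3]
    field_simp
    ring
  rw [key]
  refine (abs_add_three _ _ _).trans ?_
  rw [abs_mul, abs_mul, abs_mul, abs_neg, abs_neg, abs_of_pos (a := 1 / (4 * π)) (by positivity),
    abs_of_pos (a := 1 / (2 * π)) (by positivity), abs_of_pos (a := 1 / (p + 1)) (by positivity)]
  have t2 : L2 / (p + 1) * U x1 * (mb U p x1 (Λ * r) - mb U p x1 r)
      = 1 / (p + 1) * (L2 * U x1 * (mb U p x1 (Λ * r) - mb U p x1 r)) := by ring
  rw [t2]
  gcongr

end PD

namespace PD
variable {D p : ℝ} {U w : E2 → ℝ} {x1 : E2} {c R : ℝ} {r Λ L L2 : ℝ} {X : E2 → E2}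

/-- Scaled form of the Pohozaev estimate. -/
lemma poho_scaled (h : PD D p U w x1 c R) (hr : 0 < r) (hΛ : 1 < Λ) (hL : 0 ≤ L) (hL2 : 0 ≤ L2)
    (hX : Xf x1 r Λ L L2 X) (hR : Λ * r ≤ R / 2) {K : ℝ} (hK : p * ∫ y, U y ^ p ≤ K) :
    |(p * mb U p x1 r) ^ 2 / (4 * π) - 2 * U x1 * (p * mb U p x1 r)|
      ≤ 1 / (4 * π) * (2 * K * ((p * ((∫ y, U y ^ p) - mb U p x1 (Λ * r))) / (Λ - 1)
        + L * (p * (mb U p x1 (Λ * r) - mb U p x1 r))))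
        + L2 * U x1 * (p * (mb U p x1 (Λ * r) - mb U p x1 r))
        + 1 / (2 * π) * (4 / R * K * (p * ∫ x in ball x1 (Λ * r), U x ^ p * ‖x - x1‖))
        + 2 * (U x1 * K) / p + 2 * (p * ∫ x, U x ^ p * (U x1 - U x)) := by
  have hp := h.hp
  have hp0 := h.hp0
  have hpi := Real.pi_pos
  have hR0 := h.R0
  have hM0 := h.M0
  have hP := h.pohozaev hr hΛ hL hX hR
  have k1 := h.mb_le (Λ * r)
  have k2 := h.mb_nonneg r
  have k4 := h.mb_mono (s := r) (t := Λ * r) (by nlinarith)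
  have hV : 0 ≤ ∫ x in ball x1 (Λ * r), U x ^ p * ‖x - x1‖ :=
    integral_nonneg fun x => mul_nonneg (h.pow0 p x) (norm_nonneg _)
  have hm0 := h.m0
  have hEr : ∫ x in ball x1 r, U x ^ (p + 1)
      = U x1 * mb U p x1 r - ∫ x in ball x1 r, U x ^ p * (U x1 - U x) := by
    unfold mb
    rw [← integral_const_mul, ← integral_sub
      (h.FBB.integrable.integrableOn.const_mul _) h.FMU_BB.integrable.integrableOn]
    congr 1; ext x; rw [h.pow_succ]; ring
  have hd0 : 0 ≤ ∫ x in ball x1 r, U x ^ p * (U x1 - U x) := integral_nonneg h.FMU_nonneg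
  have hd1 : ∫ x in ball x1 r, U x ^ p * (U x1 - U x) ≤ ∫ x, U x ^ p * (U x1 - U x) :=
    setIntegral_le_integral h.FMU_BB.integrable (Eventually.of_forall h.FMU_nonneg)
  rw [hEr] at hP
  set m := ∫ y, U y ^ p
  set V := ∫ x in ball x1 (Λ * r), U x ^ p * ‖x - x1‖
  set d := ∫ x in ball x1 r, U x ^ p * (U x1 - U x)
  set d' := ∫ x, U x ^ p * (U x1 - U x)
  set M := U x1
  set a := mb U p x1 r
  set b := mb U p x1 (Λ * r)
  have hΛ' : 0 < Λ - 1 := by linarith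
  have key : (p * a) ^ 2 / (4 * π) - 2 * M * (p * a)
      = p ^ 2 * (a ^ 2 / (4 * π) - 2 / (p + 1) * (M * a - d)) - 2 * M * (p * a) / (p + 1)
        - 2 * (p / (p + 1)) * (p * d) := by
    field_simp
    ring
  have f1 : |p ^ 2 * (a ^ 2 / (4 * π) - 2 / (p + 1) * (M * a - d))|
      ≤ p ^ 2 * (1 / (4 * π) * (2 * m * ((m - b) / (Λ - 1) + L * (b - a)))
        + L2 / (p + 1) * M * (b - a) + 1 / (2 * π) * (4 / R * m * V)) := by
    rw [abs_mul, abs_of_pos (a := p ^ 2) (by positivity)]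
    exact mul_le_mul_of_nonneg_left hP (by positivity)
  have f2 : p ^ 2 * (1 / (4 * π) * (2 * m * ((m - b) / (Λ - 1) + L * (b - a)))
        + L2 / (p + 1) * M * (b - a) + 1 / (2 * π) * (4 / R * m * V))
      = 1 / (4 * π) * (2 * (p * m) * ((p * (m - b)) / (Λ - 1) + L * (p * (b - a))))
        + p / (p + 1) * (L2 * M * (p * (b - a))) + 1 / (2 * π) * (4 / R * (p * m) * (p * V)) := by
    field_simp
  have hq : p / (p + 1) ≤ 1 := by rw [div_le_one (by linarith)]; linarith
  have hq0 : 0 ≤ p / (p + 1) := by positivity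
  have n1 : 0 ≤ p * (m - b) := mul_nonneg hp0.le (by linarith)
  have n2 : 0 ≤ p * (b - a) := mul_nonneg hp0.le (by linarith)
  have f3 : 1 / (4 * π) * (2 * (p * m) * ((p * (m - b)) / (Λ - 1) + L * (p * (b - a))))
        + p / (p + 1) * (L2 * M * (p * (b - a))) + 1 / (2 * π) * (4 / R * (p * m) * (p * V))
      ≤ 1 / (4 * π) * (2 * K * ((p * (m - b)) / (Λ - 1) + L * (p * (b - a))))
        + 1 * (L2 * M * (p * (b - a))) + 1 / (2 * π) * (4 / R * K * (p * V)) := by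
    gcongr
  have f4 : |2 * M * (p * a) / (p + 1)| ≤ 2 * (M * K) / p := by
    rw [abs_of_nonneg (by positivity)]
    have : p * a ≤ K := le_trans (mul_le_mul_of_nonneg_left (h.mb_le r) hp0.le) hK
    calc _ ≤ 2 * M * K / (p + 1) := by gcongr
      _ ≤ 2 * M * K / p := by
        have : 0 ≤ p * a := by positivity
        have : 0 ≤ K := by linarith
        gcongr; linarith
      _ = _ := by ring
  have f5 : |2 * (p / (p + 1)) * (p * d)| ≤ 2 * (p * d') := by
    rw [abs_of_nonneg (by positivity)]
    calc _ ≤ 2 * 1 * (p * d') := by gcongr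
      _ = _ := by ring
  rw [key]
  have t1 := abs_sub (p ^ 2 * (a ^ 2 / (4 * π) - 2 / (p + 1) * (M * a - d)) - 2 * M * (p * a) / (p + 1))
    (2 * (p / (p + 1)) * (p * d))
  have t2 := abs_sub (p ^ 2 * (a ^ 2 / (4 * π) - 2 / (p + 1) * (M * a - d))) (2 * M * (p * a) / (p + 1))
  rw [f2] at f1
  linarith

lemma V_le (h : PD D p U w x1 c R) (s : ℝ) :
    ∫ x in ball x1 s, U x ^ p * ‖x - x1‖ ≤ s * mb U p x1 s := by
  unfold mb
  rw [← integral_const_mul]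
  have hcn : Continuous (fun x : E2 => U x ^ p * ‖x - x1‖) :=
    (h.powc h.hp0).mul (continuous_id.sub continuous_const).norm
  refine setIntegral_mono_on (hcn.continuousOn.integrableOn_of_subset_isCompact
    (isCompact_closedBall x1 s) measurableSet_ball ball_subset_closedBall measure_ball_lt_top.ne)
    (h.FBB.integrable.integrableOn.const_mul _) measurableSet_ball fun x hx => ?_
  rw [mem_ball, dist_eq_norm] at hx
  have := h.pow0 p x
  nlinarith

end PD

/-- Basic uniform bounds. -/
lemma basic_bd (D : ℝ) : ∃ κ > 0, κ ≤ 1 ∧ ∀ᶠ p : ℝ in atTop, ∀ (U w : E2 → ℝ) (x1 : E2) (c R : ℝ),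
    PD D p U w x1 c R → p * ∫ x, U x ^ (p + 1) ≤ 8 * π * Real.exp 1 + κ →
    3 / 2 ≤ U x1 ∧ U x1 ≤ 2 ∧ p * (∫ x, U x ^ p) ≤ 45 ∧ eps p (U x1) ^ 2 ≤ 1 / p := by
  obtain ⟨κ, hκ, hκ1, hl⟩ := limits D (show (0:ℝ) < 1 / 10 by norm_num)
  refine ⟨κ, hκ, hκ1, ?_⟩
  filter_upwards [hl] with p hp U w x1 c R h hE
  obtain ⟨h1, h2, -⟩ := hp U w x1 c R h hE
  obtain ⟨hq1, hq2⟩ := q_bounds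
  have hpi := Real.pi_lt_d2
  have hpi0 := Real.pi_pos
  rw [abs_le] at h1 h2
  have hM : 3 / 2 ≤ U x1 := by linarith
  refine ⟨hM, by linarith, ?_, ?_⟩
  · have : 8 * π * √(Real.exp 1) ≤ 8 * 3.15 * (5 / 3) := by gcongr
    linarith
  · have hs := eps_sq h.hp0 h.M0
    have hM1 : U x1 ≤ U x1 ^ p := by
      conv_lhs => rw [← Real.rpow_one (U x1)]
      exact Real.rpow_le_rpow_of_exponent_le (by linarith) h.hp.le
    have : U x1 * eps p (U x1) ^ 2 ≤ U x1 * (1 / p) := by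
      rw [mul_one_div, ← hs]
      exact mul_le_mul_of_nonneg_right hM1 (sq_nonneg _)
    exact le_of_mul_le_mul_left this h.M0

lemma pigeon {N : ℕ} (hN : 0 < N) (f : ℕ → ℝ) {B : ℝ} (h0 : 0 ≤ f 0) (hB : f N ≤ B) :
    ∃ k < N, f (k + 1) - f k ≤ B / N := by
  have hN' : (0:ℝ) < N := by exact_mod_cast hN
  have hs : ∑ k ∈ Finset.range N, (f (k + 1) - f k) ≤ ∑ k ∈ Finset.range N, B / N := by
    rw [Finset.sum_range_sub, Finset.sum_const, Finset.card_range, nsmul_eq_mul]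
    field_simp
    linarith
  obtain ⟨k, hk, h⟩ := Finset.exists_le_of_sum_le (Finset.nonempty_range_iff.2 hN.ne') hs
  exact ⟨k, Finset.mem_range.1 hk, h⟩

set_option maxHeartbeats 1000000 in
/-- Almost all of the mass sits at scale `eps`. -/
lemma scale (D : ℝ) {R δ : ℝ} (hR : 0 < R) (hδ : 0 < δ) :
    ∃ κ > 0, κ ≤ 1 ∧ ∃ T ≥ 1, ∀ᶠ p : ℝ in atTop, ∀ (U w : E2 → ℝ) (x1 : E2) (c : ℝ),
    PD D p U w x1 c R → p * ∫ x, U x ^ (p + 1) ≤ 8 * π * Real.exp 1 + κ →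
    8 * π * √(Real.exp 1) - δ ≤ p * mb U p x1 (T * eps p (U x1)) := by
  have hpi := Real.pi_gt_three
  have hpi0 := Real.pi_pos
  have hpi2 := Real.pi_lt_d2
  set a0 : ℝ := Real.exp (-(96 * 45)) / 2 with ha0
  have ha0p : 0 < a0 := by rw [ha0]; positivity
  set θ : ℝ := a0 * δ / (8 * π) with hθ
  have hθ0 : 0 < θ := by rw [hθ]; positivity
  set Λ : ℝ := 1 + 45 ^ 2 * 8 / θ with hΛd
  have hΛ : 1 < Λ := by rw [hΛd]; have : 0 < 45 ^ 2 * 8 / θ := by positivity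
                        linarith
  obtain ⟨L, L2, hL, hL2, hXX⟩ := exists_X hΛ
  obtain ⟨N0, hN0⟩ := exists_nat_gt (8 * ((L + L2) * 45 ^ 2) / θ)
  set N := N0 + 1 with hN
  have hNp : (0:ℝ) < N := by rw [hN]; positivity
  have hN1 : (L + L2) * 45 ^ 2 / N ≤ θ / 8 := by
    rw [div_le_iff₀ hNp]
    rw [div_lt_iff₀ hθ0] at hN0
    have : (N:ℝ) = N0 + 1 := by rw [hN]; push_cast; ring
    rw [this]; nlinarith
  set T : ℝ := Λ ^ N with hT
  have hT1 : 1 ≤ T := one_le_pow₀ hΛ.le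
  set δ' : ℝ := min (θ / 16) (δ / (16 * π)) with hδ'
  have hδ'0 : 0 < δ' := by rw [hδ']; exact lt_min (by positivity) (by positivity)
  obtain ⟨κ1, hκ1, hκ11, e1⟩ := basic_bd D
  obtain ⟨κ2, hκ2, hκ21, e2⟩ := limits D hδ'0
  refine ⟨min κ1 κ2, lt_min hκ1 hκ2, (min_le_left _ _).trans hκ11, T, hT1, ?_⟩
  set W : ℝ := 1 / (2 * π) * (4 / R * 45 * (Λ * T * 45)) with hW
  have hW0 : 0 < W := by rw [hW]; have : 0 < Λ := by linarith
                         positivity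
  set τ : ℝ := min (R / (2 * Λ * T)) (θ / (8 * W)) with hτ
  have hτ0 : 0 < τ := by
    have : 0 < Λ := by linarith
    rw [hτ]; exact lt_min (by positivity) (by positivity)
  filter_upwards [e1, e2, eventually_ge_atTop (96 * 45), eventually_ge_atTop (1 / τ ^ 2),
    eventually_ge_atTop (8 * (2 * (2 * 45)) / θ)] with p g1 g2 hp3 hp4 hp5 U w x1 c h hE
  obtain ⟨hM1, hM2, hm, he⟩ := g1 U w x1 c R h (hE.trans (by linarith [min_le_left κ1 κ2]))
  obtain ⟨l1, -, l3⟩ := g2 U w x1 c R h (hE.trans (by linarith [min_le_right κ1 κ2]))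
  have hp0 := h.hp0
  have hε0 : 0 < eps p (U x1) := eps_pos hp0 h.M0
  have hme := h.m_eps (K := 45) (by norm_num) hm (by linarith) (by linarith) hp3
  set M := U x1 with hMd
  set ε := eps p M with hεd
  have hετ : ε ≤ τ := by
    have : ε ^ 2 ≤ τ ^ 2 := by
      refine he.trans ?_
      rw [div_le_iff₀ hp0]
      rw [div_le_iff₀ (by positivity)] at hp4
      linarith
    exact abs_le_of_sq_le_sq' this hτ0.le |>.2
  -- choose the scale
  obtain ⟨k, hk, hkk⟩ := pigeon (N := N) (by omega) (fun k => p * mb U p x1 (Λ ^ k * ε))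
    (mul_nonneg hp0.le (h.mb_nonneg _))
    ((mul_le_mul_of_nonneg_left (h.mb_le _) hp0.le).trans hm)
  set r := Λ ^ k * ε with hr
  have hΛk : 1 ≤ Λ ^ k := one_le_pow₀ hΛ.le
  have hΛkT : Λ ^ k ≤ T := pow_le_pow_right₀ hΛ.le hk.le
  have hr0 : 0 < r := by rw [hr]; positivity
  have hrT : r ≤ T * ε := mul_le_mul_of_nonneg_right hΛkT hε0.le
  have hΛr : Λ ^ (k + 1) * ε = Λ * r := by rw [hr, _root_.pow_succ]; ring
  rw [hΛr] at hkk
  have hΛ0 : 0 < Λ := by linarith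
  have hRr : Λ * r ≤ R / 2 := by
    have h1 : τ ≤ R / (2 * Λ * T) := min_le_left _ _
    have h2 : Λ * r ≤ Λ * (T * τ) := by gcongr; exact hrT.trans (by gcongr)
    have h3 : Λ * (T * τ) ≤ Λ * (T * (R / (2 * Λ * T))) := by gcongr
    have h4 : Λ * (T * (R / (2 * Λ * T))) = R / 2 := by field_simp
    linarith
  obtain ⟨X, hX⟩ := hXX x1 r hr0
  have hP := h.poho_scaled hr0 hΛ hL hL2 hX hRr hm
  have hVl := h.V_le (Λ * r)
  set a := p * mb U p x1 r with ha
  have haa : a0 ≤ a := hme.trans (mul_le_mul_of_nonneg_left (h.mb_mono (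
    le_mul_of_one_le_left hε0.le hΛk)) hp0.le)
  have hA : p * (mb U p x1 (Λ * r) - mb U p x1 r) ≤ 45 / N := by linarith
  have hA0 : 0 ≤ p * (mb U p x1 (Λ * r) - mb U p x1 r) :=
    mul_nonneg hp0.le (by linarith [h.mb_mono (s := r) (t := Λ * r) (le_mul_of_one_le_left hr0.le hΛ.le)])
  have hO : p * ((∫ y, U y ^ p) - mb U p x1 (Λ * r)) ≤ 45 := by
    have := mul_nonneg hp0.le (h.mb_nonneg (Λ * r)); linarith
  have hV : p * (∫ x in ball x1 (Λ * r), U x ^ p * ‖x - x1‖) ≤ Λ * T * 45 * ε := by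
    calc p * (∫ x in ball x1 (Λ * r), U x ^ p * ‖x - x1‖) ≤ p * (Λ * r * ∫ y, U y ^ p) := by
          apply mul_le_mul_of_nonneg_left _ hp0.le
          exact hVl.trans (mul_le_mul_of_nonneg_left (h.mb_le _) (by positivity))
      _ = Λ * r * (p * ∫ y, U y ^ p) := by ring
      _ ≤ Λ * (T * ε) * 45 := by
          have := mul_nonneg hp0.le h.m0
          gcongr
      _ = _ := by ring
  have b1 : 1 / (4 * π) * (2 * 45 * ((p * ((∫ y, U y ^ p) - mb U p x1 (Λ * r))) / (Λ - 1)
        + L * (p * (mb U p x1 (Λ * r) - mb U p x1 r)))) ≤ θ / 8 + L * 45 ^ 2 / N := by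
    have c1 : p * ((∫ y, U y ^ p) - mb U p x1 (Λ * r)) / (Λ - 1) ≤ θ / (8 * 45) := by
      have : Λ - 1 = 45 ^ 2 * 8 / θ := by rw [hΛd]; ring
      rw [this, div_le_iff₀ (by positivity)]
      calc _ ≤ (45:ℝ) := hO
        _ = _ := by field_simp
    have c2 : L * (p * (mb U p x1 (Λ * r) - mb U p x1 r)) ≤ L * (45 / N) := by gcongr
    have c3 : 1 / (4 * π) * 2 ≤ 1 := by
      rw [one_div, inv_mul_le_iff₀ (by positivity)]; linarith
    calc _ ≤ 1 / (4 * π) * (2 * 45 * (θ / (8 * 45) + L * (45 / N))) := by gcongr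
      _ = (1 / (4 * π) * 2) * (45 * (θ / (8 * 45) + L * (45 / N))) := by ring
      _ ≤ 1 * (45 * (θ / (8 * 45) + L * (45 / N))) := by gcongr
      _ = _ := by ring
  have b2 : L2 * M * (p * (mb U p x1 (Λ * r) - mb U p x1 r)) ≤ L2 * 45 ^ 2 / N := by
    calc _ ≤ L2 * 45 * (45 / N) := by gcongr; linarith
      _ = _ := by ring
  have b3 : 1 / (2 * π) * (4 / R * 45 * (p * ∫ x in ball x1 (Λ * r), U x ^ p * ‖x - x1‖)) ≤ θ / 8 := by
    calc _ ≤ 1 / (2 * π) * (4 / R * 45 * (Λ * T * 45 * ε)) := by gcongr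
      _ = W * ε := by rw [hW]; ring
      _ ≤ W * (θ / (8 * W)) := by gcongr; exact hετ.trans (min_le_right _ _)
      _ = θ / 8 := by field_simp
  have b4 : 2 * (M * 45) / p ≤ θ / 8 := by
    rw [div_le_iff₀ hp0]
    rw [div_le_iff₀ hθ0] at hp5
    linarith [mul_comm p θ]
  have b5 : 2 * (p * ∫ x, U x ^ p * (M - U x)) ≤ θ / 8 := by
    have : δ' ≤ θ / 16 := min_le_left _ _
    linarith
  have tot : |a ^ 2 / (4 * π) - 2 * M * a| ≤ θ := by
    have : L * 45 ^ 2 / N + L2 * 45 ^ 2 / N = (L + L2) * 45 ^ 2 / N := by ring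
    linarith
  have h9 : a * (8 * π * M - a) ≤ 4 * π * θ := by
    have h1 := (abs_le.1 tot).1
    have h2 : a * (8 * π * M - a) = -(4 * π) * (a ^ 2 / (4 * π) - 2 * M * a) := by
      field_simp; ring
    have h3 := mul_le_mul_of_nonneg_left h1 (show (0:ℝ) ≤ 4 * π by positivity)
    rw [h2]; linarith
  have h10 : 8 * π * M - a ≤ δ / 2 := by
    by_contra! hn
    have h11 : a0 * (δ / 2) < a * (8 * π * M - a) := by
      calc a0 * (δ / 2) ≤ a * (δ / 2) := by gcongr
        _ < _ := by apply mul_lt_mul_of_pos_left hn; linarith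
    have h12 : 4 * π * θ = a0 * (δ / 2) := by rw [hθ]; field_simp; norm_num
    linarith
  have h13 : 8 * π * √(Real.exp 1) - δ / 2 ≤ 8 * π * M := by
    have h14 : δ' ≤ δ / (16 * π) := min_le_right _ _
    have h15 := (abs_le.1 l1).1
    have h16 : 8 * π * (√(Real.exp 1) - M) ≤ 8 * π * (δ / (16 * π)) := by gcongr; linarith
    have h17 : 8 * π * (δ / (16 * π)) = δ / 2 := by field_simp; norm_num
    linarith
  have h18 : a ≤ p * mb U p x1 (T * ε) := mul_le_mul_of_nonneg_left (h.mb_mono hrT) hp0.le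
  linarith

lemma log_one_add_div_K1 {ε s : ℝ} (hε : 0 < ε) (hs : 0 ≤ s) (z : E2) (hz : z ≠ 0) :
    Real.log (1 + s / ‖z‖) ≤ Real.log (1 + s / ε) + ε * K1 ε z := by
  have hz0 : 0 < ‖z‖ := norm_pos_iff.2 hz
  rcases lt_or_ge ‖z‖ ε with h | h
  · rw [K1_of_lt h]
    have h1 : 1 + s / ‖z‖ ≤ (1 + s / ε) * (ε / ‖z‖) := by
      have : (1 + s / ε) * (ε / ‖z‖) = ε / ‖z‖ + s / ‖z‖ := by field_simp
      rw [this]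
      have : 1 ≤ ε / ‖z‖ := by rw [le_div_iff₀ hz0]; linarith
      linarith
    have h2 := Real.log_le_log (by positivity) h1
    rw [Real.log_mul (by positivity) (by positivity)] at h2
    have h3 := Real.log_le_sub_one_of_pos (show 0 < ε / ‖z‖ by positivity)
    have h4 : ε / ‖z‖ = ε * ‖z‖⁻¹ := by ring
    linarith
  · have h1 : Real.log (1 + s / ‖z‖) ≤ Real.log (1 + s / ε) := by
      apply Real.log_le_log (by positivity)
      gcongr
    have := mul_nonneg hε.le (K1_nonneg ε z)
    linarith

namespace PD
variable {D p : ℝ} {U w : E2 → ℝ} {x1 : E2} {c R T : ℝ}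

lemma near (h : PD D p U w x1 c R) (hT : 1 ≤ T) {x : E2} (hs1 : 2 * (T * eps p (U x1)) ≤ ‖x - x1‖)
    (hs2 : ‖x - x1‖ ≤ R / 2) :
    mb U p x1 (T * eps p (U x1)) * Real.log (‖x - x1‖ / (2 * (T * eps p (U x1))))
      - ((∫ y, U y ^ p) - mb U p x1 (T * eps p (U x1))) * Real.log (1 + ‖x - x1‖ / eps p (U x1))
      - 2 * π * (U x1 / p) - 2 * (∫ y, U y ^ p) ≤ 2 * π * (U x1 - U x) := by
  have hR0 := h.R0
  have hp := h.hp0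
  have hε : 0 < eps p (U x1) := h.eps0
  set ε := eps p (U x1) with hεd
  set s := ‖x - x1‖ with hs
  set τ := T * ε with hτ
  have hτ0 : 0 < τ := by rw [hτ]; have : 0 < T := by linarith
                         positivity
  have hs0 : 0 < s := by linarith
  set l1 := Real.log (s / (2 * τ)) with hl1
  have hl1n : 0 ≤ l1 := Real.log_nonneg (by rw [le_div_iff₀ (by positivity)]; linarith)
  set l2 := Real.log (1 + s / ε) with hl2
  have hl2n : 0 ≤ l2 := Real.log_nonneg (by have : 0 ≤ s / ε := by positivity
                                            linarith)
  have iL := (Ker.log.integrable h.QBB x).sub (Ker.log.integrable h.QBB x1)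
  have iF := h.FBB.integrable
  have i1 := (h.F1BB' τ).integrable
  have iK : Integrable (fun y => K1 ε (x - y)) := (K1_integrable ε).comp_sub_left x
  have iQ := h.QBB.abs.integrable
  have j1 : Integrable (fun y => l1 * F1 U p x1 τ y) := i1.const_mul _
  have j2 : Integrable (fun y => l2 * (U y ^ p - F1 U p x1 τ y)) := (iF.sub i1).const_mul _
  have j3 : Integrable (fun y => ε * U x1 ^ p * K1 ε (x - y)) := iK.const_mul _
  have j4 : Integrable (fun y => 1 * |(- lap w y)|) := iQ.const_mul _
  have j12 : Integrable (fun y => l1 * F1 U p x1 τ y - l2 * (U y ^ p - F1 U p x1 τ y)) := j1.sub j2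
  have j123 : Integrable (fun y => l1 * F1 U p x1 τ y - l2 * (U y ^ p - F1 U p x1 τ y)
    - ε * U x1 ^ p * K1 ε (x - y)) := j12.sub j3
  have key : ∫ y, (l1 * F1 U p x1 τ y - l2 * (U y ^ p - F1 U p x1 τ y)
      - ε * U x1 ^ p * K1 ε (x - y) - 1 * |(- lap w y)|)
      ≤ ∫ y, (Real.log ‖x - y‖ * (- lap w y) - Real.log ‖x1 - y‖ * (- lap w y)) := by
    refine integral_mono_ae (j123.sub j4) iL ?_
    filter_upwards [ae_sub_ne x, ae_sub_ne x1] with y hy hy1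
    have a1 : 0 < ‖x - y‖ := norm_pos_iff.2 hy
    have a2 : 0 < ‖x1 - y‖ := norm_pos_iff.2 hy1
    have hK0 := K1_nonneg ε (x - y)
    have hMp : 0 ≤ U x1 ^ p := h.pow0 p x1
    have hF0 := h.pow0 p y
    have hFM := h.FM y
    have hQ0 := abs_nonneg (- lap w y)
    have t1 : ‖x1 - y‖ ≤ ‖x - y‖ + s := by
      have := norm_sub_le (x - y) (x - x1)
      rwa [sub_sub_sub_cancel_left] at this
    have t2 : ‖x - y‖ ≤ ‖x1 - y‖ + s := by
      have := norm_add_le (x - x1) (x1 - y)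
      rw [sub_add_sub_cancel] at this; linarith
    have t3 : s ≤ ‖x - y‖ + ‖x1 - y‖ := by
      have := norm_sub_le (x - y) (x1 - y)
      rwa [sub_sub_sub_cancel_right] at this
    rw [← sub_mul, ← Real.log_div a1.ne' a2.ne']
    have hsym : ‖y - x1‖ = ‖x1 - y‖ := norm_sub_rev _ _
    rcases lt_or_ge ‖y - x1‖ R with hyR | hyR
    · have hQF : - lap w y = U y ^ p := (h.loc y (by rw [mem_ball, dist_eq_norm]; exact hyR)).2
      rw [hQF, abs_of_nonneg hF0]
      rcases lt_or_ge ‖y - x1‖ τ with hyτ | hyτ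
      · have e1 : F1 U p x1 τ y = U y ^ p := F1_of y hyτ
        rw [e1, sub_self, mul_zero, sub_zero]
        have : l1 ≤ Real.log (‖x - y‖ / ‖x1 - y‖) := by
          apply Real.log_le_log (by positivity)
          rw [div_le_div_iff₀ (by positivity) a2]
          nlinarith
        have g1 := mul_le_mul_of_nonneg_right this hF0
        have g2 : 0 ≤ ε * U x1 ^ p * K1 ε (x - y) := by positivity
        linarith
      · have e1 : F1 U p x1 τ y = 0 := F1_out y hyτ
        rw [e1, mul_zero, sub_zero, zero_sub]
        have b1 : -Real.log (1 + s / ‖x - y‖) ≤ Real.log (‖x - y‖ / ‖x1 - y‖) := by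
          rw [← Real.log_inv]
          apply Real.log_le_log (by positivity)
          rw [← one_div, div_le_div_iff₀ (by positivity) a2]
          have : ‖x - y‖ * (1 + s / ‖x - y‖) = ‖x - y‖ + s := by field_simp
          linarith
        have b2 := log_one_add_div_K1 hε hs0.le (x - y) hy
        have b3 : -(l2 + ε * K1 ε (x - y)) ≤ Real.log (‖x - y‖ / ‖x1 - y‖) := by linarith
        have g1 := mul_le_mul_of_nonneg_right b3 hF0
        have g2 : ε * K1 ε (x - y) * U y ^ p ≤ ε * K1 ε (x - y) * U x1 ^ p :=
          mul_le_mul_of_nonneg_left hFM (by positivity)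
        linarith
    · have e1 : F1 U p x1 τ y = 0 := F1_out y (by linarith)
      rw [e1, mul_zero, sub_zero, zero_sub]
      have b1 : |Real.log (‖x - y‖ / ‖x1 - y‖)| ≤ 1 := by
        have l2e : Real.log 2 ≤ 1 := by linarith [Real.log_two_lt_d9]
        rw [abs_le]
        constructor
        · rw [← neg_neg (Real.log _), ← Real.log_inv]
          apply neg_le_neg
          refine le_trans (Real.log_le_log (by positivity) ?_) l2e
          rw [inv_div, div_le_iff₀ a1]
          linarith
        · refine le_trans (Real.log_le_log (by positivity) ?_) l2e
          rw [div_le_iff₀ a2]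
          linarith
      have g1 : |Real.log (‖x - y‖ / ‖x1 - y‖) * (- lap w y)| ≤ 1 * |(- lap w y)| := by
        rw [abs_mul]; exact mul_le_mul_of_nonneg_right b1 hQ0
      have g2 := (abs_le.1 g1).1
      have g3 : 0 ≤ l2 * U y ^ p := by positivity
      have g4 : 0 ≤ ε * U x1 ^ p * K1 ε (x - y) := by positivity
      linarith
  rw [integral_sub j123 j4, integral_sub j12 j3, integral_sub j1 j2, integral_const_mul,
    integral_const_mul, integral_const_mul, integral_const_mul, integral_sub iF i1,
    integral_sub_left_eq_self (fun y => K1 ε y) volume x, K1_integral hε.le, F1_int,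
    integral_sub (Ker.log.integrable h.QBB x) (Ker.log.integrable h.QBB x1)] at key
  have r1 := rep1 h.w2 h.hc x
  have r2 := rep1 h.w2 h.hc x1
  have hwx : w x = U x - c := (h.loc x (by rw [mem_ball, dist_eq_norm]; linarith)).1
  have hwx1 := h.wx1
  have hQa := h.Q_abs
  have hes := eps_sq hp h.M0
  have hpi := Real.pi_pos
  have e1 : ε * U x1 ^ p * (2 * π * ε) = 2 * π * (U x1 / p) := by rw [← hes]; ring
  rw [e1] at key
  have e2 : 2 * π * (U x1 - U x) = (∫ y, Real.log ‖x - y‖ * (- lap w y))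
      - ∫ y, Real.log ‖x1 - y‖ * (- lap w y) := by
    have : U x1 - U x = w x1 - w x := by rw [hwx, hwx1]; ring
    rw [this, r1, r2]
    field_simp
    ring
  rw [e2]
  linarith

lemma far (h : PD D p U w x1 c R) (hT : 1 ≤ T) {x : E2} (hs1 : 2 * (T * eps p (U x1)) ≤ R / 2)
    (hs2 : R / 2 ≤ ‖x - x1‖) (hx : U x ≠ 0) :
    2 * π * U x ≤ |Real.log (4 * D / R)| * (∫ y, U y ^ p)
      + Real.log (D / eps p (U x1)) * ((∫ y, U y ^ p) - mb U p x1 (T * eps p (U x1)))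
      + 2 * π * (U x1 / p) + 2 * π / p := by
  have hR0 := h.R0
  have hp := h.hp0
  have hD := h.hD0
  have hε : 0 < eps p (U x1) := h.eps0
  set ε := eps p (U x1) with hεd
  set τ := T * ε with hτ
  have hτ0 : 0 < τ := by rw [hτ]; have : 0 < T := by linarith
                         positivity
  have hw := h.w_le (h.Us x hx).le
  have iF := h.FBB.integrable
  have i1 := (h.F1BB' τ).integrable
  have hGB : BB (fun y => U y ^ p - F1 U p x1 τ y) := h.FBB.sub (h.F1BB' τ)
  have k1 := (Ker.log_div hD).integrable (h.F1BB' τ) x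
  have k2 := (Ker.log_div hD).integrable hGB x
  have hsp : ∫ y, Real.log (D / ‖x - y‖) * U y ^ p
      = (∫ y, Real.log (D / ‖x - y‖) * F1 U p x1 τ y)
        + ∫ y, Real.log (D / ‖x - y‖) * (U y ^ p - F1 U p x1 τ y) := by
    rw [← integral_add k1 k2]
    congr 1; ext y; ring
  have hb := bathtub hGB (fun y => by linarith [h.F1_le' τ y]) (A := U x1 ^ p)
    (fun y => by linarith [h.F1_nonneg' τ y, h.FM y]) hε hD x
  rw [integral_sub iF i1, F1_int] at hb
  have ha : ∫ y, Real.log (D / ‖x - y‖) * F1 U p x1 τ y ≤ |Real.log (4 * D / R)| * ∫ y, U y ^ p := by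
    rw [← integral_const_mul]
    refine integral_mono k1 (iF.const_mul _) fun y => ?_
    simp only
    rcases lt_or_ge ‖y - x1‖ τ with hy | hy
    · have e1 : F1 U p x1 τ y = U y ^ p := F1_of y hy
      rw [e1]
      apply mul_le_mul_of_nonneg_right _ (h.pow0 p y)
      have t3 : ‖x - x1‖ ≤ ‖x - y‖ + ‖y - x1‖ := by
        have := norm_add_le (x - y) (y - x1)
        rwa [sub_add_sub_cancel] at this
      have a1 : R / 4 ≤ ‖x - y‖ := by linarith
      have a2 : 0 < ‖x - y‖ := by linarith
      refine le_trans (Real.log_le_log (by positivity) ?_) (le_abs_self _)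
      rw [div_le_div_iff₀ a2 hR0]
      nlinarith
    · have e1 : F1 U p x1 τ y = 0 := F1_out y hy
      rw [e1, mul_zero]
      exact mul_nonneg (abs_nonneg _) (h.pow0 p y)
  have hes := eps_sq hp h.M0
  have e3 : 2 * π * ε ^ 2 * U x1 ^ p = 2 * π * (U x1 / p) := by rw [← hes]; ring
  rw [e3] at hb
  have hUw := h.Uw x
  have hcp := h.cp
  have hpi := Real.pi_pos
  have f1 : 2 * π * w x ≤ ∫ y, Real.log (D / ‖x - y‖) * U y ^ p := by
    have := mul_le_mul_of_nonneg_left hw (show 0 ≤ 2 * π by positivity)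
    refine this.trans (le_of_eq ?_)
    field_simp
  have f2 : 2 * π * U x ≤ 2 * π * w x + 2 * π / p := by
    have : 2 * π * U x ≤ 2 * π * (w x + 1 / p) := by gcongr; linarith
    refine this.trans (le_of_eq ?_)
    ring
  linarith
end PD

set_option maxHeartbeats 1000000 in
/-- Pointwise decay of the solutions. -/
lemma decay (D : ℝ) {R : ℝ} (hR : 0 < R) :
    ∃ κ > 0, κ ≤ 1 ∧ ∃ C ≥ 0, ∀ᶠ p : ℝ in atTop, ∀ (U w : E2 → ℝ) (x1 : E2) (c : ℝ),
    PD D p U w x1 c R → p * ∫ x, U x ^ (p + 1) ≤ 8 * π * Real.exp 1 + κ →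
    (3 / 2 ≤ U x1 ∧ U x1 ≤ 2 ∧ p * (∫ x, U x ^ p) ≤ 45 ∧ eps p (U x1) ^ 2 ≤ 1 / p) ∧
    (38 ≤ p * ∫ x, U x ^ p) ∧
    (∀ x, ‖x - x1‖ ≤ R / 2 →
      7 / 2 * Real.log (1 + ‖x - x1‖ / eps p (U x1)) - C ≤ p * (U x1 - U x) / U x1) ∧
    (∀ x, R / 2 ≤ ‖x - x1‖ → U x ≤ 1 / 2) := by
  have hpi := Real.pi_gt_three
  have hpi0 := Real.pi_pos
  have hpi2 := Real.pi_lt_d2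
  obtain ⟨hq1, hq2⟩ := q_bounds
  have hten : (0:ℝ) < 1 / 10 := by norm_num
  obtain ⟨κ1, hκ1, hκ11, e1⟩ := basic_bd D
  obtain ⟨κ2, hκ2, hκ21, e2⟩ := limits D hten
  obtain ⟨κ3, hκ3, hκ31, T, hT, e3⟩ := scale D hR hten
  have hl4 : 0 ≤ Real.log (4 * T) := Real.log_nonneg (by linarith)
  set C : ℝ := 45 * Real.log (4 * T) + 110 with hC
  refine ⟨min κ1 (min κ2 κ3), lt_min hκ1 (lt_min hκ2 hκ3), (min_le_left _ _).trans hκ11, C,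
    by linarith, ?_⟩
  have el : ∀ᶠ p : ℝ in atTop, Real.log p ≤ p := by
    filter_upwards [eventually_gt_atTop 0] with p hp
    linarith [Real.log_le_sub_one_of_pos hp]
  filter_upwards [e1, e2, e3, el, eventually_ge_atTop 20, eventually_ge_atTop (45 * |Real.log (4 * D / R)|),
    eventually_ge_atTop |Real.log D|, eventually_ge_atTop ((4 * T / R) ^ 2)]
    with p g1 g2 g3 hlp hp20 hpR hpD hpT U w x1 c h hE
  have m1 := min_le_left κ1 (min κ2 κ3)
  have m2 := (min_le_right κ1 (min κ2 κ3)).trans (min_le_left _ _)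
  have m3 := (min_le_right κ1 (min κ2 κ3)).trans (min_le_right _ _)
  have b1 := g1 U w x1 c R h (hE.trans (by linarith))
  obtain ⟨l1, l2, -⟩ := g2 U w x1 c R h (hE.trans (by linarith))
  have l3 := g3 U w x1 c h (hE.trans (by linarith))
  refine ⟨b1, ?_⟩
  obtain ⟨hM1, hM2, hm, he⟩ := b1
  have hp0 := h.hp0
  have hε : 0 < eps p (U x1) := h.eps0
  have hnear := fun x => h.near hT (x := x)
  have hfar := fun x => h.far hT (x := x)
  have hmb := h.mb_le (T * eps p (U x1))
  have hmb0 := h.mb_nonneg (T * eps p (U x1))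
  have hm0 := h.m0
  have hel := eps_log hp0 h.M0 h.hD0
  set q := √(Real.exp 1) with hq
  set M := U x1 with hMd
  set ε := eps p M with hεd
  set m := ∫ x, U x ^ p with hmd
  set b := mb U p x1 (T * ε) with hbd
  have hT0 : 0 < T := by linarith
  have hTR : 2 * (T * ε) ≤ R / 2 := by
    have h1 : (4 * T / R * ε) ^ 2 ≤ 1 := by
      rw [mul_pow]
      calc (4 * T / R) ^ 2 * ε ^ 2 ≤ p * (1 / p) := by gcongr
        _ = 1 := by field_simp
    have h2 : 4 * T / R * ε ≤ 1 := by
      rw [← abs_of_pos (show 0 < 4 * T / R * ε by positivity)]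
      exact abs_le_one_iff_mul_self_le_one.2 (by rw [← pow_two]; exact h1)
    have h3 : 4 * T / R * ε = 4 * (T * ε) / R := by ring
    rw [h3, div_le_one hR] at h2
    linarith
  have hqπ : 38.4 ≤ 8 * π * q := by
    have := mul_le_mul hpi.le hq1.le (by norm_num) hpi0.le
    linarith
  have hqπ2 : 8 * π * q ≤ 42 := by
    have := mul_le_mul hpi2.le hq2.le (by linarith) (by norm_num)
    linarith
  rw [abs_le] at l1 l2
  have hmb2 : p * (m - b) ≤ 1 / 5 := by linarith
  have hmb3 : 0 ≤ p * (m - b) := mul_nonneg hp0.le (by linarith)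
  have hpi3 := Real.pi_gt_d2
  refine ⟨by linarith [l2.1], fun x hx => ?_, fun x hx => ?_⟩
  · have hMp : 0 < M := h.M0
    have hMU : 0 ≤ p * (M - U x) := mul_nonneg hp0.le (by linarith [h.UM x])
    rcases lt_or_ge ‖x - x1‖ (2 * (T * ε)) with hs | hs
    · have f1 : Real.log (1 + ‖x - x1‖ / ε) ≤ Real.log (4 * T) := by
        apply Real.log_le_log (by positivity)
        have : ‖x - x1‖ / ε ≤ 2 * T := by
          rw [div_le_iff₀ hε]; linarith
        linarith
      have f2 : 0 ≤ p * (M - U x) / M := by positivity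
      linarith
    · have hN := hnear x hs hx
      set s := ‖x - x1‖ with hsd
      have hs0 : 0 < s := by have : 0 < T * ε := by positivity
                             linarith
      set lA := Real.log (s / (2 * (T * ε))) with hlA
      set lB := Real.log (1 + s / ε) with hlB
      have hlB0 : 0 ≤ lB := Real.log_nonneg (by have : 0 ≤ s / ε := by positivity
                                                linarith)
      have hlA0 : 0 ≤ lA := Real.log_nonneg (by rw [le_div_iff₀ (by positivity)]; linarith)
      have hAB : lB - Real.log (4 * T) ≤ lA := by
        have h1 : 1 + s / ε ≤ (4 * T) * (s / (2 * (T * ε))) := by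
          have : (4 * T) * (s / (2 * (T * ε))) = 2 * (s / ε) := by field_simp; norm_num
          rw [this]
          have : 1 ≤ s / ε := by
            rw [le_div_iff₀ hε]
            have := mul_le_mul_of_nonneg_right hT hε.le
            linarith
          linarith
        have h2 := Real.log_le_log (by positivity) h1
        rw [Real.log_mul (by positivity) (by positivity)] at h2
        linarith
      have hpN := mul_le_mul_of_nonneg_left hN hp0.le
      have x1e : p * (b * lA - (m - b) * lB - 2 * π * (M / p) - 2 * m)
          = (p * b) * lA - (p * (m - b)) * lB - 2 * π * M - 2 * (p * m) := by field_simp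
      have x2e : p * (2 * π * (M - U x)) = 2 * π * (p * (M - U x)) := by ring
      rw [x1e, x2e] at hpN
      have y1 : (8 * π * q - 1 / 10) * lA ≤ (p * b) * lA := mul_le_mul_of_nonneg_right l3 hlA0
      have y2 : (8 * π * q - 1 / 10) * (lB - Real.log (4 * T)) ≤ (8 * π * q - 1 / 10) * lA :=
        mul_le_mul_of_nonneg_left hAB (by linarith)
      have y3 : (p * (m - b)) * lB ≤ 1 / 5 * lB := mul_le_mul_of_nonneg_right hmb2 hlB0
      have y4 : (8 * π * q - 1 / 10) * Real.log (4 * T) ≤ 45 * Real.log (4 * T) :=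
        mul_le_mul_of_nonneg_right (by linarith) hl4
      have y5 : 2 * π * M ≤ 2 * 3.15 * 2 := by gcongr
      have y6 : 2 * π * (7 / 2) * M ≤ 8 * π * q - 3 / 10 := by
        have : 2 * π * (7 / 2) * M ≤ 2 * π * (7 / 2) * (q + 1 / 10) := by gcongr; linarith
        have h2 := mul_le_mul_of_nonneg_left hq1.le hpi0.le
        linarith
      have y7 := mul_le_mul_of_nonneg_right y6 hlB0
      have y8 : C ≤ 2 * π * C * M := by
        have h1 : 1 ≤ 2 * π * M := by
          have := mul_le_mul hpi.le hM1 (by norm_num) hpi0.le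
          linarith
        have h2 : 0 ≤ C := by linarith
        have h3 := mul_le_mul_of_nonneg_right h1 h2
        linarith
      have y9 : 2 * π * ((7 / 2 * lB - C) * M) ≤ 2 * π * (p * (M - U x)) := by
        have e1 : 2 * π * ((7 / 2 * lB - C) * M) = (2 * π * (7 / 2) * M) * lB - 2 * π * C * M := by ring
        rw [e1]
        rw [mul_sub (8 * π * q - 1 / 10)] at y2
        have e2 : (8 * π * q - 3 / 10) * lB = (8 * π * q - 1 / 10) * lB - 1 / 5 * lB := by ring
        rw [e2] at y7
        linarith only [y1, y2, y3, y4, y5, y7, y8, hpN, hm, hC]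
      rw [le_div_iff₀ hMp]
      exact le_of_mul_le_mul_left y9 (by positivity)
  · by_cases hx0 : U x = 0
    · rw [hx0]; norm_num
    have hF := hfar x hTR hx hx0
    have z1 : |Real.log (4 * D / R)| * m ≤ 1 := by
      have : p * (|Real.log (4 * D / R)| * m) ≤ p * 1 := by
        calc p * (|Real.log (4 * D / R)| * m) = |Real.log (4 * D / R)| * (p * m) := by ring
          _ ≤ |Real.log (4 * D / R)| * 45 := by gcongr
          _ ≤ p * 1 := by linarith
      exact le_of_mul_le_mul_left this hp0
    have z2 : Real.log (D / ε) ≤ 2 * p := by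
      rw [hel]
      have hlM : Real.log M ≤ 1 := by linarith [Real.log_le_sub_one_of_pos h.M0]
      have : (p - 1) * Real.log M ≤ (p - 1) * 1 := by gcongr; linarith [h.hp]
      have := le_abs_self (Real.log D)
      linarith
    have z3 : Real.log (D / ε) * (m - b) ≤ 2 / 5 := by
      calc Real.log (D / ε) * (m - b) ≤ (2 * p) * (m - b) :=
            mul_le_mul_of_nonneg_right z2 (by linarith)
        _ = 2 * (p * (m - b)) := by ring
        _ ≤ _ := by linarith
    have z4 : 2 * π * (M / p) ≤ 2 * 3.15 * (2 / 20) := by gcongr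
    have z5 : 2 * π / p ≤ 2 * 3.15 / 20 := by gcongr
    have z6 : 2 * π * U x ≤ 2 * π * (1 / 2) := by linarith
    exact le_of_mul_le_mul_left z6 (by positivity)

/-- A universal constant. -/
def cW : ℝ := ∫ x : E2, (1 + ‖x‖) ^ (-(5 / 2) : ℝ)

lemma cW_nonneg : 0 ≤ cW := integral_nonneg fun x => by positivity

lemma W_int {ε : ℝ} (hε : 0 < ε) (x1 : E2) :
    Integrable (fun x : E2 => (1 + ‖x - x1‖ / ε) ^ (-(5 / 2) : ℝ)) ∧
    ∫ x : E2, (1 + ‖x - x1‖ / ε) ^ (-(5 / 2) : ℝ) = ε ^ 2 * cW := by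
  have h0 : Integrable (fun x : E2 => (1 + ‖x‖) ^ (-(5 / 2) : ℝ)) :=
    integrable_one_add_norm (by simp; norm_num)
  have e : ∀ x : E2, (1 + ‖x - x1‖ / ε) ^ (-(5 / 2) : ℝ)
      = (1 + ‖ε⁻¹ • (x - x1)‖) ^ (-(5 / 2) : ℝ) := by
    intro x
    rw [norm_smul, Real.norm_eq_abs, abs_of_pos (inv_pos.2 hε), div_eq_inv_mul]
  simp only [e]
  constructor
  · exact (h0.comp_smul (inv_ne_zero hε.ne')).comp_sub_right x1
  · rw [integral_sub_right_eq_self (fun x : E2 => (1 + ‖ε⁻¹ • x‖) ^ (-(5 / 2) : ℝ)) x1,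
      Measure.integral_comp_inv_smul_of_nonneg volume (fun x : E2 => (1 + ‖x‖) ^ (-(5 / 2) : ℝ)) hε.le]
    simp [cW]

namespace PD
variable {D p : ℝ} {U w : E2 → ℝ} {x1 : E2} {c R : ℝ} {C : ℝ}

lemma F_exp (h : PD D p U w x1 c R) (x : E2) :
    U x ^ p ≤ U x1 ^ p * Real.exp (-(p * (U x1 - U x) / U x1)) := by
  have hM := h.M0
  have hp := h.hp0
  have h1 : U x ≤ U x1 * Real.exp (-((U x1 - U x) / U x1)) := by
    have := Real.add_one_le_exp (-((U x1 - U x) / U x1))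
    calc U x = U x1 * (-((U x1 - U x) / U x1) + 1) := by field_simp; ring
      _ ≤ _ := by gcongr
  calc U x ^ p ≤ (U x1 * Real.exp (-((U x1 - U x) / U x1))) ^ p :=
        Real.rpow_le_rpow (h.U0 x) h1 hp.le
    _ = _ := by
      rw [Real.mul_rpow hM.le (Real.exp_pos _).le, ← Real.exp_mul]
      congr 2; ring

lemma F_pt (h : PD D p U w x1 c R) (hC : 0 ≤ C) {x : E2}
    (hd : 7 / 2 * Real.log (1 + ‖x - x1‖ / eps p (U x1)) - C ≤ p * (U x1 - U x) / U x1) :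
    U x ^ p * (‖x - x1‖ / eps p (U x1)) ≤
      U x1 ^ p * Real.exp C * (1 + ‖x - x1‖ / eps p (U x1)) ^ (-(5 / 2) : ℝ) ∧
    U x ^ p * (U x1 - U x) ≤
      7 / 2 * (U x1 / p) * (U x1 ^ p * Real.exp C * (1 + ‖x - x1‖ / eps p (U x1)) ^ (-(5 / 2) : ℝ)) := by
  have hM := h.M0
  have hp := h.hp0
  have hε : 0 < eps p (U x1) := h.eps0
  have hF := h.F_exp x
  have hUM := h.UM x
  have hMp : 0 < U x1 ^ p := by positivity
  set τ := 1 + ‖x - x1‖ / eps p (U x1) with hτ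
  set y := p * (U x1 - U x) / U x1 with hy
  have hs : 0 ≤ ‖x - x1‖ / eps p (U x1) := by positivity
  have hτ0 : 0 < τ := by linarith
  have hy0 : 0 ≤ y := by rw [hy]; apply div_nonneg (mul_nonneg hp.le (by linarith)) hM.le
  have hτe : τ ^ (-(5 / 2) : ℝ) = Real.exp (-(5 / 2 * Real.log τ)) := by
    rw [Real.rpow_def_of_pos hτ0]; congr 1; ring
  have hτe2 : τ = Real.exp (Real.log τ) := (Real.exp_log hτ0).symm
  constructor
  · calc U x ^ p * (‖x - x1‖ / eps p (U x1)) ≤ (U x1 ^ p * Real.exp (-y)) * τ := by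
          apply mul_le_mul hF (by linarith) hs (by positivity)
      _ ≤ (U x1 ^ p * Real.exp (C - 7 / 2 * Real.log τ)) * Real.exp (Real.log τ) := by
          rw [← hτe2]; gcongr; linarith
      _ = _ := by
          rw [hτe, mul_assoc, mul_assoc, ← Real.exp_add, ← Real.exp_add]; congr 2; ring
  · have e1 : U x1 - U x = U x1 / p * y := by rw [hy]; field_simp
    have e2 : y ≤ 7 / 2 * Real.exp (2 / 7 * y) := by
      have := Real.add_one_le_exp (2 / 7 * y)
      linarith
    calc U x ^ p * (U x1 - U x) ≤ (U x1 ^ p * Real.exp (-y)) * (U x1 / p * (7 / 2 * Real.exp (2 / 7 * y))) := by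
          rw [e1]
          apply mul_le_mul hF _ (by positivity) (by positivity)
          gcongr
      _ = 7 / 2 * (U x1 / p) * (U x1 ^ p * Real.exp (-y + 2 / 7 * y)) := by rw [Real.exp_add]; ring
      _ ≤ 7 / 2 * (U x1 / p) * (U x1 ^ p * Real.exp (C + -(5 / 2 * Real.log τ))) := by
          have : Real.exp (-y + 2 / 7 * y) ≤ Real.exp (C + -(5 / 2 * Real.log τ)) :=
            Real.exp_le_exp.2 (by linarith)
          gcongr
      _ = _ := by rw [hτe, Real.exp_add]; ring

lemma ints_out (h : PD D p U w x1 c R) (hf : ∀ x, R / 2 ≤ ‖x - x1‖ → U x ≤ 1 / 2) :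
    (∫ x, U x ^ p) - mb U p x1 (R / 2) ≤ (1 / 2) ^ p * (π * D ^ 2) := by
  have hD := h.hD0
  have hp := h.hp0
  have e : (∫ x, U x ^ p) - mb U p x1 (R / 2) = ∫ x in (ball x1 (R / 2))ᶜ, U x ^ p := by
    rw [← integral_add_compl measurableSet_ball h.FBB.integrable (s := ball x1 (R / 2))]
    unfold mb; ring
  rw [e, ← integral_indicator measurableSet_ball.compl]
  have hi : Integrable ((ball (0:E2) D).indicator (fun _ => ((1 / 2) ^ p : ℝ))) := by
    rw [integrable_indicator_iff measurableSet_ball]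
    exact integrableOn_const measure_ball_lt_top.ne
  calc _ ≤ ∫ x, (ball (0:E2) D).indicator (fun _ => ((1 / 2) ^ p : ℝ)) x := by
        apply integral_mono (h.FBB.integrable.indicator measurableSet_ball.compl) hi
        intro x
        by_cases hx : x ∈ (ball x1 (R / 2))ᶜ
        · rw [Set.indicator_of_mem hx]
          rw [Set.mem_compl_iff, mem_ball, dist_eq_norm, not_lt] at hx
          by_cases h0 : U x ^ p = 0
          · rw [h0]; exact Set.indicator_nonneg (fun _ _ => by positivity) _
          · have := h.Us x (h.pow_ne hp h0)
            rw [Set.indicator_of_mem (by rw [mem_ball_zero_iff]; linarith)]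
            exact Real.rpow_le_rpow (h.U0 x) (hf x hx) hp.le
        · rw [Set.indicator_of_notMem hx]; exact Set.indicator_nonneg (fun _ _ => by positivity) _
    _ = _ := by
      rw [integral_indicator measurableSet_ball, setIntegral_const, vol_ball _ hD.le, smul_eq_mul]
      ring

lemma ints (h : PD D p U w x1 c R) (hC : 0 ≤ C)
    (hd : ∀ x, ‖x - x1‖ ≤ R / 2 →
      7 / 2 * Real.log (1 + ‖x - x1‖ / eps p (U x1)) - C ≤ p * (U x1 - U x) / U x1) :
    ∫ x in ball x1 (R / 2), U x ^ p * (‖x - x1‖ / eps p (U x1)) ≤ Real.exp C * cW * (U x1 / p) ∧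
    ∫ x, U x ^ p * (U x1 - U x) ≤ 7 / 2 * (U x1 / p) * (Real.exp C * cW * (U x1 / p))
      + U x1 * ((∫ x, U x ^ p) - mb U p x1 (R / 2)) := by
  have hM := h.M0
  have hp := h.hp0
  have hε : 0 < eps p (U x1) := h.eps0
  obtain ⟨w1, w2⟩ := W_int hε x1
  set G : E2 → ℝ := fun x => U x1 ^ p * Real.exp C * (1 + ‖x - x1‖ / eps p (U x1)) ^ (-(5 / 2) : ℝ) with hG
  have hGi : Integrable G := w1.const_mul _
  have hG0 : ∀ x, 0 ≤ G x := fun x => by simp only [hG]; positivity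
  have hGint : ∫ x, G x = Real.exp C * cW * (U x1 / p) := by
    simp only [hG]
    rw [integral_const_mul, w2, ← eps_sq hp hM]; ring
  have hpt := fun x (hx : x ∈ ball x1 (R / 2)) => h.F_pt hC (x := x)
    (hd x (by rw [mem_ball, dist_eq_norm] at hx; exact hx.le))
  have hG1 := setIntegral_le_integral (s := ball x1 (R / 2)) hGi (Eventually.of_forall hG0)
  constructor
  · rw [← hGint]
    refine le_trans ?_ hG1
    apply setIntegral_mono_on _ hGi.integrableOn measurableSet_ball (fun x hx => (hpt x hx).1)
    have : Continuous fun x => U x ^ p * (‖x - x1‖ / eps p (U x1)) :=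
      (h.powc hp).mul (by fun_prop)
    exact (this.continuousOn.integrableOn_compact (isCompact_closedBall x1 (R / 2))).mono_set
      ball_subset_closedBall
  · rw [← integral_add_compl measurableSet_ball h.FMU_BB.integrable (s := ball x1 (R / 2))]
    apply add_le_add
    · rw [← hGint]
      refine le_trans (setIntegral_mono_on h.FMU_BB.integrable.integrableOn
        (hGi.const_mul (7 / 2 * (U x1 / p))).integrableOn measurableSet_ball
        (fun x hx => (hpt x hx).2)) ?_
      rw [integral_const_mul]
      gcongr
    · have e : (∫ x, U x ^ p) - mb U p x1 (R / 2) = ∫ x in (ball x1 (R / 2))ᶜ, U x ^ p := by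
        rw [← integral_add_compl measurableSet_ball h.FBB.integrable (s := ball x1 (R / 2))]
        unfold mb; ring
      rw [e, ← integral_const_mul]
      apply setIntegral_mono_on h.FMU_BB.integrable.integrableOn
        (h.FBB.integrable.const_mul _).integrableOn measurableSet_ball.compl
      intro x _
      rw [mul_comm (U x1)]
      exact mul_le_mul_of_nonneg_left (by linarith [h.U0 x]) (h.pow0 p x)

end PD

lemma half_pow_small : ∀ᶠ p : ℝ in atTop, p * (p * (1 / 2 : ℝ) ^ p) ≤ 1 := by
  have h := tendsto_rpow_mul_exp_neg_mul_atTop_nhds_zero 2 (Real.log 2) (Real.log_pos (by norm_num))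
  filter_upwards [h.eventually (eventually_le_nhds (show (0:ℝ) < 1 by norm_num))] with p hp
  rw [Real.rpow_two] at hp
  have e : (1 / 2 : ℝ) ^ p = Real.exp (-Real.log 2 * p) := by
    rw [Real.rpow_def_of_pos (by norm_num), one_div, Real.log_inv]
  rw [e]; linarith

lemma pow_large : ∀ᶠ p : ℝ in atTop, p ≤ (3 / 2 : ℝ) ^ (p - 1) := by
  have h := p_exp_tendsto (k := Real.log (3 / 2)) (Real.log_pos (by norm_num))
  filter_upwards [h.eventually (eventually_le_nhds (show (0:ℝ) < 2 / 3 by norm_num))] with p hp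
  rw [Real.exp_neg, ← div_eq_mul_inv, div_le_iff₀ (Real.exp_pos _)] at hp
  rw [Real.rpow_sub_one (by norm_num), Real.rpow_def_of_pos (by norm_num)]
  linarith

lemma eps_small {p M : ℝ} (hp : 0 < p) (hM : 3 / 2 ≤ M) (hp1 : 1 < p) (h : p ≤ (3 / 2 : ℝ) ^ (p - 1)) :
    p * eps p M ≤ 1 := by
  unfold eps
  have h1 : p ≤ M ^ (p - 1) := h.trans (Real.rpow_le_rpow (by norm_num) hM (by linarith))
  have h2 : p ≤ √(p * M ^ (p - 1)) := by
    apply Real.le_sqrt_of_sq_le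
    rw [pow_two]; gcongr
  rw [← div_eq_mul_inv, div_le_one (hp.trans_le h2)]
  exact h2

/-- All quantitative consequences of the decay. -/
lemma bounds (D : ℝ) {R : ℝ} (hR : 0 < R) :
    ∃ κ > 0, κ ≤ 1 ∧ ∃ C ≥ 0, ∀ᶠ p : ℝ in atTop, ∀ (U w : E2 → ℝ) (x1 : E2) (c : ℝ),
    PD D p U w x1 c R → p * ∫ x, U x ^ (p + 1) ≤ 8 * π * Real.exp 1 + κ →
    (3 / 2 ≤ U x1 ∧ U x1 ≤ 2 ∧ p * (∫ x, U x ^ p) ≤ 45 ∧ 38 ≤ p * ∫ x, U x ^ p) ∧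
    p * eps p (U x1) ≤ 1 ∧
    p * (∫ x in ball x1 (R / 2), U x ^ p * (‖x - x1‖ / eps p (U x1))) ≤ C ∧
    p * (p * ∫ x, U x ^ p * (U x1 - U x)) ≤ C ∧
    p * (p * ((∫ x, U x ^ p) - mb U p x1 (R / 2))) ≤ C := by
  obtain ⟨κ, hκ, hκ1, C, hC, e⟩ := decay D hR
  have hcW := cW_nonneg
  have hpi := Real.pi_pos
  refine ⟨κ, hκ, hκ1, 14 * (Real.exp C * cW) + 2 * (π * D ^ 2), by positivity, ?_⟩
  filter_upwards [e, half_pow_small, pow_large] with p g hp2 hp3 U w x1 c h hE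
  obtain ⟨⟨b1, b2, b3, -⟩, b4, hd, hf⟩ := g U w x1 c h hE
  have hp0 := h.hp0
  obtain ⟨i1, i2⟩ := h.ints hC hd
  have i3 := h.ints_out hf
  set J := Real.exp C * cW with hJ
  have hJ0 : 0 ≤ J := by positivity
  have hJM : J * U x1 ≤ J * 2 := mul_le_mul_of_nonneg_left b2 hJ0
  have hS0 : 0 ≤ π * D ^ 2 := by positivity
  have k3 : p * (p * ((∫ x, U x ^ p) - mb U p x1 (R / 2))) ≤ π * D ^ 2 := by
    calc p * (p * ((∫ x, U x ^ p) - mb U p x1 (R / 2))) ≤ p * (p * ((1 / 2) ^ p * (π * D ^ 2))) := by gcongr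
      _ = (p * (p * (1 / 2) ^ p)) * (π * D ^ 2) := by ring
      _ ≤ 1 * (π * D ^ 2) := by gcongr
      _ = _ := one_mul _
  refine ⟨⟨b1, b2, b3, b4⟩, eps_small hp0 b1 h.hp hp3, ?_, ?_, by linarith⟩
  · calc _ ≤ p * (J * (U x1 / p)) := by gcongr
      _ = J * U x1 := by field_simp
      _ ≤ _ := by linarith
  · have hM := h.M0
    have k4 : p * (p * (U x1 * ((∫ x, U x ^ p) - mb U p x1 (R / 2)))) ≤ 2 * (π * D ^ 2) := by
      calc _ = U x1 * (p * (p * ((∫ x, U x ^ p) - mb U p x1 (R / 2)))) := by ring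
        _ ≤ 2 * (π * D ^ 2) :=
          mul_le_mul b2 k3 (mul_nonneg hp0.le (mul_nonneg hp0.le (by linarith [h.mb_le (R / 2)]))) (by norm_num)
    have k5 : J * (U x1 * U x1) ≤ J * (2 * 2) := by gcongr
    calc _ ≤ p * (p * (7 / 2 * (U x1 / p) * (J * (U x1 / p))
      + U x1 * ((∫ x, U x ^ p) - mb U p x1 (R / 2)))) := by gcongr
      _ = 7 / 2 * (J * (U x1 * U x1)) + p * (p * (U x1 * ((∫ x, U x ^ p) - mb U p x1 (R / 2)))) := by
        field_simp
      _ ≤ _ := by linarith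

namespace PD
variable {D p : ℝ} {U w : E2 → ℝ} {x1 : E2} {c R : ℝ}

lemma tail_r (h : PD D p U w x1 c R) {r : ℝ} (hr : 0 < r) (hrR : r ≤ R / 2) :
    mb U p x1 (R / 2) - mb U p x1 r ≤
      eps p (U x1) / r * ∫ x in ball x1 (R / 2), U x ^ p * (‖x - x1‖ / eps p (U x1)) := by
  have hε : 0 < eps p (U x1) := h.eps0
  have hi := fun s => (h.F1BB' s).integrable
  have hcont : Continuous fun x => U x ^ p * (‖x - x1‖ / eps p (U x1)) :=
    (h.powc h.hp0).mul (by fun_prop)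
  have hci : IntegrableOn (fun x => U x ^ p * (‖x - x1‖ / eps p (U x1))) (ball x1 (R / 2)) :=
    (hcont.continuousOn.integrableOn_compact (isCompact_closedBall x1 (R / 2))).mono_set
      ball_subset_closedBall
  rw [← F1_int, ← F1_int, ← integral_sub (hi _) (hi _), ← integral_const_mul,
    ← integral_indicator measurableSet_ball]
  apply integral_mono ((hi _).sub (hi _))
  · rw [integrable_indicator_iff measurableSet_ball]
    exact hci.const_mul _
  intro x
  have hF := h.pow0 p x
  by_cases hx : x ∈ ball x1 (R / 2)
  · have e2 : F1 U p x1 (R / 2) x = U x ^ p := Set.indicator_of_mem hx _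
    simp only [Set.indicator_of_mem hx, Pi.sub_apply, e2]
    have e3 : eps p (U x1) / r * (U x ^ p * (‖x - x1‖ / eps p (U x1))) = U x ^ p * (‖x - x1‖ / r) := by
      field_simp
    rw [e3]
    rcases lt_or_ge ‖x - x1‖ r with h1 | h1
    · rw [F1_of x h1, sub_self]; positivity
    · rw [F1_out x h1, sub_zero]
      apply le_mul_of_one_le_right hF
      rwa [one_le_div hr]
  · have hx' : R / 2 ≤ ‖x - x1‖ := by rw [mem_ball, dist_eq_norm, not_lt] at hx; exact hx
    simp only [Set.indicator_of_notMem hx, Pi.sub_apply, F1_out x hx', F1_out x (hrR.trans hx'), sub_self, le_refl]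

end PD

namespace PD
variable {D p : ℝ} {U w : E2 → ℝ} {x1 : E2} {c R C : ℝ}

/-- Scaled tail mass bound. -/
lemma tail_scaled (h : PD D p U w x1 c R) {r : ℝ} (hr : 0 < r) (hrR : r ≤ R / 2) (hC : 0 ≤ C)
    (he : p * eps p (U x1) ≤ 1)
    (h1 : p * (∫ x in ball x1 (R / 2), U x ^ p * (‖x - x1‖ / eps p (U x1))) ≤ C) :
    p * (mb U p x1 (R / 2) - mb U p x1 r) ≤ (C / r) / p := by
  have hp := h.hp0
  have hε : 0 < eps p (U x1) := h.eps0
  have ht := h.tail_r hr hrR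
  set I := ∫ x in ball x1 (R / 2), U x ^ p * (‖x - x1‖ / eps p (U x1)) with hI
  rw [le_div_iff₀ hp]
  calc p * (mb U p x1 (R / 2) - mb U p x1 r) * p ≤ p * (eps p (U x1) / r * I) * p := by gcongr
    _ = (p * eps p (U x1)) * ((p * I) / r) := by ring
    _ ≤ (p * eps p (U x1)) * (C / r) := by gcongr
    _ ≤ 1 * (C / r) := by gcongr
    _ = _ := one_mul _

end PD

lemma quad_solve {a M B p : ℝ} (ha : 37 ≤ a) (hp : 0 < p) (hB : 0 ≤ B)
    (h : |a ^ 2 / (4 * π) - 2 * M * a| ≤ B / p) : |a - 8 * π * M| ≤ B / p := by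
  have hpi := Real.pi_pos
  have hpi2 := Real.pi_lt_d2
  have e : a ^ 2 / (4 * π) - 2 * M * a = a / (4 * π) * (a - 8 * π * M) := by
    field_simp
    ring
  rw [e, abs_mul, abs_of_nonneg (by positivity)] at h
  have h1 : 1 ≤ a / (4 * π) := by
    rw [one_le_div (by positivity)]; linarith
  exact (le_mul_of_one_le_left (abs_nonneg _) h1).trans h

set_option maxHeartbeats 1000000 in
/-- Consequence of the Pohozaev identity: mass versus height. -/
lemma mass_height (D : ℝ) {R : ℝ} (hR : 0 < R) :
    ∃ κ > 0, κ ≤ 1 ∧ ∃ C ≥ 0, ∀ᶠ p : ℝ in atTop, ∀ (U w : E2 → ℝ) (x1 : E2) (c : ℝ),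
    PD D p U w x1 c R → p * ∫ x, U x ^ (p + 1) ≤ 8 * π * Real.exp 1 + κ →
    (3 / 2 ≤ U x1 ∧ U x1 ≤ 2 ∧ p * (∫ x, U x ^ p) ≤ 45) ∧
    p * eps p (U x1) ≤ 1 ∧
    p * (∫ x in ball x1 (R / 2), U x ^ p * (‖x - x1‖ / eps p (U x1))) ≤ C ∧
    p * ((∫ x, U x ^ p) - mb U p x1 (R / 2)) ≤ C / p ∧
    |p * (∫ x, U x ^ p) - 8 * π * U x1| ≤ C / p := by
  obtain ⟨κ, hκ, hκ1, C, hC, e⟩ := bounds D hR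
  obtain ⟨L, L2, hL, hL2, hXf⟩ := exists_X (Λ := 2) (by norm_num)
  have hpi := Real.pi_pos
  have hpi3 := Real.pi_gt_three
  set C1 : ℝ := C / (R / 4) with hC1
  have hC10 : 0 ≤ C1 := by positivity
  set B : ℝ := 90 * (C + L * C1) + L2 * 2 * C1 + 4 / R * 45 * C + 180 + 2 * C with hB
  have hB0 : 0 ≤ B := by positivity
  refine ⟨κ, hκ, hκ1, B + C + C1, by positivity, ?_⟩
  filter_upwards [e, eventually_ge_atTop 1, eventually_ge_atTop (C + C1)] with p g hp1 hpC U w x1 c h hE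
  obtain ⟨⟨b1, b2, b3, b4⟩, he, i1, i2, i3⟩ := g U w x1 c h hE
  have hp0 := h.hp0
  have hM := h.M0
  have hε : 0 < eps p (U x1) := h.eps0
  have hr : 0 < R / 4 := by positivity
  obtain ⟨X, hX⟩ := hXf x1 (R / 4) hr
  have hP := h.poho_scaled hr (by norm_num) hL hL2 hX (by linarith) b3
  have hT := h.tail_scaled hr (by linarith) hC he i1
  have e2 : 2 * (R / 4) = R / 2 := by ring
  rw [e2] at hP
  have hmono := h.mb_mono (show R / 4 ≤ R / 2 by linarith)
  have hle := h.mb_le (R / 2)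
  have i2' : p * (∫ x, U x ^ p * (U x1 - U x)) ≤ C / p := by rw [le_div_iff₀ hp0]; linarith
  have i3' : p * ((∫ x, U x ^ p) - mb U p x1 (R / 2)) ≤ C / p := by rw [le_div_iff₀ hp0]; linarith
  have i4 : p * (∫ x in ball x1 (R / 2), U x ^ p * ‖x - x1‖) ≤ C / p := by
    have e3 : ∫ x in ball x1 (R / 2), U x ^ p * ‖x - x1‖
        = eps p (U x1) * ∫ x in ball x1 (R / 2), U x ^ p * (‖x - x1‖ / eps p (U x1)) := by
      rw [← integral_const_mul]
      congr 1
      ext x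
      field_simp
    rw [e3, le_div_iff₀ hp0]
    have hI0 : 0 ≤ ∫ x in ball x1 (R / 2), U x ^ p * (‖x - x1‖ / eps p (U x1)) :=
      integral_nonneg fun x => mul_nonneg (h.pow0 p x) (by positivity)
    calc _ = (p * eps p (U x1)) * (p * ∫ x in ball x1 (R / 2), U x ^ p * (‖x - x1‖ / eps p (U x1))) := by ring
      _ ≤ 1 * C := mul_le_mul he i1 (by positivity) (by norm_num)
      _ = _ := one_mul _
  rw [← hC1] at hT
  set m := ∫ x, U x ^ p with hm
  set m2 := mb U p x1 (R / 2) with hm2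
  set m1 := mb U p x1 (R / 4) with hm1
  have z1 : 0 ≤ p * (m - m2) := mul_nonneg hp0.le (by linarith)
  have z2 : 0 ≤ p * (m2 - m1) := mul_nonneg hp0.le (by linarith)
  have hCp : (C + C1) / p ≤ 1 := by rw [div_le_one hp0]; exact hpC
  rw [add_div] at hCp
  have hpm : p * m - p * m1 = p * (m - m2) + p * (m2 - m1) := by ring
  have hQ : |(p * m1) ^ 2 / (4 * π) - 2 * U x1 * (p * m1)| ≤ B / p := by
    refine hP.trans ?_
    have f1 : 1 / (4 * π) * (2 * 45 * (p * (m - m2) / (2 - 1) + L * (p * (m2 - m1))))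
        ≤ 1 * (2 * 45 * (C / p / (2 - 1) + L * (C1 / p))) := by
      have hh : p * (m - m2) / (2 - 1) + L * (p * (m2 - m1)) ≤ C / p / (2 - 1) + L * (C1 / p) :=
        add_le_add (by norm_num; exact i3') (mul_le_mul_of_nonneg_left hT hL)
      have hh0 : 0 ≤ p * (m - m2) / (2 - 1) + L * (p * (m2 - m1)) :=
        add_nonneg (div_nonneg z1 (by norm_num)) (mul_nonneg hL z2)
      apply mul_le_mul _ _ (by positivity) (by norm_num)
      · rw [div_le_one (by positivity)]; linarith
      · gcongr
    have f2 : L2 * U x1 * (p * (m2 - m1)) ≤ L2 * 2 * (C1 / p) := by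
      gcongr
    have f3 : 1 / (2 * π) * (4 / R * 45 * (p * ∫ x in ball x1 (R / 2), U x ^ p * ‖x - x1‖))
        ≤ 1 * (4 / R * 45 * (C / p)) := by
      have hI0 : 0 ≤ ∫ x in ball x1 (R / 2), U x ^ p * ‖x - x1‖ :=
        integral_nonneg fun x => mul_nonneg (h.pow0 p x) (by positivity)
      apply mul_le_mul _ _ (by positivity) (by norm_num)
      · rw [div_le_one (by positivity)]; linarith
      · gcongr
    have f4 : 2 * (U x1 * 45) / p ≤ 2 * (2 * 45) / p := by gcongr
    have eB : B / p = 1 * (2 * 45 * (C / p / (2 - 1) + L * (C1 / p))) + L2 * 2 * (C1 / p)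
        + 1 * (4 / R * 45 * (C / p)) + 2 * (2 * 45) / p + 2 * (C / p) := by
      rw [hB]; ring
    rw [eB]
    linarith
  have ha : 37 ≤ p * m1 := by linarith
  have hS := quad_solve ha hp0 hB0 hQ
  refine ⟨⟨b1, b2, b3⟩, he, by linarith, ?_, ?_⟩
  · refine i3'.trans ?_
    gcongr; linarith
  · rw [add_div, add_div]
    rw [abs_le] at hS ⊢
    constructor <;> linarith

lemma log_ratio_bd {ε : ℝ} (hε : 0 < ε) (z : E2) (hz : z ≠ 0) :
    |Real.log (ε / ‖z‖)| ≤ ‖z‖ / ε + ε * K1 ε z := by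
  have hz0 := norm_pos_iff.2 hz
  have hK := K1_nonneg ε z
  rcases lt_or_ge ‖z‖ ε with h | h
  · rw [K1_of_lt h]
    have h1 : 1 ≤ ε / ‖z‖ := by rw [one_le_div hz0]; exact h.le
    rw [abs_of_nonneg (Real.log_nonneg h1)]
    have := Real.log_le_sub_one_of_pos (show 0 < ε / ‖z‖ by positivity)
    have h2 : 0 ≤ ‖z‖ / ε := by positivity
    rw [← div_eq_mul_inv]
    linarith
  · have h1 : 1 ≤ ‖z‖ / ε := by rw [one_le_div hε]; exact h
    have e : Real.log (ε / ‖z‖) = - Real.log (‖z‖ / ε) := by rw [← Real.log_inv, inv_div]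
    rw [e, abs_neg, abs_of_nonneg (Real.log_nonneg h1)]
    have := Real.log_le_sub_one_of_pos (show 0 < ‖z‖ / ε by positivity)
    have : 0 ≤ ε * K1 ε z := by positivity
    linarith

namespace PD
variable {D p : ℝ} {U w : E2 → ℝ} {x1 : E2} {c R C : ℝ}

lemma green_pt (h : PD D p U w x1 c R) (y : E2) (hy : x1 - y ≠ 0) :
    |Real.log (D / ‖x1 - y‖) * (- lap w y) - Real.log (D / eps p (U x1)) * F1 U p x1 (R / 2) y|
      ≤ (ball x1 (R / 2)).indicator (fun y => U y ^ p * (‖y - x1‖ / eps p (U x1))) y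
        + U x1 ^ p * eps p (U x1) * K1 (eps p (U x1)) (x1 - y)
        + |Real.log (2 * D / R)| * |(- lap w y)| := by
  have hε : 0 < eps p (U x1) := h.eps0
  have hD := h.hD0
  have hR := h.R0
  have hM := h.M0
  have hy0 := norm_pos_iff.2 hy
  set ε := eps p (U x1) with hεd
  have hK := K1_nonneg ε (x1 - y)
  have hF := h.pow0 p y
  have hFM := h.FM y
  have hL := mul_nonneg (abs_nonneg (Real.log (2 * D / R))) (abs_nonneg (- lap w y))
  have hMK : 0 ≤ U x1 ^ p * ε * K1 ε (x1 - y) := by positivity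
  by_cases hb : y ∈ ball x1 (R / 2)
  · have e1 : F1 U p x1 (R / 2) y = U y ^ p := Set.indicator_of_mem hb _
    have e2 : - lap w y = U y ^ p := (h.loc y (ball_subset_ball (by linarith) hb)).2
    rw [Set.indicator_of_mem hb, e1]
    have e3 : Real.log (D / ‖x1 - y‖) * (- lap w y) - Real.log (D / ε) * U y ^ p
        = U y ^ p * Real.log (ε / ‖x1 - y‖) := by
      rw [e2, Real.log_div hD.ne' hy0.ne', Real.log_div hD.ne' hε.ne', Real.log_div hε.ne' hy0.ne']
      ring
    rw [e3, abs_mul, abs_of_nonneg hF]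
    have h1 := mul_le_mul_of_nonneg_left (log_ratio_bd hε (x1 - y) hy) hF
    have h2 : U y ^ p * (ε * K1 ε (x1 - y)) ≤ U x1 ^ p * (ε * K1 ε (x1 - y)) := by gcongr
    rw [norm_sub_rev y x1]
    rw [mul_add] at h1
    linarith
  · rw [Set.indicator_of_notMem hb]
    rw [mem_ball, dist_eq_norm, not_lt, norm_sub_rev] at hb
    rw [F1_out y (by rw [norm_sub_rev]; exact hb), mul_zero, sub_zero, abs_mul]
    by_cases hq : - lap w y = 0
    · rw [hq, abs_zero, mul_zero, mul_zero]; linarith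
    have hyD := h.Q_supp hq
    have hxD := h.x1D
    have hle : ‖x1 - y‖ ≤ D := (norm_sub_le _ _).trans (by linarith)
    have h1 : 1 ≤ D / ‖x1 - y‖ := by rwa [one_le_div hy0]
    have h2 : Real.log (D / ‖x1 - y‖) ≤ Real.log (2 * D / R) := by
      apply Real.log_le_log (by positivity)
      rw [div_le_div_iff₀ hy0 hR]
      have := mul_le_mul_of_nonneg_left hb hD.le
      linarith
    have h3 : |Real.log (D / ‖x1 - y‖)| ≤ |Real.log (2 * D / R)| := by
      rw [abs_of_nonneg (Real.log_nonneg h1)]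
      exact h2.trans (le_abs_self _)
    have := mul_le_mul_of_nonneg_right h3 (abs_nonneg (- lap w y))
    linarith

lemma green_x1 (h : PD D p U w x1 c R) :
    |2 * π * (U x1 - c) - Real.log (D / eps p (U x1)) * mb U p x1 (R / 2)|
      ≤ (∫ x in ball x1 (R / 2), U x ^ p * (‖x - x1‖ / eps p (U x1)))
        + 2 * π * (U x1 / p) + |Real.log (2 * D / R)| * (2 * ∫ x, U x ^ p) := by
  have hε : 0 < eps p (U x1) := h.eps0
  have hpi := Real.pi_pos
  have hcont : Continuous fun x => U x ^ p * (‖x - x1‖ / eps p (U x1)) :=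
    (h.powc h.hp0).mul (by fun_prop)
  have hci : IntegrableOn (fun x => U x ^ p * (‖x - x1‖ / eps p (U x1))) (ball x1 (R / 2)) :=
    (hcont.continuousOn.integrableOn_compact (isCompact_closedBall x1 (R / 2))).mono_set
      ball_subset_closedBall
  have hi1 := (integrable_indicator_iff measurableSet_ball).2 hci
  have hi2 : Integrable (fun y => U x1 ^ p * eps p (U x1) * K1 (eps p (U x1)) (x1 - y)) :=
    ((K1_integrable _).comp_sub_left x1).const_mul _
  have hi3 : Integrable (fun y => |Real.log (2 * D / R)| * |(- lap w y)|) :=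
    h.QBB.abs.integrable.const_mul _
  have hiQ := (Ker.log_div h.hD0).integrable h.QBB x1
  have hiF : Integrable (fun y => Real.log (D / eps p (U x1)) * F1 U p x1 (R / 2) y) :=
    (h.F1BB' _).integrable.const_mul _
  have e1 : 2 * π * (U x1 - c) = ∫ y, Real.log (D / ‖x1 - y‖) * (- lap w y) := by
    rw [← h.wx1, rep1D h.w2 h.hc h.hD0 x1]
    field_simp
  have e2 : Real.log (D / eps p (U x1)) * mb U p x1 (R / 2)
      = ∫ y, Real.log (D / eps p (U x1)) * F1 U p x1 (R / 2) y := by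
    rw [integral_const_mul, F1_int]
  rw [e1, e2, ← integral_sub hiQ hiF, ← Real.norm_eq_abs]
  have key := norm_integral_le_of_norm_le ((hi1.add hi2).add hi3)
    (f := fun y => Real.log (D / ‖x1 - y‖) * (- lap w y) - Real.log (D / eps p (U x1)) * F1 U p x1 (R / 2) y)
    (by filter_upwards [ae_sub_ne x1] with y hy
        exact h.green_pt y hy)
  refine key.trans ?_
  rw [integral_add' (hi1.add hi2) hi3, integral_add' hi1 hi2, integral_indicator measurableSet_ball,
    integral_const_mul, integral_const_mul, integral_sub_left_eq_self (K1 (eps p (U x1))) volume x1,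
    K1_integral hε.le]
  have e3 : U x1 ^ p * eps p (U x1) * (2 * π * eps p (U x1)) = 2 * π * (U x1 / p) := by
    rw [← eps_sq h.hp0 h.M0]; ring
  rw [e3]
  have := mul_le_mul_of_nonneg_left h.Q_abs (abs_nonneg (Real.log (2 * D / R)))
  linarith

end PD

lemma M_sqrt_e {M : ℝ} (hM : 3 / 2 ≤ M) (hM2 : M ≤ 2) :
    |M - √(Real.exp 1)| ≤ |1 - 2 * Real.log M| := by
  have hM0 : 0 < M := by linarith
  obtain ⟨q1, q2⟩ := q_bounds
  have eq : √(Real.exp 1) = Real.exp (1 / 2) := by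
    rw [Real.sqrt_eq_rpow, ← Real.exp_mul]; norm_num
  set q := √(Real.exp 1) with hq
  have hq0 : 0 < q := by linarith
  have hlq : Real.log q = 1 / 2 := by rw [eq, Real.log_exp]
  have hA : Real.log M - Real.log q ≤ M / q - 1 := by
    rw [← Real.log_div hM0.ne' hq0.ne']; exact Real.log_le_sub_one_of_pos (by positivity)
  have hB : Real.log q - Real.log M ≤ q / M - 1 := by
    rw [← Real.log_div hq0.ne' hM0.ne']; exact Real.log_le_sub_one_of_pos (by positivity)
  rw [hlq] at hA hB
  rcases le_total q M with h | h
  · have h1 : M - q ≤ M * (Real.log M - 1 / 2) := by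
      have := mul_le_mul_of_nonneg_left hB hM0.le
      have e : M * (q / M - 1) = q - M := by field_simp
      rw [e] at this; linarith
    have h0 : 0 ≤ Real.log M - 1 / 2 := by
      rw [← hlq]; linarith [Real.log_le_log hq0 h]
    have h2 := mul_le_mul_of_nonneg_right hM2 h0
    rw [abs_of_nonneg (by linarith : 0 ≤ M - q), abs_of_nonpos (by linarith)]
    linarith
  · have h1 : q - M ≤ q * (1 / 2 - Real.log M) := by
      have := mul_le_mul_of_nonneg_left hA hq0.le
      have e : q * (M / q - 1) = M - q := by field_simp
      rw [e] at this; linarith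
    have h0 : 0 ≤ 1 / 2 - Real.log M := by
      rw [← hlq]; linarith [Real.log_le_log hM0 h]
    have h2 := mul_le_mul_of_nonneg_right (show q ≤ 2 by linarith) h0
    rw [abs_of_nonpos (by linarith : M - q ≤ 0), abs_of_nonneg (by linarith)]
    linarith

lemma arith1 {M c L m m2 p C K : ℝ} (hM1 : 3 / 2 ≤ M) (hM2 : M ≤ 2) (hp : 0 < p) (hc0 : 0 ≤ c)
    (hcp : c ≤ 1 / p) (hL0 : 0 ≤ L) (hL : L ≤ 2 * p) (hC : 0 ≤ C)
    (hg : |2 * π * (M - c) - L * m2| ≤ K / p) (h2 : p * (m - m2) ≤ C / p) (h20 : m2 ≤ m)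
    (hm : |p * m - 8 * π * M| ≤ C / p) :
    |1 - 4 * L / p| ≤ (K + 4 * C + 8) / p := by
  have hpi := Real.pi_gt_three
  have hpi2 := Real.pi_lt_d2
  have hK : 0 ≤ K / p := (abs_nonneg _).trans hg
  have a1 : |L * (m - m2)| ≤ 2 * C / p := by
    rw [abs_of_nonneg (mul_nonneg hL0 (by linarith))]
    calc L * (m - m2) ≤ (2 * p) * (m - m2) := mul_le_mul_of_nonneg_right hL (by linarith)
      _ = 2 * (p * (m - m2)) := by ring
      _ ≤ 2 * (C / p) := by linarith
      _ = _ := by ring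
  have a2 : |L / p * (p * m - 8 * π * M)| ≤ 2 * C / p := by
    rw [abs_mul, abs_of_nonneg (by positivity)]
    calc L / p * |p * m - 8 * π * M| ≤ 2 * (C / p) := by
          apply mul_le_mul _ hm (abs_nonneg _) (by norm_num)
          rw [div_le_iff₀ hp]; exact hL
      _ = _ := by ring
  have a3 : |2 * π * c| ≤ 8 / p := by
    rw [abs_of_nonneg (by positivity)]
    calc 2 * π * c ≤ 8 * (1 / p) := by
          apply mul_le_mul _ hcp hc0 (by norm_num)
          linarith
      _ = _ := by ring
  have e : 2 * π * M * (1 - 4 * L / p) = (2 * π * (M - c) - L * m2) - L * (m - m2)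
      + L / p * (p * m - 8 * π * M) + 2 * π * c := by
    field_simp; ring
  have h1 : 1 ≤ 2 * π * M := by
    have := mul_le_mul hpi.le hM1 (by norm_num) (by positivity)
    linarith
  calc |1 - 4 * L / p| ≤ 2 * π * M * |1 - 4 * L / p| := le_mul_of_one_le_left (abs_nonneg _) h1
    _ = |2 * π * M * (1 - 4 * L / p)| := by rw [abs_mul, abs_of_nonneg (by linarith : 0 ≤ 2 * π * M)]
    _ ≤ K / p + 2 * C / p + 2 * C / p + 8 / p := by
      rw [e]
      rw [abs_le] at hg a1 a2 a3 ⊢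
      constructor <;> linarith [hg.1, hg.2, a1.1, a1.2, a2.1, a2.2, a3.1, a3.2]
    _ = _ := by ring

lemma arith2 {M L D p K : ℝ} (hM1 : 3 / 2 ≤ M) (hM2 : M ≤ 2) (hp : 3 ≤ p)
    (hL : L = Real.log D + (Real.log p + (p - 1) * Real.log M) / 2) (hK : 0 ≤ K)
    (h : |1 - 4 * L / p| ≤ K / p) :
    |1 - 2 * Real.log M| ≤ (K + 4 * |Real.log D| + 4) * (Real.log p / p) := by
  have hp0 : 0 < p := by linarith
  have hl1 : 1 ≤ Real.log p := by
    rw [Real.le_log_iff_exp_le hp0]; linarith [Real.exp_one_lt_d9]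
  have hlM0 : 0 ≤ Real.log M := Real.log_nonneg (by linarith)
  have hlM1 : Real.log M ≤ 1 := by linarith [Real.log_le_sub_one_of_pos (show 0 < M by linarith)]
  have hD := abs_nonneg (Real.log D)
  have e : 1 - 2 * Real.log M = (1 - 4 * L / p) + (4 * Real.log D + 2 * Real.log p - 2 * Real.log M) / p := by
    rw [hL]; field_simp; ring
  have h2 : |(4 * Real.log D + 2 * Real.log p - 2 * Real.log M) / p|
      ≤ (4 * |Real.log D| + 2 * Real.log p + 2) / p := by
    rw [abs_div, abs_of_pos hp0]
    gcongr
    have := abs_le.1 (le_refl |Real.log D|)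
    rw [abs_le]; constructor <;> linarith
  rw [e]
  refine (abs_add_le _ _).trans ((add_le_add h h2).trans ?_)
  rw [← add_div, ← mul_div_assoc]
  gcongr
  have k1 : K * 1 ≤ K * Real.log p := by gcongr
  have k2 : |Real.log D| * 1 ≤ |Real.log D| * Real.log p := by gcongr
  linarith

set_option maxHeartbeats 1000000 in
/-- The expansion of the mass for one bubble. -/
lemma core (D : ℝ) {R r : ℝ} (hR : 0 < R) (hr : 0 < r) (hrR : r ≤ R / 2) :
    ∃ κ > 0, κ ≤ 1 ∧ ∃ C ≥ 0, ∀ᶠ p : ℝ in atTop, ∀ (U w : E2 → ℝ) (x1 : E2) (c : ℝ),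
    PD D p U w x1 c R → p * ∫ x, U x ^ (p + 1) ≤ 8 * π * Real.exp 1 + κ →
    |mb U p x1 r - 8 * π * √(Real.exp 1) / p| ≤ C * Real.log p / p ^ 2 := by
  obtain ⟨κ, hκ, hκ1, C, hC, e⟩ := mass_height D hR
  have hpi := Real.pi_pos
  have hpi2 := Real.pi_lt_d2
  set lR := |Real.log (2 * D / R)| with hlR
  have hlR0 : 0 ≤ lR := abs_nonneg _
  set K : ℝ := C + 16 + lR * 90 with hK
  set K2 : ℝ := K + 4 * C + 8 with hK2
  set K3 : ℝ := K2 + 4 * |Real.log D| + 4 with hK3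
  have hlD := abs_nonneg (Real.log D)
  have hK0 : 0 ≤ K := by positivity
  have hK20 : 0 ≤ K2 := by positivity
  have hK30 : 0 ≤ K3 := by positivity
  refine ⟨κ, hκ, hκ1, 2 * C + C / r + 8 * π * K3, by positivity, ?_⟩
  filter_upwards [e, eventually_ge_atTop 3, eventually_ge_atTop |Real.log D|] with p g hp3 hpD U w x1 c h hE
  obtain ⟨⟨b1, b2, b3⟩, he, i1, i2, i3⟩ := g U w x1 c h hE
  have hp0 := h.hp0
  have hg := h.green_x1
  have hT := h.tail_scaled hr hrR hC he i1
  have hmono := h.mb_mono hrR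
  have hle := h.mb_le (R / 2)
  have hel := eps_log hp0 h.M0 h.hD0
  have hlp : 1 ≤ Real.log p := by
    rw [Real.le_log_iff_exp_le hp0]; linarith [Real.exp_one_lt_d9]
  have hlpp : Real.log p ≤ p := by linarith [Real.log_le_sub_one_of_pos hp0]
  have hlM0 : 0 ≤ Real.log (U x1) := Real.log_nonneg (by linarith)
  have hlM1 : Real.log (U x1) ≤ 1 := by linarith [Real.log_le_sub_one_of_pos h.M0]
  have hlD0 : 0 ≤ Real.log D := Real.log_nonneg h.hD
  have hpM0 : 0 ≤ (p - 1) * Real.log (U x1) := mul_nonneg (by linarith) hlM0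
  have hpM1 : (p - 1) * Real.log (U x1) ≤ (p - 1) * 1 := by gcongr; linarith
  have hL0 : 0 ≤ Real.log (D / eps p (U x1)) := by rw [hel]; linarith
  have hL1 : Real.log (D / eps p (U x1)) ≤ 2 * p := by
    rw [hel]; linarith [le_abs_self (Real.log D)]
  have hgK : |2 * π * (U x1 - c) - Real.log (D / eps p (U x1)) * mb U p x1 (R / 2)| ≤ K / p := by
    refine hg.trans ?_
    have j1 : (∫ x in ball x1 (R / 2), U x ^ p * (‖x - x1‖ / eps p (U x1))) ≤ C / p := by
      rw [le_div_iff₀ hp0]; linarith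
    have j2 : 2 * π * (U x1 / p) ≤ 2 * 3.15 * (2 / p) := by gcongr
    have j3 : (∫ x, U x ^ p) ≤ 45 / p := by rw [le_div_iff₀ hp0]; linarith
    have j4 : lR * (2 * ∫ x, U x ^ p) ≤ lR * (2 * (45 / p)) := by gcongr
    have j5 : 0 ≤ 1 / p := by positivity
    have eK : K / p = C / p + 16 * (1 / p) + lR * (2 * (45 / p)) := by rw [hK]; ring
    have e6 : 2 * 3.15 * (2 / p) = 12.6 * (1 / p) := by ring
    rw [eK]
    linarith
  have s1 := arith1 b1 b2 hp0 h.c0 h.cp hL0 hL1 hC hgK i2 hle i3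
  have s2 := arith2 b1 b2 hp3 hel hK20 s1
  have s3 := (M_sqrt_e b1 b2).trans s2
  rw [← hK3] at s3
  set q := √(Real.exp 1) with hq
  set m := ∫ x, U x ^ p with hm
  set m2 := mb U p x1 (R / 2) with hm2
  set m1 := mb U p x1 r with hm1
  have z1 : 0 ≤ p * (m - m2) := mul_nonneg hp0.le (by linarith)
  have z2 : 0 ≤ p * (m2 - m1) := mul_nonneg hp0.le (by linarith)
  have s4 : |8 * π * (U x1 - q)| ≤ 8 * π * (K3 * (Real.log p / p)) := by
    rw [abs_mul, abs_of_nonneg (by positivity : 0 ≤ 8 * π)]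
    gcongr
  have s5 : |p * m1 - 8 * π * q| ≤ 2 * (C / p) + C / r / p + 8 * π * (K3 * (Real.log p / p)) := by
    have e1 : p * m1 - 8 * π * q = (p * m - 8 * π * U x1) - p * (m - m2) - p * (m2 - m1)
        + 8 * π * (U x1 - q) := by ring
    rw [e1]
    have hCp : 0 ≤ C / p := by positivity
    have hCr : 0 ≤ C / r / p := by positivity
    clear_value m m2 m1 K K2 K3 q lR
    rw [abs_le] at s4 i3 ⊢
    constructor <;> linarith [s4.1, s4.2, i3.1, i3.2]
  have e7 : m1 - 8 * π * q / p = (p * m1 - 8 * π * q) / p := by field_simp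
  rw [e7, abs_div, abs_of_pos hp0, div_le_iff₀ hp0]
  refine s5.trans ?_
  have e8 : (2 * C + C / r + 8 * π * K3) * Real.log p / p ^ 2 * p
      = 2 * (C * Real.log p / p) + (C / r) * Real.log p / p + 8 * π * (K3 * (Real.log p / p)) := by
    field_simp
  rw [e8]
  have k1 : C / p ≤ C * Real.log p / p := by
    gcongr; exact le_mul_of_one_le_right hC hlp
  have k2 : C / r / p ≤ (C / r) * Real.log p / p := by
    gcongr; exact le_mul_of_one_le_right (by positivity) hlp
  linarith

lemma lap_neg' (u : E2 → ℝ) (x : E2) : lap (fun y => - u y) x = - lap u x := by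
  unfold lap
  simp only [fderiv_fun_neg, ContinuousLinearMap.neg_apply, Finset.sum_neg_distrib]

lemma neg_sol {Ω : Set E2} {p : ℝ} {u : E2 → ℝ} (h : IsSolution Ω p u) :
    IsSolution Ω p (fun y => - u y) := by
  obtain ⟨h1, h2, h3, h4⟩ := h
  refine ⟨h1.neg, h2.neg, fun x hx => ?_, fun x hx => by simp [h4 x hx]⟩
  rw [lap_neg', abs_neg, h3 x hx]; ring

lemma ball_in {Ω : Set E2} (hΩ : IsOpen Ω) {x : E2} {r : ℝ} (hx : x ∈ Ω) (hr : 0 < r)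
    (h : ∀ y ∈ ball x r, y ∉ frontier Ω) : ball x r ⊆ Ω := by
  refine (convex_ball x r).isPreconnected.subset_of_closure_inter_subset hΩ
    ⟨x, mem_ball_self hr, hx⟩ fun y hy => ?_
  by_contra hn
  exact h y hy.2 (by rw [hΩ.frontier_eq]; exact ⟨hy.1, hn⟩)

lemma energy_split {Ω : Set E2} (hΩ : IsOpen Ω) {p : ℝ} (hp : 1 < p) {u : E2 → ℝ}
    (hi1 : Integrable (fun x => UU Ω u x ^ (p + 1)))
    (hi2 : Integrable (fun x => UU Ω (fun y => - u y) x ^ (p + 1))) :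
    ∫ x in Ω, |u x| ^ (p + 1) = (∫ x, UU Ω u x ^ (p + 1)) + ∫ x, UU Ω (fun y => - u y) x ^ (p + 1) := by
  rw [← integral_add hi1 hi2, ← integral_indicator hΩ.measurableSet]
  congr 1
  ext x
  have h0 : (0:ℝ) ^ (p + 1) = 0 := Real.zero_rpow (by linarith)
  by_cases hx : x ∈ Ω
  · simp only [UU, Set.indicator_of_mem hx]
    rcases le_total 0 (u x) with h | h
    · rw [abs_of_nonneg h, max_eq_left h, max_eq_right (by linarith), h0, add_zero]
    · rw [abs_of_nonpos h, max_eq_right h, max_eq_left (by linarith), h0, zero_add]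
  · simp only [UU, Set.indicator_of_notMem hx, h0, add_zero]

lemma mb_UU {Ω : Set E2} {p r : ℝ} {u : E2 → ℝ} {x1 : E2} (hb : ball x1 r ⊆ Ω)
    (hs : ∀ y ∈ ball x1 r, 0 ≤ u y) :
    mb (UU Ω u) p x1 r = ∫ y in ball x1 r, |u y| ^ p := by
  unfold mb
  apply setIntegral_congr_fun measurableSet_ball
  intro y hy
  simp only [UU, Set.indicator_of_mem (hb hy), max_eq_left (hs y hy), abs_of_nonneg (hs y hy)]

/-- Remark 3.11: `C_{i,p} = ∫_{B_ϱ(x_{i,p})}|u_p|^p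
= (8π√e/p)(1 + O(log p/p))`. -/
theorem mass_constant_expansion
    (Ω : Set E2) (hΩo : IsOpen Ω) (hΩb : IsBounded Ω) (hΩne : Ω.Nonempty)
    (p : ℕ → ℝ) (hp1 : ∀ n, 1 < p n) (hptop : Tendsto p atTop atTop)
    (u : ℕ → E2 → ℝ)
    (hsol : ∀ n, IsSolution Ω (p n) (u n))
    (hnod : ∀ n, IsNodal Ω (u n))
    (hlow : Tendsto (fun n => p n * ∫ x in Ω, |u n x| ^ (p n + 1)) atTop
      (𝓝 (16 * π * Real.exp 1)))
    (xl : Fin 2 → ℕ → E2)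
    (hmax : ∀ n, xl 0 n ∈ Ω ∧ ∀ y ∈ closure Ω, u n y ≤ u n (xl 0 n))
    (hmin : ∀ n, xl 1 n ∈ Ω ∧ ∀ y ∈ closure Ω, u n (xl 1 n) ≤ u n y)
    (x : Fin 2 → E2) (hx : ∀ i, x i ∈ Ω) (hxne : x 0 ≠ x 1)
    (hxconv : ∀ i, Tendsto (fun n => xl i n) atTop (𝓝 (x i)))
    (r0 : ℝ) (hr0 : 0 < r0)
    (hdisj : Disjoint (ball (x 0) (2 * r0)) (ball (x 1) (2 * r0)))
    (ϱ0 : ℝ) (hϱ0 : ϱ0 ∈ Set.Ioo (0:ℝ) (r0 / 2)) (N0 : ℕ)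
    (hsign : ∀ n ≥ N0,
      (∀ y ∈ ball (x 0) (2 * ϱ0), 1 / p n ≤ u n y) ∧
      (∀ y ∈ ball (x 1) (2 * ϱ0), u n y ≤ -(1 / p n)))
    (ϱ : ℝ) (hϱ : 0 < ϱ ∧ ϱ ≤ ϱ0 / 2) :
    ∃ C > (0:ℝ), ∃ N : ℕ, ∀ n ≥ N, ∀ i : Fin 2,
      |(∫ y in ball (xl i n) ϱ, |u n y| ^ (p n))
          - 8 * π * Real.sqrt (Real.exp 1) / p n|
        ≤ C * Real.log (p n) / (p n) ^ 2 := by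
  have hR : 0 < ϱ0 := hϱ0.1
  obtain ⟨s, hs⟩ := hΩb.subset_ball 0
  set D : ℝ := 2 * max s 1 with hD
  have hD1 : 1 ≤ D := by linarith [le_max_right s 1]
  have hΩD : Ω ⊆ ball 0 (D / 2) := hs.trans (ball_subset_ball (by linarith [le_max_left s 1]))
  obtain ⟨κ, hκ, hκ1, C, hC, ev⟩ := core D hR hϱ.1 hϱ.2
  have ev2 := E_ge D (16 * π * Real.exp 1 + 1) (half_pos hκ)
  have ev3 := hlow.eventually (eventually_le_nhds
    (show 16 * π * Real.exp 1 < 16 * π * Real.exp 1 + κ / 2 by linarith))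
  have hd : ∀ i, ∀ᶠ n in atTop, dist (xl i n) (x i) < ϱ0 := fun i =>
    (hxconv i).eventually (ball_mem_nhds (x i) hR)
  have main : ∀ᶠ n in atTop, ∀ i : Fin 2,
      |(∫ y in ball (xl i n) ϱ, |u n y| ^ (p n))
          - 8 * π * Real.sqrt (Real.exp 1) / p n|
        ≤ C * Real.log (p n) / (p n) ^ 2 := by
    filter_upwards [hptop.eventually ev, hptop.eventually ev2, ev3, hd 0, hd 1,
      eventually_ge_atTop N0] with n g1 g2 g3 d0 d1 hn
    obtain ⟨s0, s1⟩ := hsign n hn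
    have hpn := hp1 n
    have hp0 : 0 < p n := by linarith
    have hinv : 0 < 1 / p n := by positivity
    have hz := (hsol n).2.2.2
    have B0 : ball (x 0) (2 * ϱ0) ⊆ Ω := ball_in hΩo (hx 0) (by linarith) fun y hy hf => by
      have := s0 y hy; rw [hz y hf] at this; linarith
    have B1 : ball (x 1) (2 * ϱ0) ⊆ Ω := ball_in hΩo (hx 1) (by linarith) fun y hy hf => by
      have := s1 y hy; rw [hz y hf] at this; linarith
    have b0 : ball (xl 0 n) ϱ0 ⊆ ball (x 0) (2 * ϱ0) := ball_subset_ball' (by linarith)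
    have b1 : ball (xl 1 n) ϱ0 ⊆ ball (x 1) (2 * ϱ0) := ball_subset_ball' (by linarith)
    have t0 : ∀ y ∈ ball (xl 0 n) ϱ0, 1 / p n ≤ u n y := fun y hy => s0 y (b0 hy)
    have t1 : ∀ y ∈ ball (xl 1 n) ϱ0, 1 / p n ≤ - u n y := fun y hy => by
      linarith [s1 y (b1 hy)]
    obtain ⟨w0, c0, P0⟩ := exists_PD hΩo hpn (hsol n) (hmax n).1 (hmax n).2
      (hinv.trans_le (t0 _ (mem_ball_self hR))) hR (b0.trans B0) t0 hD1 hΩD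
    obtain ⟨w1, c1, P1⟩ := exists_PD hΩo hpn (neg_sol (hsol n)) (hmin n).1
      (fun y hy => neg_le_neg ((hmin n).2 y hy))
      (hinv.trans_le (t1 _ (mem_ball_self hR))) hR (b1.trans B1) t1 hD1 hΩD
    have hsplit := energy_split hΩo hpn P0.EBB.integrable P1.EBB.integrable
    rw [hsplit, mul_add] at g3
    have p0 := mul_pos hp0 P0.E0
    have p1 := mul_pos hp0 P1.E0
    have l0 := g2 _ _ _ _ _ P0 (by linarith)
    have l1 := g2 _ _ _ _ _ P1 (by linarith)
    have r0 := g1 _ _ _ _ P0 (by linarith)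
    have r1 := g1 _ _ _ _ P1 (by linarith)
    have hbb : ∀ i, ball (xl i n) ϱ ⊆ ball (xl i n) ϱ0 := fun i =>
      ball_subset_ball (by linarith [hϱ.2])
    rw [mb_UU ((hbb 0).trans (b0.trans B0)) fun y hy => hinv.le.trans (t0 y (hbb 0 hy))] at r0
    rw [mb_UU ((hbb 1).trans (b1.trans B1)) fun y hy => hinv.le.trans (t1 y (hbb 1 hy))] at r1
    simp only [abs_neg] at r1
    intro i
    fin_cases i
    · exact r0
    · exact r1
  obtain ⟨N, hN⟩ := eventually_atTop.1 main
  refine ⟨C + 1, by linarith, N, fun n hn i => (hN n hn i).trans ?_⟩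
  have hlog : 0 ≤ Real.log (p n) := Real.log_nonneg (hp1 n).le
  gcongr
  linarith

end
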